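/- arXiv:math/0002207 — 4 statements merged into one kernel-verified Lean document; each statement's English description precedes it below -/
import Mathlib

section
/- Let n > 0 and let 0 < d < n. For every d-dimensional linear subspace E of ℂ^n there exists s ∈ ℂ such that E ∩ F_{n-d}(s) = {0}. (Equivalently, the intersection over all s ∈ ℂ of the simple Schubert varieties {E : E ∩ F_{n-d}(s) ≠ {0}} of the Grassmannian of d-planes in ℂ^n is empty.) -/
/-- The `j`-th coordinatewise derivative at `s` of the rational normal curve
`γ(s) = (1, s, s², …, s^{n-1})` in `ℂⁿ`. -/
noncomputable def oscVec (n : ℕ) (j : ℕ) (s : ℂ) : Fin n → ℂ :=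
  fun i => iteratedDeriv j (fun t : ℂ => t ^ (i : ℕ)) s

/-- The osculating subspace `F_k(s) = span{γ(s), γ'(s), …, γ^{(k-1)}(s)}`. -/
noncomputable def oscF (n k : ℕ) (s : ℂ) : Submodule ℂ (Fin n → ℂ) :=
  Submodule.span ℂ (Set.range fun j : Fin k => oscVec n j s)

open Polynomial in
/-- If the Wronskian of `f` and `g` vanishes and `g` has a root which is not a root of `f`,
then `g = 0`. -/
theorem eq_zero_of_wronskian_eq_zero_of_isRoot {f g : ℂ[X]} {s : ℂ}
    (hW : f * derivative g - derivative f * g = 0) (hf : ¬ f.IsRoot s) (hg : g.IsRoot s) :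
    g = 0 := by
  by_contra hg0
  have hg' : derivative g ≠ 0 := by
    intro h
    have h1 := derivative_eq_zero.1 h
    rw [eq_C_of_natDegree_eq_zero h1] at hg hg0
    simp_all
  have hf0 : f ≠ 0 := by
    rintro rfl
    simp at hf
  have h1 := derivative_rootMultiplicity_of_root hg
  have h2 : 0 < g.rootMultiplicity s := (rootMultiplicity_pos hg0).2 hg
  have h3 : f.rootMultiplicity s = 0 := rootMultiplicity_eq_zero hf
  have h4 := rootMultiplicity_mul (x := s) (mul_ne_zero hf0 hg')
  have h5 : g.rootMultiplicity s ≤ (f * derivative g).rootMultiplicity s := by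
    rw [le_rootMultiplicity_iff (mul_ne_zero hf0 hg'), sub_eq_zero.1 hW]
    exact (pow_rootMultiplicity_dvd g s).mul_left _
  omega

open Polynomial in
/-- An `m`-dimensional space of polynomials contains, for all but finitely many `s`, no nonzero
polynomial vanishing to order at least `m` at `s`. -/
theorem finite_setOf_exists_pow_dvd (m : ℕ) (V : Submodule ℂ ℂ[X]) [FiniteDimensional ℂ V]
    (hV : Module.finrank ℂ V ≤ m) :
    {s : ℂ | ∃ g ∈ V, g ≠ 0 ∧ (X - C s) ^ m ∣ g}.Finite := by
  induction m generalizing V with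
  | zero =>
    have h : V = ⊥ := Submodule.finrank_eq_zero.1 (Nat.le_zero.1 hV)
    subst h
    convert Set.finite_empty
    ext s
    simp
  | succ m ih =>
    by_cases hbot : V = ⊥
    · subst hbot
      convert Set.finite_empty
      ext s
      simp
    obtain ⟨f, hfV, hf0⟩ := V.ne_bot_iff.1 hbot
    let W : ℂ[X] →ₗ[ℂ] ℂ[X] :=
      LinearMap.mulLeft ℂ f ∘ₗ derivative - LinearMap.mulLeft ℂ (derivative f)
    have hW (g : ℂ[X]) : W g = f * derivative g - derivative f * g := rfl
    have hrank : Module.finrank ℂ (V.map W) ≤ m := by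
      have h1 := (W.domRestrict V).finrank_range_add_finrank_ker
      rw [LinearMap.range_domRestrict] at h1
      have h2 : 0 < Module.finrank ℂ (LinearMap.ker (W.domRestrict V)) := by
        rw [Nat.pos_iff_ne_zero, Ne, Submodule.finrank_eq_zero]
        refine (Submodule.ne_bot_iff _).2 ⟨⟨f, hfV⟩, ?_, by simpa using hf0⟩
        rw [LinearMap.mem_ker, LinearMap.domRestrict_apply, hW, mul_comm, sub_self]
      omega
    refine ((ih (V.map W) hrank).union (finite_setOfPred_isRoot hf0)).subset ?_
    rintro s ⟨g, hgV, hg0, hdvd⟩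
    by_cases hs : f.IsRoot s
    · exact Or.inr hs
    refine Or.inl ⟨W g, Submodule.mem_map_of_mem hgV, fun h => hg0 ?_, ?_⟩
    · exact eq_zero_of_wronskian_eq_zero_of_isRoot h hs
        (dvd_iff_isRoot.1 ((dvd_pow_self _ m.succ_ne_zero).trans hdvd))
    · rw [hW]
      exact dvd_sub ((pow_sub_one_dvd_derivative_of_pow_dvd hdvd).mul_left _)
        (((pow_dvd_pow _ m.le_succ).trans hdvd).mul_left _)

open Polynomial in
/-- The polynomial `φ(γ(X))` obtained by applying the linear form `φ` to the rational normal
curve. -/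
noncomputable def curvePoly (n : ℕ) : Module.Dual ℂ (Fin n → ℂ) →ₗ[ℂ] ℂ[X] :=
  ∑ i : Fin n, (monomial (i : ℕ)) ∘ₗ Module.Dual.eval ℂ _ (Pi.single i 1)

open Polynomial in
theorem curvePoly_apply (n : ℕ) (φ : Module.Dual ℂ (Fin n → ℂ)) :
    curvePoly n φ = ∑ i : Fin n, C (φ (Pi.single i 1)) * X ^ (i : ℕ) := by
  simp [curvePoly, C_mul_X_pow_eq_monomial]

theorem curvePoly_injective (n : ℕ) : Function.Injective (curvePoly n) := by
  refine (injective_iff_map_eq_zero _).2 fun φ h => ?_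
  refine LinearMap.pi_ext' fun i => LinearMap.ext_ring ?_
  have h1 := congrArg (fun p => Polynomial.coeff p (i : ℕ)) h
  simpa [curvePoly_apply, Polynomial.finsetSum_coeff, Polynomial.coeff_C_mul,
    Polynomial.coeff_X_pow, Fin.val_inj] using h1

open Polynomial in
theorem eval_iterate_derivative_curvePoly (n j : ℕ) (φ : Module.Dual ℂ (Fin n → ℂ)) (s : ℂ) :
    (derivative^[j] (curvePoly n φ)).eval s = φ (oscVec n j s) := by
  rw [LinearMap.pi_apply_eq_sum_univ φ, curvePoly_apply, iterate_derivative_sum, eval_finsetSum]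
  refine Finset.sum_congr rfl fun i _ => ?_
  rw [iterate_derivative_C_mul, eval_C_mul, smul_eq_mul, mul_comm]
  congr 1
  · simp [oscVec, iterate_derivative_X_pow_eq_natCast_mul]
  · congr 1
    ext k
    simp [Pi.single_apply, eq_comm]

/-- For `0 < d < n` and any `d`-dimensional subspace `E` of `ℂⁿ`, there is `s ∈ ℂ` with
`E ∩ F_{n−d}(s) = {0}`; i.e. the intersection over all `s` of the simple Schubert varieties
`{E : E ∩ F_{n−d}(s) ≠ 0}` is empty. -/
theorem stmt_0 (n d : ℕ) (hn : 0 < n) (hd : 0 < d) (hdn : d < n)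
    (E : Submodule ℂ (Fin n → ℂ)) (hE : Module.finrank ℂ E = d) :
    ∃ s : ℂ, E ⊓ oscF n (n - d) s = ⊥ := by
  have hann : Module.finrank ℂ E.dualAnnihilator ≤ n - d := by
    have := Subspace.finrank_add_finrank_dualAnnihilator_eq E
    rw [hE, Module.finrank_fin_fun] at this
    omega
  obtain ⟨s, hs⟩ := (finite_setOf_exists_pow_dvd (n - d) (E.dualAnnihilator.map (curvePoly n))
    ((Submodule.finrank_map_le _ _).trans hann)).infinite_compl.nonempty
  refine ⟨s, ?_⟩
  have hsup : E ⊔ oscF n (n - d) s = ⊤ := by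
    by_contra hne
    obtain ⟨φ, hφ0, hφ⟩ := Submodule.exists_le_ker_of_lt_top _ (lt_top_iff_ne_top.2 hne)
    have hp : curvePoly n φ ≠ 0 := (map_ne_zero_iff _ (curvePoly_injective n)).2 hφ0
    refine hs ⟨_, Submodule.mem_map_of_mem
      ((Submodule.mem_dualAnnihilator φ).2 fun w hw => hφ (Submodule.mem_sup_left hw)), hp, ?_⟩
    rw [← Polynomial.le_rootMultiplicity_iff hp]
    refine Nat.le_of_pred_lt
      ((Polynomial.lt_rootMultiplicity_iff_isRoot_iterate_derivative hp).2 ?_)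
    intro j hj
    replace hj : j < n - d := by rw [Nat.pred_eq_sub_one] at hj; omega
    rw [Polynomial.IsRoot, eval_iterate_derivative_curvePoly]
    exact hφ (Submodule.mem_sup_right (Submodule.subset_span ⟨⟨j, hj⟩, rfl⟩))
  have hF : Module.finrank ℂ (oscF n (n - d) s) ≤ n - d :=
    (finrank_range_le_card _).trans_eq (Fintype.card_fin _)
  have h := Submodule.finrank_sup_add_finrank_inf_eq E (oscF n (n - d) s)
  rw [hsup, finrank_top, Module.finrank_fin_fun, hE] at h
  exact Submodule.finrank_eq_zero.1 (by omega)
end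

section
/- Let n ≥ 1 and define γ : ℝ → ℝ^{2n+1} by letting the i-th coordinate of γ(s) be (−1)^{max(i−n−1,0)} s^{i−1}/(i−1)! for 1 ≤ i ≤ 2n+1. Then for every s ∈ ℝ and all integers a, b ≥ 0 with a + b ≤ 2n − 1, one has Σ_{i=1}^{2n+1} γ^{(a)}(s)_i · γ^{(b)}(s)_{2n+2−i} = 0, where γ^{(a)} denotes the a-th coordinatewise derivative. Consequently, for each s the flag of osculating subspaces F_k(s) = span{γ(s), …, γ^{(k-1)}(s)} is an isotropic flag for the symmetric bilinear form B(x,y) = Σ_{i=1}^{2n+1} x_i y_{2n+2−i}: F_n(s) is isotropic and B vanishes identically on F_i(s) × F_{2n+1−i}(s) for every i. -/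
/-- The `i`-th coordinate function of the curve `γ : ℝ → ℝ^{2n+1}`,
`γ(s)_i = (−1)^{max(i−n−1,0)} s^{i−1}/(i−1)!` (here `i : Fin (2n+1)` is the 0-indexed
version of the 1-indexed coordinate). -/
noncomputable def gammaOdd (n : ℕ) (i : Fin (2 * n + 1)) : ℝ → ℝ :=
  fun s => (-1 : ℝ) ^ ((i : ℕ) - n) * s ^ (i : ℕ) / (Nat.factorial (i : ℕ))

/-- The index pairing `i ↦ 2n+2−i` (1-indexed), i.e. `i ↦ 2n−i` (0-indexed). -/
def pairOdd (n : ℕ) (i : Fin (2 * n + 1)) : Fin (2 * n + 1) :=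
  ⟨2 * n - (i : ℕ), by omega⟩

/-- The symmetric bilinear form `B(x,y) = Σ_{i=1}^{2n+1} x_i y_{2n+2−i}` on `ℝ^{2n+1}`. -/
def formOdd (n : ℕ) (x y : Fin (2 * n + 1) → ℝ) : ℝ :=
  ∑ i, x i * y (pairOdd n i)

/-- The osculating subspace `F_k(s) = span{γ(s), γ'(s), …, γ^{(k-1)}(s)}`,
derivatives taken coordinatewise. -/
noncomputable def oscOdd (n k : ℕ) (s : ℝ) : Submodule ℝ (Fin (2 * n + 1) → ℝ) :=
  Submodule.span ℝ (Set.range fun j : Fin k => fun i => iteratedDeriv (j : ℕ) (gammaOdd n i) s)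

theorem iteratedDeriv_pow_div_factorial (m k : ℕ) (s : ℝ) :
    iteratedDeriv k (fun x : ℝ => x ^ m / (m.factorial : ℝ)) s =
      if k ≤ m then s ^ (m - k) / ((m - k).factorial : ℝ) else 0 := by
  rw [iteratedDeriv_div_const, iteratedDeriv_pow]
  split_ifs with h
  · rw [← Nat.factorial_mul_descFactorial h]
    have h₁ : ((m - k).factorial : ℝ) ≠ 0 := mod_cast Nat.factorial_ne_zero _
    have h₂ : (m.descFactorial k : ℝ) ≠ 0 := by
      rw [Nat.cast_ne_zero, Ne, Nat.descFactorial_eq_zero_iff_lt]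
      omega
    push_cast
    field_simp
  · simp [Nat.descFactorial_eq_zero_iff_lt.mpr (not_le.mp h)]

theorem iteratedDeriv_gammaOdd (n k : ℕ) (i : Fin (2 * n + 1)) (s : ℝ) :
    iteratedDeriv k (gammaOdd n i) s = (-1) ^ ((i : ℕ) - n) *
      if k ≤ (i : ℕ) then s ^ ((i : ℕ) - k) / (((i : ℕ) - k).factorial : ℝ) else 0 := by
  rw [← iteratedDeriv_pow_div_factorial, ← iteratedDeriv_const_mul_field]
  congr 1
  funext x
  rw [gammaOdd, mul_div_assoc]

theorem sum_alternating_inv_factorial {m : ℕ} (hm : m ≠ 0) :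
    ∑ j ∈ Finset.range (m + 1),
      (-1 : ℝ) ^ j / ((j.factorial : ℝ) * ((m - j).factorial : ℝ)) = 0 := by
  have h : ∑ j ∈ Finset.range (m + 1), (-1 : ℝ) ^ j * (m.choose j : ℝ) = 0 := by
    exact_mod_cast Int.alternating_sum_range_choose_of_ne hm
  have hf : (m.factorial : ℝ) ≠ 0 := mod_cast m.factorial_ne_zero
  refine (mul_eq_zero.mp ?_).resolve_left hf
  rw [← h, Finset.mul_sum]
  refine Finset.sum_congr rfl fun j hj => ?_
  rw [Nat.cast_choose ℝ (Nat.lt_succ_iff.mp (Finset.mem_range.mp hj))]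
  ring

theorem neg_one_pow_sub_mul_neg_one_pow_sub (n i : ℕ) :
    (-1 : ℝ) ^ (i - n) * (-1) ^ (2 * n - i - n) = (-1) ^ (n + i) := by
  rw [← pow_add, neg_one_pow_eq_pow_mod_two, neg_one_pow_eq_pow_mod_two (n := n + i)]
  congr 1
  omega

theorem sum_iteratedDeriv_gammaOdd_mul {n a b : ℕ} (hab : a + b < 2 * n) (s : ℝ) :
    ∑ i : Fin (2 * n + 1),
      iteratedDeriv a (gammaOdd n i) s * iteratedDeriv b (gammaOdd n (pairOdd n i)) s = 0 := by
  simp only [iteratedDeriv_gammaOdd, pairOdd]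
  rw [Fin.sum_univ_eq_sum_range (fun i : ℕ =>
    ((-1) ^ (i - n) * if a ≤ i then s ^ (i - a) / ((i - a).factorial : ℝ) else 0) *
    ((-1) ^ (2 * n - i - n) *
      if b ≤ 2 * n - i then s ^ (2 * n - i - b) / ((2 * n - i - b).factorial : ℝ) else 0))]
  have hsub : Finset.Ico a (2 * n - b + 1) ⊆ Finset.range (2 * n + 1) := fun i hi => by
    simp only [Finset.mem_Ico, Finset.mem_range] at hi ⊢
    omega
  rw [← Finset.sum_subset hsub, Finset.sum_Ico_eq_sum_range,
    show 2 * n - b + 1 - a = 2 * n - (a + b) + 1 by omega]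
  · set m := 2 * n - (a + b) with hm
    trans ∑ j ∈ Finset.range (m + 1), (-1) ^ (n + a) * s ^ m *
      ((-1 : ℝ) ^ j / ((j.factorial : ℝ) * ((m - j).factorial : ℝ)))
    · refine Finset.sum_congr rfl fun j hj => ?_
      rw [Finset.mem_range] at hj
      rw [if_pos (by omega), if_pos (by omega), mul_mul_mul_comm,
        neg_one_pow_sub_mul_neg_one_pow_sub, show a + j - a = j by omega,
        show 2 * n - (a + j) - b = m - j by omega, ← pow_mul_pow_sub s (show j ≤ m by omega)]
      ring
    · rw [← Finset.mul_sum, sum_alternating_inv_factorial (by omega), mul_zero]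
  · intro i hi hi'
    simp only [Finset.mem_Ico, Finset.mem_range] at hi hi'
    by_cases h : a ≤ i
    · rw [if_neg (show ¬ b ≤ 2 * n - i by omega), mul_zero, mul_zero]
    · rw [if_neg h, mul_zero, zero_mul]

theorem formOdd_eq_zero_of_mem_span {n : ℕ} {S T : Set (Fin (2 * n + 1) → ℝ)}
    (h : ∀ x ∈ S, ∀ y ∈ T, formOdd n x y = 0) {x y : Fin (2 * n + 1) → ℝ}
    (hx : x ∈ Submodule.span ℝ S) (hy : y ∈ Submodule.span ℝ T) : formOdd n x y = 0 := by
  induction hx, hy using Submodule.span_induction₂ with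
  | mem_mem x y hx hy => exact h x hx y hy
  | zero_left y hy => simp [formOdd]
  | zero_right x hx => simp [formOdd]
  | add_left x y z _ _ _ h₁ h₂ =>
    simp only [formOdd, Pi.add_apply, add_mul, Finset.sum_add_distrib] at *
    rw [h₁, h₂, add_zero]
  | add_right x y z _ _ _ h₁ h₂ =>
    simp only [formOdd, Pi.add_apply, mul_add, Finset.sum_add_distrib] at *
    rw [h₁, h₂, add_zero]
  | smul_left r x y _ _ h₁ =>
    simp only [formOdd, Pi.smul_apply, smul_eq_mul, mul_assoc, ← Finset.mul_sum] at *
    rw [h₁, mul_zero]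
  | smul_right r x y _ _ h₁ =>
    simp only [formOdd, Pi.smul_apply, smul_eq_mul, mul_left_comm _ r, ← Finset.mul_sum] at *
    rw [h₁, mul_zero]

theorem formOdd_eq_zero_of_mem_oscOdd {n k l : ℕ} (hkl : k + l ≤ 2 * n + 1) {s : ℝ}
    {x y : Fin (2 * n + 1) → ℝ} (hx : x ∈ oscOdd n k s) (hy : y ∈ oscOdd n l s) :
    formOdd n x y = 0 := by
  refine formOdd_eq_zero_of_mem_span ?_ hx hy
  rintro _ ⟨a, rfl⟩ _ ⟨b, rfl⟩
  exact sum_iteratedDeriv_gammaOdd_mul (by omega) s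

/-- For `n ≥ 1`: the derivatives of the curve `γ` satisfy
`Σ_i γ^{(a)}(s)_i γ^{(b)}(s)_{2n+2−i} = 0` whenever `a + b ≤ 2n − 1`; consequently each
osculating flag `F_•(s)` is isotropic for `B`: `F_n(s)` is isotropic and `B` vanishes
identically on `F_i(s) × F_{2n+1−i}(s)` for every `i`. -/
theorem stmt_1 (n : ℕ) (hn : 1 ≤ n) :
    (∀ s : ℝ, ∀ a b : ℕ, a + b ≤ 2 * n - 1 →
        ∑ i : Fin (2 * n + 1),
          iteratedDeriv a (gammaOdd n i) s * iteratedDeriv b (gammaOdd n (pairOdd n i)) s = 0) ∧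
      ∀ s : ℝ,
        (∀ x ∈ oscOdd n n s, ∀ y ∈ oscOdd n n s, formOdd n x y = 0) ∧
          ∀ i : ℕ, ∀ x ∈ oscOdd n i s, ∀ y ∈ oscOdd n (2 * n + 1 - i) s, formOdd n x y = 0 := by
  refine ⟨fun s a b hab => sum_iteratedDeriv_gammaOdd_mul (by omega) s, fun s =>
    ⟨fun x hx y hy => formOdd_eq_zero_of_mem_oscOdd (by omega) hx hy, fun i x hx y hy => ?_⟩⟩
  obtain hi | hi := le_or_gt i (2 * n + 1)
  · exact formOdd_eq_zero_of_mem_oscOdd (by omega) hx hy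
  · have hy₀ : y = 0 := by
      rw [show 2 * n + 1 - i = 0 by omega] at hy
      simpa [oscOdd] using hy
    simp [hy₀, formOdd]
end

section
/- Let n ≥ 1 and define γ : ℝ → ℝ^{2n} by letting the i-th coordinate of γ(s) be (−1)^{max(i−n−1,0)} s^{i−1}/(i−1)! for 1 ≤ i ≤ 2n. Then for every s ∈ ℝ and all integers a, b ≥ 0 with a + b ≤ 2n − 2, one has Σ_{i=1}^{n} ( γ^{(a)}(s)_i · γ^{(b)}(s)_{2n+1−i} − γ^{(b)}(s)_i · γ^{(a)}(s)_{2n+1−i} ) = 0, where γ^{(a)} denotes the a-th coordinatewise derivative. Consequently, for each s the flag of osculating subspaces F_k(s) = span{γ(s), …, γ^{(k-1)}(s)} is an isotropic flag for the alternating form ⟨x,y⟩ = Σ_{i=1}^{n} (x_i y_{2n+1−i} − y_i x_{2n+1−i}): F_n(s) is Lagrangian and the form vanishes identically on F_i(s) × F_{2n−i}(s) for every i. -/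
/-- The `i`-th coordinate function of the curve `γ : ℝ → ℝ^{2n}`,
`γ(s)_i = (−1)^{max(i−n−1,0)} s^{i−1}/(i−1)!` (here `i : Fin (2n)` is the 0-indexed
version of the 1-indexed coordinate). -/
noncomputable def gammaEv (n : ℕ) (i : Fin (2 * n)) : ℝ → ℝ :=
  fun s => (-1 : ℝ) ^ ((i : ℕ) - n) * s ^ (i : ℕ) / (Nat.factorial (i : ℕ))

/-- The index pairing `i ↦ 2n+1−i` (1-indexed), i.e. `i ↦ 2n−1−i` (0-indexed),
defined for `i` among the first `n` indices. -/
def pairEv (n : ℕ) (i : Fin n) : Fin (2 * n) :=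
  ⟨2 * n - 1 - (i : ℕ), by have := i.isLt; omega⟩

/-- The inclusion of the first `n` indices into `Fin (2n)`. -/
def inclEv (n : ℕ) (i : Fin n) : Fin (2 * n) :=
  ⟨(i : ℕ), by have := i.isLt; omega⟩

/-- The alternating form `⟨x,y⟩ = Σ_{i=1}^{n} (x_i y_{2n+1−i} − y_i x_{2n+1−i})` on `ℝ^{2n}`. -/
def formEv (n : ℕ) (x y : Fin (2 * n) → ℝ) : ℝ :=
  ∑ i : Fin n, (x (inclEv n i) * y (pairEv n i) - y (inclEv n i) * x (pairEv n i))

/-- The osculating subspace `F_k(s) = span{γ(s), γ'(s), …, γ^{(k-1)}(s)}`,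
derivatives taken coordinatewise. -/
noncomputable def oscEv (n k : ℕ) (s : ℝ) : Submodule ℝ (Fin (2 * n) → ℝ) :=
  Submodule.span ℝ (Set.range fun j : Fin k => fun i => iteratedDeriv (j : ℕ) (gammaEv n i) s)

open PowerSeries in
/-- The derivatives of `s ^ i / i!` are the coefficients of `X ^ a * exp (s X)`. -/
lemma iteratedDeriv_gammaEv (n a : ℕ) (i : Fin (2 * n)) (s : ℝ) :
    iteratedDeriv a (gammaEv n i) s =
      (-1) ^ ((i : ℕ) - n) * coeff (i : ℕ) (X ^ a * rescale s (exp ℝ)) := by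
  unfold gammaEv
  rw [iteratedDeriv_div_const, iteratedDeriv_const_mul_field, iteratedDeriv_pow, coeff_X_pow_mul',
    mul_div_assoc]
  congr 1
  split_ifs with h
  · rw [coeff_rescale, coeff_exp, ← Nat.factorial_mul_descFactorial h]
    have h₁ : (((i : ℕ) - a).factorial : ℝ) ≠ 0 := mod_cast Nat.factorial_ne_zero _
    have h₂ : (Nat.descFactorial i a : ℝ) ≠ 0 := by
      rw [Nat.cast_ne_zero, Ne, Nat.descFactorial_eq_zero_iff_lt]
      omega
    simp
    field_simp
  · simp [Nat.descFactorial_eq_zero_iff_lt.mpr (not_le.mp h)]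

open PowerSeries in
/-- The alternating convolution of the coefficients of `X ^ a * exp (s X)` and `X ^ b * exp (s X)`
is, up to sign, given by the coefficients of `X ^ (a + b)`. -/
lemma sum_neg_one_pow_mul_coeff_eq_zero {a b N : ℕ} (h : a + b < N) (s : ℝ) :
    ∑ k ∈ Finset.range (N + 1), (-1) ^ k * coeff k (X ^ a * rescale s (exp ℝ)) *
      coeff (N - k) (X ^ b * rescale s (exp ℝ)) = 0 := by
  have key : rescale (-1) (X ^ a * rescale s (exp ℝ)) * (X ^ b * rescale s (exp ℝ)) =
      C ((-1) ^ a) * X ^ (a + b) := by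
    have hexp := exp_mul_exp_eq_exp_add (A := ℝ) (-s) s
    rw [neg_add_cancel, rescale_zero_apply] at hexp
    simp only [constantCoeff_exp, map_one] at hexp
    rw [map_mul, map_pow, rescale_rescale, rescale_neg_one_X, mul_neg_one, map_pow, map_neg,
      map_one, pow_add, neg_pow X a]
    linear_combination ((-1) ^ a * X ^ a * X ^ b) * hexp
  have hN := congrArg (coeff N) key
  rw [coeff_mul, coeff_C_mul, coeff_X_pow, if_neg h.ne', mul_zero,
    Finset.Nat.sum_antidiagonal_eq_sum_range_succ_mk] at hN
  simpa only [coeff_rescale] using hN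

lemma sum_range_two_mul {M : Type*} [AddCommMonoid M] (f : ℕ → M) (n : ℕ) :
    ∑ k ∈ Finset.range (2 * n), f k = ∑ k ∈ Finset.range n, (f k + f (2 * n - 1 - k)) := by
  rw [two_mul, Finset.sum_range_add, Finset.sum_add_distrib,
    ← Finset.sum_range_reflect (fun k => f (n + k)) n]
  congr 1
  refine Finset.sum_congr rfl fun k hk => ?_
  have := Finset.mem_range.mp hk
  congr 1
  omega

lemma formEv_iteratedDeriv_gammaEv {n a b : ℕ} (h : a + b + 1 < 2 * n) (s : ℝ) :
    formEv n (fun i => iteratedDeriv a (gammaEv n i) s)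
      (fun i => iteratedDeriv b (gammaEv n i) s) = 0 := by
  have key := sum_neg_one_pow_mul_coeff_eq_zero (show a + b < 2 * n - 1 by omega) s
  rw [show 2 * n - 1 + 1 = 2 * n by omega, sum_range_two_mul, Finset.sum_range] at key
  simp only [formEv, iteratedDeriv_gammaEv, inclEv, pairEv]
  rw [← mul_zero ((-1 : ℝ) ^ (n - 1)), ← key, Finset.mul_sum]
  refine Finset.sum_congr rfl fun ⟨k, hk⟩ _ => ?_
  obtain ⟨m, rfl⟩ := Nat.exists_eq_add_of_lt hk
  have hsqk : ((-1 : ℝ) ^ k) * (-1) ^ k = 1 := by rw [← mul_pow]; simp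
  have hsqm : ((-1 : ℝ) ^ m) * (-1) ^ m = 1 := by rw [← mul_pow]; simp
  rw [show k - (k + m + 1) = 0 by omega, show 2 * (k + m + 1) - 1 - k - (k + m + 1) = m by omega,
    show 2 * (k + m + 1) - 1 - (2 * (k + m + 1) - 1 - k) = k by omega,
    show 2 * (k + m + 1) - 1 - k = k + m + m + 1 by omega, show k + m + 1 - 1 = k + m by omega]
  set f := PowerSeries.X ^ a * PowerSeries.rescale s (PowerSeries.exp ℝ)
  set g := PowerSeries.X ^ b * PowerSeries.rescale s (PowerSeries.exp ℝ)
  simp only [pow_add, pow_zero, pow_one]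
  linear_combination
    ((-1) ^ m * f.coeff (k + m + m + 1) * g.coeff k * ((-1) ^ m * (-1) ^ m) -
      (-1) ^ m * f.coeff k * g.coeff (k + m + m + 1)) * hsqk +
    (-1) ^ m * f.coeff (k + m + m + 1) * g.coeff k * hsqm

/-- `formEv` as a bilinear map. -/
def formEvBilin (n : ℕ) : LinearMap.BilinForm ℝ (Fin (2 * n) → ℝ) :=
  LinearMap.mk₂ ℝ (formEv n)
    (fun x x' y => by
      simp only [formEv, ← Finset.sum_add_distrib, Pi.add_apply]
      exact Finset.sum_congr rfl fun _ _ => by ring)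
    (fun c x y => by
      simp only [formEv, Finset.mul_sum, Pi.smul_apply, smul_eq_mul]
      exact Finset.sum_congr rfl fun _ _ => by ring)
    (fun x y y' => by
      simp only [formEv, ← Finset.sum_add_distrib, Pi.add_apply]
      exact Finset.sum_congr rfl fun _ _ => by ring)
    (fun c x y => by
      simp only [formEv, Finset.mul_sum, Pi.smul_apply, smul_eq_mul]
      exact Finset.sum_congr rfl fun _ _ => by ring)

lemma formEv_eq_zero_of_mem_oscEv {n k l : ℕ} (h : k + l ≤ 2 * n) (s : ℝ)
    {x y : Fin (2 * n) → ℝ} (hx : x ∈ oscEv n k s) (hy : y ∈ oscEv n l s) :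
    formEv n x y = 0 := by
  change formEvBilin n x y = 0
  induction hx, hy using Submodule.span_induction₂ with
  | mem_mem x y hx hy =>
    obtain ⟨i, rfl⟩ := hx
    obtain ⟨j, rfl⟩ := hy
    exact formEv_iteratedDeriv_gammaEv (by omega) s
  | zero_left | zero_right => simp
  | add_left _ _ _ _ _ _ h₁ h₂ | add_right _ _ _ _ _ _ h₁ h₂ => simp [h₁, h₂]
  | smul_left _ _ _ _ _ h | smul_right _ _ _ _ _ h => simp [h]

lemma finrank_oscEv {n k : ℕ} (hk : k ≤ 2 * n) (s : ℝ) :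
    Module.finrank ℝ (oscEv n k s) = k := by
  have hli : LinearIndependent ℝ
      (fun (j : Fin k) (i : Fin (2 * n)) => iteratedDeriv (j : ℕ) (gammaEv n i) s) := by
    refine LinearIndependent.of_comp (LinearMap.funLeft ℝ ℝ (Fin.castLE hk)) ?_
    refine Matrix.linearIndependent_rows_of_det_ne_zero (A := Matrix.of fun (j i : Fin k) =>
      iteratedDeriv (j : ℕ) (gammaEv n (Fin.castLE hk i)) s) ?_
    rw [Matrix.det_of_isUpperTriangular]
    · refine Finset.prod_ne_zero_iff.mpr fun i _ => ?_
      simp [iteratedDeriv_gammaEv, PowerSeries.coeff_X_pow_mul']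
    · intro j i hij
      have : ¬ j ≤ i := not_le.mpr hij
      simp [iteratedDeriv_gammaEv, PowerSeries.coeff_X_pow_mul', this]
  exact (finrank_span_eq_card hli).trans (Fintype.card_fin k)

/-- For `n ≥ 1`: the derivatives of the curve `γ` satisfy
`Σ_{i=1}^{n} (γ^{(a)}(s)_i γ^{(b)}(s)_{2n+1−i} − γ^{(b)}(s)_i γ^{(a)}(s)_{2n+1−i}) = 0`
whenever `a + b ≤ 2n − 2`; consequently each osculating flag `F_•(s)` is isotropic for the
alternating form: `F_n(s)` is Lagrangian and the form vanishes identically on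
`F_i(s) × F_{2n−i}(s)` for every `i`. -/
theorem stmt_2 (n : ℕ) (hn : 1 ≤ n) :
    (∀ s : ℝ, ∀ a b : ℕ, a + b ≤ 2 * n - 2 →
        ∑ i : Fin n,
          (iteratedDeriv a (gammaEv n (inclEv n i)) s * iteratedDeriv b (gammaEv n (pairEv n i)) s -
            iteratedDeriv b (gammaEv n (inclEv n i)) s * iteratedDeriv a (gammaEv n (pairEv n i)) s) = 0) ∧
      ∀ s : ℝ,
        (Module.finrank ℝ ↥(oscEv n n s) = n ∧
          ∀ x ∈ oscEv n n s, ∀ y ∈ oscEv n n s, formEv n x y = 0) ∧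
          ∀ i : ℕ, ∀ x ∈ oscEv n i s, ∀ y ∈ oscEv n (2 * n - i) s, formEv n x y = 0 := by
  refine ⟨fun s a b hab => formEv_iteratedDeriv_gammaEv (by omega) s, fun s =>
    ⟨⟨finrank_oscEv (by omega) s, fun x hx y hy =>
      formEv_eq_zero_of_mem_oscEv (by omega) s hx hy⟩, fun i x hx y hy => ?_⟩⟩
  rcases le_total i (2 * n) with hi | hi
  · exact formEv_eq_zero_of_mem_oscEv (by omega) s hx hy
  · have hy0 : y = 0 := by
      rw [Nat.sub_eq_zero_of_le hi] at hy
      simpa [oscEv] using hy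
    simp [hy0, formEv]
end

section
/- (Corollary 2.2, with transversality weakened to finiteness.) Let 0 < d_1 < ⋯ < d_m < n, let w ∈ S_n be a permutation whose descent set is contained in {d_1,…,d_m}, and set r := ℓ(w). Then for any list i_1, …, i_r of indices from {1,…,m} there exist real numbers s_1, …, s_r such that the set of partial flags E_• of type d in ℂ^n satisfying E_• ∈ X_w F_•(0) and E_{d_{i_k}} ∩ F_{n−d_{i_k}}(s_k) ≠ {0} for each k = 1,…,r, is finite and every partial flag in this set is real, i.e., each of its subspaces E_{d_i} is stable under coordinatewise complex conjugation. -/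
/-- The length `ℓ(w)`: the number of inversions of the permutation `w`. -/
def invCount (n : ℕ) (w : Equiv.Perm (Fin n)) : ℕ :=
  (Finset.univ.filter fun p : Fin n × Fin n => p.1 < p.2 ∧ w p.2 < w p.1).card

/-- `#{k ≤ di : w(k) ≤ j}` (in 1-indexed terms), the rank number of the Schubert
condition; here `w` is `0`-indexed. -/
def schubNum (n : ℕ) (w : Equiv.Perm (Fin n)) (di j : ℕ) : ℕ :=
  (Finset.univ.filter fun k : Fin n => (k : ℕ) < di ∧ ((w k : ℕ)) < j).card

/-- A subspace of `ℂⁿ` is real if it is stable under coordinatewise complex conjugation. -/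
def conjStable (n : ℕ) (H : Submodule ℂ (Fin n → ℂ)) : Prop :=
  ∀ x ∈ H, (fun i => (starRingEnd ℂ) (x i)) ∈ H

section Combinatorics

variable {n : ℕ}

theorem schubNum_eq_sum (u : Equiv.Perm (Fin n)) (q j : ℕ) :
    schubNum n u q j = ∑ k : Fin n, if (k : ℕ) < q ∧ (u k : ℕ) < j then 1 else 0 := by
  simp [schubNum]

theorem schubNum_mul_swap (u : Equiv.Perm (Fin n)) {a b : Fin n} (hab : a < b)
    (hu : u a < u b) (q j : ℕ) :
    schubNum n (u * Equiv.swap a b) q j +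
      (if (a : ℕ) < q ∧ q ≤ b ∧ (u a : ℕ) < j ∧ j ≤ u b then 1 else 0) = schubNum n u q j := by
  have hne : a ≠ b := hab.ne
  rw [schubNum_eq_sum, schubNum_eq_sum]
  have split : ∀ f : Fin n → ℕ,
      ∑ k, f k = f a + (f b + ∑ k ∈ (Finset.univ.erase a).erase b, f k) := by
    intro f
    rw [Finset.add_sum_erase _ f (by simp [hne.symm]),
      Finset.add_sum_erase _ f (Finset.mem_univ a)]
  rw [split, split]
  have hrest : ∑ k ∈ (Finset.univ.erase a).erase b,
      (if (k : ℕ) < q ∧ (((u * Equiv.swap a b) k : Fin n) : ℕ) < j then 1 else 0) =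
      ∑ k ∈ (Finset.univ.erase a).erase b, if (k : ℕ) < q ∧ (u k : ℕ) < j then 1 else 0 := by
    refine Finset.sum_congr rfl fun k hk => ?_
    simp only [Finset.mem_erase] at hk
    rw [Equiv.Perm.mul_apply, Equiv.swap_apply_of_ne_of_ne hk.2.1 hk.1]
  rw [hrest]
  simp only [Equiv.Perm.mul_apply, Equiv.swap_apply_left, Equiv.swap_apply_right]
  rw [Fin.lt_def] at hab hu
  split_ifs <;> omega

/-- If `u` is strictly dominated by `w`, then some transposition moves `u` up while keeping it
dominated by `w`. -/
theorem exists_swap_of_schubNum_le {u w : Equiv.Perm (Fin n)}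
    (h : ∀ q j, schubNum n w q j ≤ schubNum n u q j) (hne : u ≠ w) :
    ∃ a b : Fin n, a < b ∧ u a < u b ∧
      ∀ q j, schubNum n w q j ≤ schubNum n (u * Equiv.swap a b) q j := by
  classical
  obtain ⟨a, ha, hmin⟩ : ∃ a, u a ≠ w a ∧ ∀ k < a, u k = w k := by
    have hex : (Finset.univ.filter fun k => u k ≠ w k).Nonempty := by
      by_contra hemp
      apply hne
      ext k
      rw [Finset.not_nonempty_iff_eq_empty, Finset.filter_eq_empty_iff] at hemp
      exact congrArg _ (not_not.mp (hemp (Finset.mem_univ k)))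
    refine ⟨_, (Finset.mem_filter.mp (Finset.min'_mem _ hex)).2, fun k hk => ?_⟩
    by_contra hkne
    exact absurd (Finset.min'_le _ k (Finset.mem_filter.mpr ⟨Finset.mem_univ _, hkne⟩))
      (not_le.mpr hk)
  have hlt : u a < w a := by
    by_contra hge
    have hgt : w a < u a := lt_of_le_of_ne (not_lt.mp hge) (Ne.symm ha)
    have := h (a + 1) (w a + 1)
    rw [schubNum, schubNum] at this
    refine absurd this (not_le.mpr (Finset.card_lt_card ?_))
    rw [Finset.ssubset_iff_of_subset]
    · refine ⟨a, by simp, ?_⟩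
      simp only [Finset.mem_filter, Finset.mem_univ, true_and, not_and]
      rw [Fin.lt_def] at hgt
      omega
    · intro k hk
      simp only [Finset.mem_filter, Finset.mem_univ, true_and] at hk ⊢
      have hk' : k ≠ a := by
        rintro rfl
        rw [Fin.lt_def] at hgt
        omega
      have hka : k < a := lt_of_le_of_ne (Fin.le_def.mpr (by omega)) hk'
      rw [← hmin k hka]
      exact hk
  obtain ⟨b, ⟨hab, hub1, hub2⟩, hbmin⟩ : ∃ b, (a < b ∧ u a < u b ∧ u b ≤ w a) ∧
      ∀ k, a < k → k < b → u a < u k → ¬ u k ≤ w a := by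
    have hex : (Finset.univ.filter fun b => a < b ∧ u a < u b ∧ u b ≤ w a).Nonempty := by
      refine ⟨u.symm (w a), ?_⟩
      simp only [Finset.mem_filter, Finset.mem_univ, true_and, Equiv.apply_symm_apply, le_refl,
        and_true, hlt]
      rcases lt_trichotomy a (u.symm (w a)) with hc | hc | hc
      · exact hc
      · exact absurd (u.symm_apply_eq.mp hc.symm).symm ha
      · have := hmin _ hc
        rw [Equiv.apply_symm_apply] at this
        exact absurd (w.injective this).symm hc.ne
    refine ⟨_, (Finset.mem_filter.mp (Finset.min'_mem _ hex)).2, fun k h1 h2 h3 h4 => ?_⟩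
    exact absurd (Finset.min'_le _ k (Finset.mem_filter.mpr ⟨Finset.mem_univ _, h1, h3, h4⟩))
      (not_le.mpr h2)
  refine ⟨a, b, hab, hub1, fun q j => ?_⟩
  have hform := schubNum_mul_swap u hab hub1 q j
  split_ifs at hform with hrect
  swap
  · have := h q j
    omega
  obtain ⟨h1, h2, h3, h4⟩ := hrect
  suffices schubNum n w q j + 1 ≤ schubNum n u q j by omega
  rw [Fin.lt_def] at hlt hub1 hab
  rw [Fin.le_def] at hub2
  have hbig := h q (w a + 1)
  have key : ∀ v : Equiv.Perm (Fin n), schubNum n v q (w a + 1) = schubNum n v q j +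
      (Finset.univ.filter fun k : Fin n => (k : ℕ) < q ∧ j ≤ (v k : ℕ) ∧
        (v k : ℕ) < w a + 1).card := by
    intro v
    rw [schubNum, schubNum, ← Finset.card_union_of_disjoint]
    · congr 1
      ext k
      simp only [Finset.mem_filter, Finset.mem_univ, true_and, Finset.mem_union]
      omega
    · rw [Finset.disjoint_filter]
      intro k _
      omega
  rw [key u, key w] at hbig
  have hcard : (Finset.univ.filter fun k : Fin n => (k : ℕ) < q ∧ j ≤ (u k : ℕ) ∧
        (u k : ℕ) < w a + 1).card < (Finset.univ.filter fun k : Fin n => (k : ℕ) < q ∧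
        j ≤ (w k : ℕ) ∧ (w k : ℕ) < w a + 1).card := by
    apply Finset.card_lt_card
    rw [Finset.ssubset_iff_of_subset]
    · refine ⟨a, ?_, ?_⟩
      · simp only [Finset.mem_filter, Finset.mem_univ, true_and]
        omega
      · simp only [Finset.mem_filter, Finset.mem_univ, true_and]
        omega
    · intro k hk
      simp only [Finset.mem_filter, Finset.mem_univ, true_and] at hk ⊢
      have hka : k < a := by
        by_contra hka
        rcases (not_lt.mp hka).eq_or_lt with hc | hc
        · subst hc
          omega
        · refine hbmin k hc (Fin.lt_def.mpr (by omega)) (Fin.lt_def.mpr (by omega))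
            (Fin.le_def.mpr (by omega))
      rw [← hmin k hka]
      exact hk
  omega

/-- Multiplying by an ascending transposition increases the length; by at least two if some
intermediate position carries an intermediate value. -/
theorem invCount_mul_swap (u : Equiv.Perm (Fin n)) {a b : Fin n} (hab : a < b)
    (hu : u a < u b) (s : Finset (Fin n)) (hs : ∀ c ∈ s, a < c ∧ c < b ∧ u a < u c ∧ u c < u b) :
    invCount n u + 1 + s.card ≤ invCount n (u * Equiv.swap a b) := by
  classical
  set τ := Equiv.swap a b with hτ
  have hτval : ∀ k, τ k = if k = a then b else if k = b then a else k :=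
    fun k => Equiv.swap_apply_def a b k
  have hττ : ∀ k, τ (τ k) = k := fun k => Equiv.swap_apply_self a b k
  let φ : Fin n × Fin n → Fin n × Fin n :=
    fun p => if τ p.1 < τ p.2 then (τ p.1, τ p.2) else p
  let I := Finset.univ.filter fun p : Fin n × Fin n => p.1 < p.2 ∧ u p.2 < u p.1
  let T : Finset (Fin n × Fin n) := insert (a, b) (s.image fun c => (a, c))
  have hT : T.card = 1 + s.card := by
    rw [Finset.card_insert_of_notMem, Finset.card_image_of_injective, add_comm]
    · exact fun c c' h => (Prod.ext_iff.mp h).2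
    · simp only [Finset.mem_image, Prod.mk.injEq, true_and, not_exists, not_and]
      rintro c hc rfl
      exact lt_irrefl _ (hs _ hc).2.1
  have hrev : ∀ p ∈ I, ¬ τ p.1 < τ p.2 →
      (p.1 = a ∧ p.2 < b ∧ u p.2 < u a) ∨ (p.2 = b ∧ a < p.1 ∧ u b < u p.1) := by
    rintro ⟨i, j⟩ hp hnot
    simp only [I, Finset.mem_filter, Finset.mem_univ, true_and] at hp
    simp only [hτval] at hnot
    simp only
    split_ifs at hnot <;> grind
  have hinj : Set.InjOn φ I := by
    intro p hp p' hp' heq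
    have hp1 : p.1 < p.2 := (Finset.mem_filter.mp hp).2.1
    have hp1' : p'.1 < p'.2 := (Finset.mem_filter.mp hp').2.1
    simp only [φ] at heq
    split_ifs at heq with c1 c2 c2
    · rw [Prod.mk.injEq] at heq
      exact Prod.ext (τ.injective heq.1) (τ.injective heq.2)
    · exfalso
      rw [← heq] at c2
      simp only [hττ] at c2
      exact c2 hp1
    · exfalso
      rw [heq] at c1
      simp only [hττ] at c1
      exact c1 hp1'
    · exact heq
  have hdisj : Disjoint (I.image φ) T := by
    rw [Finset.disjoint_left]
    intro x hx hxT
    obtain ⟨p, hp, rfl⟩ := Finset.mem_image.mp hx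
    have hrevp := hrev p hp
    obtain ⟨i, j⟩ := p
    simp only [I, Finset.mem_filter, Finset.mem_univ, true_and] at hp
    simp only [T, φ, Finset.mem_insert, Finset.mem_image] at hxT
    simp only at hrevp
    split_ifs at hxT with c1
    · rcases hxT with h | ⟨c, hc, h⟩
      · rw [Prod.mk.injEq] at h
        have h1 := congrArg τ h.1
        have h2 := congrArg τ h.2
        simp only [hττ] at h1 h2
        rw [hτval] at h1 h2
        grind
      · rw [Prod.mk.injEq] at h
        have h1 := congrArg τ h.1
        have h2 := congrArg τ h.2
        simp only [hττ] at h1 h2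
        rw [hτval] at h1 h2
        have := hs c hc
        grind
    · rcases hxT with h | ⟨c, hc, h⟩
      · rw [Prod.mk.injEq] at h
        grind
      · rw [Prod.mk.injEq] at h
        have := hs c hc
        grind
  have hsub : I.image φ ∪ T ⊆
      Finset.univ.filter fun p : Fin n × Fin n => p.1 < p.2 ∧ (u * τ) p.2 < (u * τ) p.1 := by
    apply Finset.union_subset
    · intro x hx
      obtain ⟨p, hp, rfl⟩ := Finset.mem_image.mp hx
      have hrevp := hrev p hp
      obtain ⟨i, j⟩ := p
      simp only [I, Finset.mem_filter, Finset.mem_univ, true_and] at hp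
      rw [Finset.mem_filter]
      refine ⟨Finset.mem_univ _, ?_⟩
      simp only [φ, Equiv.Perm.mul_apply]
      split_ifs with c1
      · simp only [hττ]
        exact ⟨c1, hp.2⟩
      · refine ⟨hp.1, ?_⟩
        simp only [hτval]
        rcases hrevp c1 with h | h <;> grind
    · intro x hx
      simp only [T, Finset.mem_insert, Finset.mem_image] at hx
      rw [Finset.mem_filter]
      refine ⟨Finset.mem_univ _, ?_⟩
      simp only [Equiv.Perm.mul_apply]
      rcases hx with rfl | ⟨c, hc, rfl⟩
      · simp only [hτval]
        grind
      · have := hs c hc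
        simp only [hτval]
        grind
  have := Finset.card_le_card hsub
  rw [Finset.card_union_of_disjoint hdisj, Finset.card_image_of_injOn hinj, hT] at this
  rw [invCount, invCount]
  simp only [I] at this
  omega

theorem invCount_lt_mul_swap (u : Equiv.Perm (Fin n)) {a b : Fin n} (hab : a < b)
    (hu : u a < u b) : invCount n u < invCount n (u * Equiv.swap a b) := by
  have := invCount_mul_swap u hab hu ∅ (by simp)
  omega

theorem invCount_le_of_schubNum_le {u w : Equiv.Perm (Fin n)}
    (h : ∀ q j, schubNum n w q j ≤ schubNum n u q j) : invCount n u ≤ invCount n w := by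
  classical
  have hbound : ∀ v : Equiv.Perm (Fin n), invCount n v ≤ n * n := by
    intro v
    refine (Finset.card_le_univ _).trans (by simp)
  obtain ⟨k, hk⟩ : ∃ k, k + invCount n u = n * n := ⟨n * n - invCount n u, by
    have := hbound u
    omega⟩
  induction k using Nat.strong_induction_on generalizing u with
  | _ k ih =>
    by_cases hne : u = w
    · rw [hne]
    · obtain ⟨a, b, hab, hu, hdom⟩ := exists_swap_of_schubNum_le h hne
      have hlt := invCount_lt_mul_swap u hab hu
      have hb := hbound (u * Equiv.swap a b)
      have := ih (n * n - invCount n (u * Equiv.swap a b)) (by omega) hdom (by omega)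
      omega

theorem invCount_lt_of_schubNum_le {u w : Equiv.Perm (Fin n)}
    (h : ∀ q j, schubNum n w q j ≤ schubNum n u q j) (hne : u ≠ w) :
    invCount n u < invCount n w := by
  obtain ⟨a, b, hab, hu, hdom⟩ := exists_swap_of_schubNum_le h hne
  exact (invCount_lt_mul_swap u hab hu).trans_le (invCount_le_of_schubNum_le hdom)

theorem eq_of_schubNum_eq {u w : Equiv.Perm (Fin n)}
    (h : ∀ q j, schubNum n w q j = schubNum n u q j) : u = w := by
  by_contra hne
  have h1 := invCount_lt_of_schubNum_le (fun q j => (h q j).le) hne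
  have h2 := invCount_le_of_schubNum_le (u := w) (w := u) (fun q j => (h q j).ge)
  omega

/-- A codimension-one relation in the Bruhat order is a cover by a transposition. -/
theorem exists_cover_of_schubNum_le {u w : Equiv.Perm (Fin n)}
    (h : ∀ q j, schubNum n w q j ≤ schubNum n u q j)
    (hlen : invCount n w = invCount n u + 1) :
    ∃ a b : Fin n, a < b ∧ u a < u b ∧ w = u * Equiv.swap a b ∧
      ∀ c, a < c → c < b → u a < u c → ¬ u c < u b := by
  have hne : u ≠ w := by
    rintro rfl
    omega
  obtain ⟨a, b, hab, hu, hdom⟩ := exists_swap_of_schubNum_le h hne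
  have hw : u * Equiv.swap a b = w := by
    by_contra hne'
    have h1 := invCount_lt_mul_swap u hab hu
    have h2 := invCount_lt_of_schubNum_le hdom hne'
    omega
  refine ⟨a, b, hab, hu, hw.symm, fun c h1 h2 h3 h4 => ?_⟩
  have := invCount_mul_swap u hab hu {c} (by
    intro c' hc'
    rw [Finset.mem_singleton] at hc'
    subst hc'
    exact ⟨h1, h2, h3, h4⟩)
  rw [hw, Finset.card_singleton] at this
  omega

end Combinatorics

namespace SchubertCell

open Matrix Module Topology Filter

variable {n : ℕ}

/-- Invertible upper triangular matrices. -/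
def IsBorel (b : Matrix (Fin n) (Fin n) ℂ) : Prop := b.IsUpperTriangular ∧ IsUnit b.det

theorem IsBorel.mul {b c : Matrix (Fin n) (Fin n) ℂ} (hb : IsBorel b) (hc : IsBorel c) :
    IsBorel (b * c) :=
  ⟨hb.1.mul hc.1, by rw [det_mul]; exact hb.2.mul hc.2⟩

theorem IsBorel.inv {b : Matrix (Fin n) (Fin n) ℂ} (hb : IsBorel b) : IsBorel b⁻¹ := by
  let := b.invertibleOfIsUnitDet hb.2
  exact ⟨blockTriangular_inv_of_blockTriangular hb.1, isUnit_nonsing_inv_det b hb.2⟩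

theorem IsBorel.one : IsBorel (1 : Matrix (Fin n) (Fin n) ℂ) :=
  ⟨blockTriangular_one, by simp⟩

theorem IsBorel.diag_ne_zero {b : Matrix (Fin n) (Fin n) ℂ} (hb : IsBorel b) (k : Fin n) :
    b k k ≠ 0 := by
  have h := hb.2.ne_zero
  rw [det_of_isUpperTriangular hb.1] at h
  exact Finset.prod_ne_zero_iff.mp h k (Finset.mem_univ k)

theorem isBorel_of_diag_ne_zero {b : Matrix (Fin n) (Fin n) ℂ} (hb : b.IsUpperTriangular)
    (h : ∀ k, b k k ≠ 0) : IsBorel b :=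
  ⟨hb, by
    rw [det_of_isUpperTriangular hb]
    exact (Finset.prod_ne_zero_iff.mpr fun k _ => h k).isUnit⟩

/-- Matrices in the affine chart of the flag variety opposite to `u`: the pivot `(u k, k)` is
`1`, with zeros to its right. -/
def IsChart (u : Equiv.Perm (Fin n)) (x : Matrix (Fin n) (Fin n) ℂ) : Prop :=
  (∀ k, x (u k) k = 1) ∧ ∀ k l, k < l → x (u k) l = 0

/-- Matrices whose entries below the pivots `(u k, k)` vanish. -/
def IsBelow (u : Equiv.Perm (Fin n)) (x : Matrix (Fin n) (Fin n) ℂ) : Prop :=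
  ∀ i k, u k < i → x i k = 0

/-- Normal forms of the flags in the Schubert cell of `u`. -/
def IsCell (u : Equiv.Perm (Fin n)) (x : Matrix (Fin n) (Fin n) ℂ) : Prop :=
  IsChart u x ∧ IsBelow u x

/-- The direction of the affine space of normal forms of the Schubert cell of `u`. -/
def cellDir (u : Equiv.Perm (Fin n)) : Submodule ℂ (Matrix (Fin n) (Fin n) ℂ) where
  carrier := {Z | (∀ k l, k ≤ l → Z (u k) l = 0) ∧ IsBelow u Z}
  zero_mem' := ⟨fun _ _ _ => rfl, fun _ _ _ => rfl⟩
  add_mem' := by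
    rintro Y Z ⟨h1, h2⟩ ⟨h3, h4⟩
    exact ⟨fun k l h => by simp [h1 k l h, h3 k l h], fun i k h => by simp [h2 i k h, h4 i k h]⟩
  smul_mem' := by
    rintro c Z ⟨h1, h2⟩
    exact ⟨fun k l h => by simp [h1 k l h], fun i k h => by simp [h2 i k h]⟩

theorem IsCell.add {u : Equiv.Perm (Fin n)} {x Z : Matrix (Fin n) (Fin n) ℂ} (hx : IsCell u x)
    (hZ : Z ∈ cellDir u) : IsCell u (x + Z) := by
  refine ⟨⟨fun k => ?_, fun k l h => ?_⟩, fun i k h => ?_⟩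
  · simp [hx.1.1 k, hZ.1 k k le_rfl]
  · simp [hx.1.2 k l h, hZ.1 k l h.le]
  · simp [hx.2 i k h, hZ.2 i k h]

theorem IsCell.sub_mem {u : Equiv.Perm (Fin n)} {x y : Matrix (Fin n) (Fin n) ℂ}
    (hx : IsCell u x) (hy : IsCell u y) : x - y ∈ cellDir u := by
  refine ⟨fun k l h => ?_, fun i k h => ?_⟩
  · rcases h.eq_or_lt with rfl | h
    · simp [hx.1.1, hy.1.1]
    · simp [hx.1.2 k l h, hy.1.2 k l h]
  · simp [hx.2 i k h, hy.2 i k h]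

theorem finrank_cellDir (u : Equiv.Perm (Fin n)) : finrank ℂ (cellDir u) = invCount n u := by
  classical
  let I := Finset.univ.filter fun p : Fin n × Fin n => p.1 < p.2 ∧ u p.2 < u p.1
  let e : cellDir u ≃ₗ[ℂ] (I → ℂ) :=
    { toFun := fun Z p => Z.1 (u p.1.2) p.1.1
      map_add' := fun _ _ => rfl
      map_smul' := fun _ _ => rfl
      invFun := fun f => ⟨Matrix.of fun i k => if h : (k, u.symm i) ∈ I then f ⟨_, h⟩ else 0, by
        refine ⟨fun k l h => ?_, fun i k h => ?_⟩
        · rw [Matrix.of_apply, dif_neg]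
          simp only [I, Finset.mem_filter, Equiv.symm_apply_apply]
          exact fun hc => absurd hc.2.1 (not_lt.mpr h)
        · rw [Matrix.of_apply, dif_neg]
          simp only [I, Finset.mem_filter, Equiv.apply_symm_apply]
          exact fun hc => absurd hc.2.2 (not_lt.mpr h.le)⟩
      left_inv := by
        rintro ⟨Z, hZ⟩
        apply Subtype.ext
        ext i k
        simp only [Matrix.of_apply]
        split_ifs with h
        · simp
        · by_contra hne
          apply h
          simp only [I, Finset.mem_filter, Finset.mem_univ, true_and, Equiv.apply_symm_apply]
          constructor
          · by_contra hle
            have := hZ.1 _ _ (not_lt.mp hle)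
            rw [Equiv.apply_symm_apply] at this
            exact hne this.symm
          · rcases lt_trichotomy i (u k) with hc | hc | hc
            · exact hc
            · have := hZ.1 k k le_rfl
              rw [← hc] at this
              exact absurd this.symm hne
            · exact absurd (hZ.2 i k hc).symm hne
      right_inv := by
        intro f
        ext ⟨⟨k, l⟩, h⟩
        simp [h] }
  rw [e.finrank_eq, finrank_fintype_fun_eq_card, Fintype.card_coe]
  rfl

theorem IsChart.isUnit_det {u : Equiv.Perm (Fin n)} {x : Matrix (Fin n) (Fin n) ℂ}
    (hx : IsChart u x) : IsUnit x.det := by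
  have h1 : (x.submatrix u id).det = 1 := by
    rw [det_of_isLowerTriangular]
    · simp [hx.1]
    · intro k l h
      exact hx.2 k l h
  rw [det_permute] at h1
  exact (IsUnit.of_mul_eq_one_right _ h1)

theorem IsChart.mulVec_pivot {u : Equiv.Perm (Fin n)} {x : Matrix (Fin n) (Fin n) ℂ}
    (hx : IsChart u x) {c : Fin n → ℂ} {k : Fin n}
    (h : ∀ l < k, c l = 0 ∨ x (u k) l = 0) : (x *ᵥ c) (u k) = c k := by
  rw [mulVec, dotProduct, Finset.sum_eq_single k]
  · rw [hx.1, one_mul]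
  · intro l _ hl
    rcases lt_or_gt_of_ne hl with hlt | hgt
    · rcases h l hlt with h | h <;> simp [h]
    · simp [hx.2 k l hgt]
  · simp

/-- Coefficient vectors of the elements of `E_q ∩ F_j`, for the flag spanned by the columns
of `g`. -/
def coeffSpace (q j : ℕ) (g : Matrix (Fin n) (Fin n) ℂ) : Submodule ℂ (Fin n → ℂ) where
  carrier := {c | (∀ k : Fin n, q ≤ k → c k = 0) ∧ ∀ i : Fin n, j ≤ i → (g *ᵥ c) i = 0}
  zero_mem' := by simp
  add_mem' := by
    rintro c c' ⟨h1, h2⟩ ⟨h3, h4⟩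
    exact ⟨fun k h => by simp [h1 k h, h3 k h], fun i h => by simp [mulVec_add, h2 i h, h4 i h]⟩
  smul_mem' := by
    rintro a c ⟨h1, h2⟩
    exact ⟨fun k h => by simp [h1 k h], fun i h => by simp [mulVec_smul, h2 i h]⟩

theorem mem_coeffSpace {q j : ℕ} {g : Matrix (Fin n) (Fin n) ℂ} {c : Fin n → ℂ} :
    c ∈ coeffSpace q j g ↔
      (∀ k : Fin n, q ≤ k → c k = 0) ∧ ∀ i : Fin n, j ≤ i → (g *ᵥ c) i = 0 := Iff.rfl

/-- The rank conditions defining the Schubert variety of `w`. -/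
def SchubCond (w : Equiv.Perm (Fin n)) (g : Matrix (Fin n) (Fin n) ℂ) : Prop :=
  ∀ q j, schubNum n w q j ≤ finrank ℂ (coeffSpace q j g)

theorem finrank_coeffSpace_mul_le {g b : Matrix (Fin n) (Fin n) ℂ} (hb : IsBorel b) (q j : ℕ) :
    finrank ℂ (coeffSpace q j (g * b)) ≤ finrank ℂ (coeffSpace q j g) := by
  have hinj : Function.Injective b.mulVecLin := by
    rw [coe_mulVecLin]
    exact mulVec_injective_of_isUnit ((isUnit_iff_isUnit_det b).mpr hb.2)
  have hmap : ∀ c ∈ coeffSpace q j (g * b), b.mulVecLin c ∈ coeffSpace q j g := by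
    rintro c ⟨h1, h2⟩
    refine ⟨fun k hk => ?_, fun i hi => ?_⟩
    · rw [mulVecLin_apply, mulVec, dotProduct]
      refine Finset.sum_eq_zero fun l _ => ?_
      rcases lt_or_ge l k with h | h
      · rw [hb.1 h, zero_mul]
      · rw [h1 l (hk.trans h), mul_zero]
    · rw [mulVecLin_apply, mulVec_mulVec]
      exact h2 i hi
  refine LinearMap.finrank_le_finrank_of_injective (f := b.mulVecLin.restrict hmap) ?_
  intro c c' h
  exact Subtype.ext (hinj (congrArg Subtype.val h))

theorem finrank_coeffSpace_mul {g b : Matrix (Fin n) (Fin n) ℂ} (hb : IsBorel b) (q j : ℕ) :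
    finrank ℂ (coeffSpace q j (g * b)) = finrank ℂ (coeffSpace q j g) := by
  refine le_antisymm (finrank_coeffSpace_mul_le hb q j) ?_
  have := finrank_coeffSpace_mul_le (g := g * b) hb.inv q j
  rwa [mul_assoc, mul_nonsing_inv _ hb.2, mul_one] at this

theorem SchubCond.mul {w : Equiv.Perm (Fin n)} {g b : Matrix (Fin n) (Fin n) ℂ}
    (h : SchubCond w g) (hb : IsBorel b) : SchubCond w (g * b) := fun q j => by
  rw [finrank_coeffSpace_mul hb]
  exact h q j

theorem IsChart.eq_zero_of_mem_coeffSpace {u : Equiv.Perm (Fin n)}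
    {x : Matrix (Fin n) (Fin n) ℂ} (hx : IsChart u x) {q j : ℕ} {c : Fin n → ℂ}
    (hc : c ∈ coeffSpace q j x) (h : ∀ k : Fin n, (k : ℕ) < q → (u k : ℕ) < j → c k = 0) :
    c = 0 := by
  funext k
  induction k using WellFoundedLT.induction with
  | ind k ih =>
    by_cases hq : (k : ℕ) < q
    · by_cases hj : (u k : ℕ) < j
      · exact h k hq hj
      · rw [Pi.zero_apply, ← hx.mulVec_pivot fun l hl => Or.inl (ih l hl)]
        exact hc.2 _ (not_lt.mp hj)
    · exact hc.1 k (not_lt.mp hq)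

theorem card_subtype_eq_schubNum (u : Equiv.Perm (Fin n)) (q j : ℕ) :
    Fintype.card {k : Fin n // (k : ℕ) < q ∧ (u k : ℕ) < j} = schubNum n u q j :=
  Fintype.card_subtype _

/-- The coordinates of a coefficient vector at the columns with small pivots. -/
def pivotCoords (u : Equiv.Perm (Fin n)) (q j : ℕ) (x : Matrix (Fin n) (Fin n) ℂ) :
    coeffSpace q j x →ₗ[ℂ] ({k : Fin n // (k : ℕ) < q ∧ (u k : ℕ) < j} → ℂ) where
  toFun c k := c.1 k.1
  map_add' _ _ := rfl
  map_smul' _ _ := rfl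

theorem IsChart.injective_pivotCoords {u : Equiv.Perm (Fin n)}
    {x : Matrix (Fin n) (Fin n) ℂ} (hx : IsChart u x) (q j : ℕ) :
    Function.Injective (pivotCoords u q j x) := by
  rw [injective_iff_map_eq_zero]
  intro c hc
  exact Subtype.ext (hx.eq_zero_of_mem_coeffSpace c.2 fun k h1 h2 => congrFun hc ⟨k, h1, h2⟩)

theorem IsChart.finrank_coeffSpace_le {u : Equiv.Perm (Fin n)}
    {x : Matrix (Fin n) (Fin n) ℂ} (hx : IsChart u x) (q j : ℕ) :
    finrank ℂ (coeffSpace q j x) ≤ schubNum n u q j := by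
  rw [← card_subtype_eq_schubNum, ← finrank_fintype_fun_eq_card ℂ]
  exact LinearMap.finrank_le_finrank_of_injective (hx.injective_pivotCoords q j)

theorem IsChart.exists_mem_coeffSpace {u : Equiv.Perm (Fin n)}
    {x : Matrix (Fin n) (Fin n) ℂ} (hx : IsChart u x) {q j : ℕ}
    (h : schubNum n u q j ≤ finrank ℂ (coeffSpace q j x)) {l : Fin n} (hl : (l : ℕ) < q)
    (hl' : (u l : ℕ) < j) :
    ∃ c ∈ coeffSpace q j x, c l = 1 ∧ ∀ k : Fin n, (u k : ℕ) < j → k ≠ l → c k = 0 := by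
  classical
  have hs : Function.Surjective (pivotCoords u q j x) := by
    refine (LinearMap.injective_iff_surjective_of_finrank_eq_finrank ?_).mp
      (hx.injective_pivotCoords q j)
    rw [finrank_fintype_fun_eq_card, card_subtype_eq_schubNum]
    exact le_antisymm (hx.finrank_coeffSpace_le q j) h
  obtain ⟨c, hc⟩ := hs (Pi.single ⟨l, hl, hl'⟩ 1)
  refine ⟨c.1, c.2, ?_, fun k hk hkl => ?_⟩
  · have := congrFun hc ⟨l, hl, hl'⟩
    rwa [Pi.single_eq_same] at this
  · by_cases hq : (k : ℕ) < q
    · have := congrFun hc ⟨k, hq, hk⟩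
      rwa [Pi.single_eq_of_ne (fun h => hkl (congrArg Subtype.val h))] at this
    · exact c.2.1 k (not_lt.mp hq)

/-- Full rank at `(l + 1, j)` forces the entries of column `l` from row `j` on to vanish. -/
theorem IsChart.apply_eq_zero {u : Equiv.Perm (Fin n)}
    {x : Matrix (Fin n) (Fin n) ℂ} (hx : IsChart u x) {l : Fin n} {j : ℕ}
    (h : schubNum n u (l + 1) j ≤ finrank ℂ (coeffSpace (l + 1) j x)) (hl : (u l : ℕ) < j)
    {i : Fin n} (hi : j ≤ i) : x i l = 0 := by
  obtain ⟨c, hc, hc1, hc0⟩ := hx.exists_mem_coeffSpace h (Nat.lt_succ_self l) hl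
  have hcl : c = Pi.single l 1 := by
    funext k
    induction k using WellFoundedLT.induction with
    | ind k ih =>
      rcases lt_trichotomy k l with hk | rfl | hk
      · rw [Pi.single_eq_of_ne hk.ne]
        by_cases hj : (u k : ℕ) < j
        · exact hc0 k hj hk.ne
        · rw [← hx.mulVec_pivot (c := c) (k := k) fun m hm => Or.inl ?_]
          · exact hc.2 _ (not_lt.mp hj)
          · rw [ih m hm, Pi.single_eq_of_ne (hm.trans hk).ne]
      · rw [hc1, Pi.single_eq_same]
      · rw [Pi.single_eq_of_ne hk.ne']
        exact hc.1 k hk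
  have := hc.2 i hi
  rwa [hcl, mulVec_single_one] at this

theorem IsChart.isCell {u : Equiv.Perm (Fin n)} {x : Matrix (Fin n) (Fin n) ℂ}
    (hx : IsChart u x) (h : SchubCond u x) : IsCell u x :=
  ⟨hx, fun _ l hi => hx.apply_eq_zero (j := u l + 1) (h _ _) (Nat.lt_succ_self _) hi⟩

theorem IsBelow.schubNum_le_finrank {u : Equiv.Perm (Fin n)} {x : Matrix (Fin n) (Fin n) ℂ}
    (hx : IsBelow u x) (q j : ℕ) : schubNum n u q j ≤ finrank ℂ (coeffSpace q j x) := by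
  classical
  rw [← card_subtype_eq_schubNum, ← finrank_fintype_fun_eq_card ℂ]
  let f : ({k : Fin n // (k : ℕ) < q ∧ (u k : ℕ) < j} → ℂ) →ₗ[ℂ] (Fin n → ℂ) :=
    { toFun := fun c k => if h : (k : ℕ) < q ∧ (u k : ℕ) < j then c ⟨k, h⟩ else 0
      map_add' := fun c c' => by ext k; simp only [Pi.add_apply]; split_ifs <;> simp
      map_smul' := fun a c => by ext k; simp }
  have hf : ∀ c, f c ∈ coeffSpace q j x := by
    refine fun c => ⟨fun k hk => dif_neg fun h => absurd h.1 (not_lt.mpr hk), fun i hi => ?_⟩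
    rw [mulVec, dotProduct]
    refine Finset.sum_eq_zero fun k _ => ?_
    by_cases h : (k : ℕ) < q ∧ (u k : ℕ) < j
    · rw [hx i k (Fin.lt_def.mpr (h.2.trans_le hi)), zero_mul]
    · rw [show f c k = 0 from dif_neg h, mul_zero]
  refine LinearMap.finrank_le_finrank_of_injective (f := f.codRestrict _ hf) ?_
  intro c c' h
  funext k
  have := congrFun (congrArg Subtype.val h) k.1
  simpa [f, k.2] using this

theorem IsCell.schubCond {u : Equiv.Perm (Fin n)} {x : Matrix (Fin n) (Fin n) ℂ}
    (hx : IsCell u x) : SchubCond u x := hx.2.schubNum_le_finrank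

theorem IsCell.finrank_coeffSpace {u : Equiv.Perm (Fin n)} {x : Matrix (Fin n) (Fin n) ℂ}
    (hx : IsCell u x) (q j : ℕ) : finrank ℂ (coeffSpace q j x) = schubNum n u q j :=
  le_antisymm (hx.1.finrank_coeffSpace_le q j) (hx.schubCond q j)

/-- Flags in the same Schubert cell have the same permutation. -/
theorem IsCell.perm_eq {u v : Equiv.Perm (Fin n)} {x b : Matrix (Fin n) (Fin n) ℂ}
    (hx : IsCell u x) (hb : IsBorel b) (hxb : IsCell v (x * b)) : u = v := by
  refine eq_of_schubNum_eq fun q j => ?_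
  rw [← hx.finrank_coeffSpace, ← hxb.finrank_coeffSpace, finrank_coeffSpace_mul hb]

theorem IsChart.eq_one_of_mul {u : Equiv.Perm (Fin n)} {x b : Matrix (Fin n) (Fin n) ℂ}
    (hx : IsChart u x) (hb : IsBorel b) (hxb : IsChart u (x * b)) : b = 1 := by
  ext k l
  induction k using WellFoundedLT.induction with
  | ind k ih =>
    rcases lt_or_ge l k with h | h
    · rw [hb.1 h, one_apply_ne h.ne']
    have hpiv : (x * b) (u k) l = b k l := by
      refine hx.mulVec_pivot (c := b.col l) fun m hm => Or.inl ?_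
      rw [col_apply, ih m hm, one_apply_ne (hm.trans_le h).ne]
    rw [← hpiv]
    rcases h.eq_or_lt with rfl | h
    · rw [hxb.1, one_apply_eq]
    · rw [hxb.2 k l h, one_apply_ne h.ne]

theorem IsChart.mul_unique {u : Equiv.Perm (Fin n)} {g b c : Matrix (Fin n) (Fin n) ℂ}
    (hb : IsBorel b) (hc : IsBorel c) (hgb : IsChart u (g * b)) (hgc : IsChart u (g * c)) :
    b = c := by
  have h := hgb.eq_one_of_mul (hb.inv.mul hc)
    (by rwa [← mul_assoc, mul_assoc g, mul_nonsing_inv _ hb.2, mul_one])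
  calc b = b * (b⁻¹ * c) := by rw [h, mul_one]
    _ = c := by rw [← mul_assoc, mul_nonsing_inv _ hb.2, one_mul]

section Cover

variable {u : Equiv.Perm (Fin n)} {a b : Fin n}

theorem mul_transvection_apply (x : Matrix (Fin n) (Fin n) ℂ) (t : ℂ) (i k : Fin n) :
    (x * transvection b a t) i k = x i k + if k = a then t * x i b else 0 := by
  split_ifs with h
  · subst h
    exact mul_transvection_apply_same ..
  · rw [mul_transvection_apply_of_ne _ _ _ _ h, add_zero]

theorem schubNum_mul_swap_of_outside (hab : a < b) (hu : u a < u b) {q j : ℕ}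
    (h : ¬((a : ℕ) < q ∧ q ≤ b ∧ (u a : ℕ) < j ∧ j ≤ u b)) :
    schubNum n (u * Equiv.swap a b) q j = schubNum n u q j := by
  have := schubNum_mul_swap u hab hu q j
  rwa [if_neg h, add_zero] at this

/-- The chart points of a Schubert variety around a codimension one cell. -/
theorem IsChart.isCell_mul_transvection (hab : a < b) (hu : u a < u b)
    (hcov : ∀ c, a < c → c < b → u a < u c → ¬u c < u b) {y : Matrix (Fin n) (Fin n) ℂ}
    (hy : IsChart u y) (hw : SchubCond (u * Equiv.swap a b) y) :
    IsCell u (y * transvection b a (-y (u b) a)) := by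
  have hout : ∀ {q j : ℕ}, ¬((a : ℕ) < q ∧ q ≤ b ∧ (u a : ℕ) < j ∧ j ≤ u b) →
      schubNum n u q j ≤ finrank ℂ (coeffSpace q j y) := fun h => by
    rw [← schubNum_mul_swap_of_outside hab hu h]
    exact hw _ _
  have hcol : ∀ l ≠ a, ∀ i, u l < i → y i l = 0 := by
    intro l hl i hi
    refine hy.apply_eq_zero (j := u l + 1) (hout ?_) (Nat.lt_succ_self _) hi
    rintro ⟨h1, h2, h3, h4⟩
    have h5 : a < l := lt_of_le_of_ne (Fin.le_def.mpr (by omega)) hl.symm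
    have h6 : l < b := Fin.lt_def.mpr (by omega)
    have h7 : u a < u l := lt_of_le_of_ne (Fin.le_def.mpr (by omega))
      (fun h => hl (u.injective h).symm)
    exact hcov l h5 h6 h7 (Fin.lt_def.mpr (by omega))
  have hcola : ∀ i, u b < i → y i a = 0 := by
    intro i hi
    refine hy.apply_eq_zero (j := u b + 1) (hout fun h => by omega) ?_ hi
    have := Fin.lt_def.mp hu
    omega
  have hrel : ∀ i, u a < i → y i a = y (u b) a * y i b := by
    obtain ⟨c, hc, hc1, hc0⟩ := hy.exists_mem_coeffSpace (q := b + 1) (j := u a + 1)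
      (hout fun h => by omega) (l := a) (by have := Fin.lt_def.mp hab; omega) (Nat.lt_succ_self _)
    have hcz : ∀ k < b, k ≠ a → c k = 0 := by
      intro k
      induction k using WellFoundedLT.induction with
      | ind k ih =>
        intro hkb hka
        by_cases hk : (u k : ℕ) < u a + 1
        · exact hc0 k hk hka
        have hk' : u a < u k := Fin.lt_def.mpr (by omega)
        rw [← hy.mulVec_pivot (c := c) (k := k) fun m hm => ?_]
        · exact hc.2 _ (not_lt.mp hk)
        · by_cases hma : m = a
          · subst hma
            refine Or.inr (hcola _ ?_)
            exact lt_of_le_of_ne (not_lt.mp (hcov k hm hkb hk'))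
              (fun h => hkb.ne (u.injective h).symm)
          · exact Or.inl (ih m hm (hm.trans hkb) hma)
    have hsum : ∀ i, (y *ᵥ c) i = y i a + y i b * c b := by
      intro i
      rw [mulVec, dotProduct, ← Finset.sum_subset (Finset.subset_univ {a, b}),
        Finset.sum_pair hab.ne, hc1, mul_one]
      intro k _ hk
      simp only [Finset.mem_insert, Finset.mem_singleton, not_or] at hk
      rcases lt_or_gt_of_ne hk.2 with h | h
      · rw [hcz k h hk.1, mul_zero]
      · rw [hc.1 k h, mul_zero]
    have hb := hc.2 (u b) hu
    rw [hsum, hy.1, one_mul] at hb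
    intro i hi
    have := hc.2 i hi
    rw [hsum] at this
    linear_combination this - y i b * hb
  refine ⟨⟨fun k => ?_, fun k l hkl => ?_⟩, fun i k hi => ?_⟩
  · rw [mul_transvection_apply]
    split_ifs with h
    · subst h
      rw [hy.1, hy.2 k b hab, mul_zero, add_zero]
    · rw [hy.1, add_zero]
  · rw [mul_transvection_apply, hy.2 k l hkl]
    split_ifs with h
    · subst h
      rw [hy.2 k b (hkl.trans hab), mul_zero, add_zero]
    · rw [add_zero]
  · rw [mul_transvection_apply]
    split_ifs with h
    · subst h
      rw [hrel i hi]
      ring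
    · rw [hcol k h i hi, add_zero]

end Cover

theorem mul_one_add_vecMulVec_apply (h : Matrix (Fin n) (Fin n) ℂ) (q : Fin n) (v : Fin n → ℂ)
    (r l : Fin n) : (h * (1 + vecMulVec (Pi.single q 1) v)) r l = h r l + h r q * v l := by
  rw [mul_add, mul_one, mul_vecMulVec, Matrix.add_apply, vecMulVec_apply, mulVec_single_one,
    col_apply]

theorem isBorel_one_add_vecMulVec {q : Fin n} {v : Fin n → ℂ} (h0 : ∀ l < q, v l = 0)
    (hq : 1 + v q ≠ 0) : IsBorel (1 + vecMulVec (Pi.single q 1) v) := by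
  have happ : ∀ k l, (1 + vecMulVec (Pi.single q 1) v : Matrix (Fin n) (Fin n) ℂ) k l
      = (1 : Matrix (Fin n) (Fin n) ℂ) k l + (Pi.single q 1 : Fin n → ℂ) k * v l :=
    fun k l => rfl
  refine isBorel_of_diag_ne_zero (fun k l h => ?_) fun k => ?_
  · replace h : l < k := h
    rw [happ, one_apply_ne h.ne', zero_add]
    by_cases hk : k = q
    · subst hk
      rw [h0 l h, mul_zero]
    · rw [Pi.single_eq_of_ne hk, zero_mul]
  · rw [happ, one_apply_eq]
    by_cases hk : k = q
    · subst hk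
      rwa [Pi.single_eq_same, one_mul]
    · rw [Pi.single_eq_of_ne hk, zero_mul, add_zero]
      exact one_ne_zero

/-- Column reduction, with pivots chosen by an arbitrary scale-invariant rule `R`. -/
theorem exists_isChart {g : Matrix (Fin n) (Fin n) ℂ} (hg : IsUnit g.det)
    {R : (Fin n → ℂ) → Fin n → Prop} (hR : ∀ y, y ≠ 0 → ∃ i, R y i ∧ y i ≠ 0)
    (hsmul : ∀ y i (c : ℂ), c ≠ 0 → R y i → R (c • y) i) :
    ∃ u b, IsBorel b ∧ IsChart u (g * b) ∧ ∀ k, R ((g * b).col k) (u k) := by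
  have key : ∀ q ≤ n, ∃ (u : Fin n → Fin n) (b : Matrix (Fin n) (Fin n) ℂ), IsBorel b ∧
      ∀ k : Fin n, (k : ℕ) < q → (g * b) (u k) k = 1 ∧ R ((g * b).col k) (u k) ∧
        ∀ l, k < l → (g * b) (u k) l = 0 := by
    intro q
    induction q with
    | zero => exact fun _ => ⟨id, 1, IsBorel.one, fun k hk => absurd hk (Nat.not_lt_zero _)⟩
    | succ q ih =>
      intro hqn
      obtain ⟨u, b, hb, hu⟩ := ih (by omega)
      set h := g * b with hh
      let Q : Fin n := ⟨q, hqn⟩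
      have hcol : h.col Q ≠ 0 := by
        intro h0
        have hdet : IsUnit h.det := by
          rw [hh, det_mul]
          exact hg.mul hb.2
        exact hdet.ne_zero (det_eq_zero_of_column_eq_zero Q fun i => congrFun h0 i)
      obtain ⟨i, hi, hi0⟩ := hR _ hcol
      rw [col_apply] at hi0
      let v : Fin n → ℂ := fun l =>
        if l < Q then 0 else if l = Q then (h i Q)⁻¹ - 1 else -h i l * (h i Q)⁻¹
      have hvlt : ∀ l < Q, v l = 0 := fun l hl => if_pos hl
      have hvQ : v Q = (h i Q)⁻¹ - 1 := by simp [v]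
      have hvgt : ∀ l, Q < l → v l = -h i l * (h i Q)⁻¹ := fun l hl => by
        simp [v, hl.ne', not_lt.mpr hl.le]
      have happ := mul_one_add_vecMulVec_apply h Q v
      have hcolQ : ∀ r, (h * (1 + vecMulVec (Pi.single Q 1) v)) r Q = (h i Q)⁻¹ * h r Q := by
        intro r
        rw [happ, hvQ]
        ring
      refine ⟨Function.update u Q i, b * (1 + vecMulVec (Pi.single Q 1) v),
        hb.mul (isBorel_one_add_vecMulVec hvlt ?_), fun k hk => ?_⟩
      · rw [hvQ, add_sub_cancel]
        exact inv_ne_zero hi0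
      rw [← mul_assoc, ← hh]
      rcases (Nat.lt_succ_iff_lt_or_eq.mp hk) with hk | hk
      · have hkQ : k < Q := Fin.lt_def.mpr hk
        obtain ⟨h1, h2, h3⟩ := hu k hk
        have hc : (h * (1 + vecMulVec (Pi.single Q 1) v)).col k = h.col k := by
          ext r
          rw [col_apply, happ, hvlt k hkQ, mul_zero, add_zero, col_apply]
        rw [Function.update_of_ne hkQ.ne, hc]
        refine ⟨?_, h2, fun l hl => ?_⟩
        · rw [happ, hvlt k hkQ, mul_zero, add_zero, h1]
        · rw [happ, h3 l hl, h3 Q hkQ, zero_mul, add_zero]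
      · obtain rfl : k = Q := Fin.ext hk
        rw [Function.update_self]
        refine ⟨?_, ?_, fun l hl => ?_⟩
        · rw [hcolQ, inv_mul_cancel₀ hi0]
        · have hc : (h * (1 + vecMulVec (Pi.single Q 1) v)).col Q = (h i Q)⁻¹ • h.col Q :=
            funext hcolQ
          rw [hc]
          exact hsmul _ _ _ (inv_ne_zero hi0) hi
        · rw [happ, hvgt l hl]
          field_simp
          ring
  obtain ⟨u, b, hb, hu⟩ := key n le_rfl
  have hinj : Function.Injective u := by
    have aux : ∀ k l, k < l → u k ≠ u l := fun k l hkl h => by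
      have h1 := (hu k k.2).2.2 l hkl
      rw [h, (hu l l.2).1] at h1
      exact one_ne_zero h1
    intro k l h
    rcases lt_trichotomy k l with hkl | hkl | hkl
    · exact absurd h (aux k l hkl)
    · exact hkl
    · exact absurd h.symm (aux l k hkl)
  let σ : Equiv.Perm (Fin n) := Equiv.ofBijective u (Finite.injective_iff_bijective.mp hinj)
  exact ⟨σ, b, hb, ⟨fun k => (hu k k.2).1, fun k l hkl => (hu k k.2).2.2 l hkl⟩,
    fun k => (hu k k.2).2.1⟩

theorem exists_isCell {g : Matrix (Fin n) (Fin n) ℂ} (hg : IsUnit g.det) :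
    ∃ u b, IsBorel b ∧ IsCell u (g * b) := by
  classical
  obtain ⟨u, b, hb, hu, hR⟩ := exists_isChart hg (R := fun y i => ∀ i', i < i' → y i' = 0)
    (fun y hy => by
      obtain ⟨i₀, hi₀⟩ := Function.ne_iff.mp hy
      obtain ⟨i, hi, hmax⟩ := (Finset.univ.filter fun i => y i ≠ 0).exists_max_image id
        ⟨i₀, by simpa using hi₀⟩
      refine ⟨i, fun i' hi' => ?_, by simpa using hi⟩
      by_contra hne
      exact absurd (hmax i' (by simpa using hne)) (not_le.mpr hi'))
    (fun y i c _ h i' hi' => by rw [Pi.smul_apply, h i' hi', smul_zero])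
  exact ⟨u, b, hb, hu, fun i k h => hR k i h⟩

theorem exists_isChart_norm_le_one {g : Matrix (Fin n) (Fin n) ℂ} (hg : IsUnit g.det) :
    ∃ u b, IsBorel b ∧ IsChart u (g * b) ∧ ∀ i k, ‖(g * b) i k‖ ≤ 1 := by
  obtain ⟨u, b, hb, hu, hR⟩ := exists_isChart hg (R := fun y i => ∀ i', ‖y i'‖ ≤ ‖y i‖)
    (fun y hy => by
      obtain ⟨i₀, hi₀⟩ := Function.ne_iff.mp hy
      obtain ⟨i, -, hmax⟩ := Finset.univ.exists_max_image (fun i => ‖y i‖) ⟨i₀, Finset.mem_univ _⟩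
      refine ⟨i, fun i' => hmax i' (Finset.mem_univ _), fun h => ?_⟩
      have := hmax i₀ (Finset.mem_univ _)
      rw [h, norm_zero] at this
      exact hi₀ (norm_le_zero_iff.mp this))
    (fun y i c _ h i' => by
      rw [Pi.smul_apply, Pi.smul_apply, norm_smul, norm_smul]
      exact mul_le_mul_of_nonneg_left (h i') (norm_nonneg c))
  refine ⟨u, b, hb, hu, fun i k => ?_⟩
  have := hR k i
  rwa [col_apply, col_apply, hu.1, norm_one] at this

theorem IsBelow.mul_left {u : Equiv.Perm (Fin n)} {X Z : Matrix (Fin n) (Fin n) ℂ}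
    (hX : X.IsUpperTriangular) (hZ : IsBelow u Z) : IsBelow u (X * Z) := by
  intro i k hi
  rw [mul_apply]
  refine Finset.sum_eq_zero fun m _ => ?_
  rcases lt_or_ge m i with h | h
  · rw [hX h, zero_mul]
  · rw [hZ m k (hi.trans_le h), mul_zero]

theorem IsCell.exists_mul_eq {u : Equiv.Perm (Fin n)} {x Z : Matrix (Fin n) (Fin n) ℂ}
    (hx : IsCell u x) (hZ : IsBelow u Z) : ∃ X, X.IsUpperTriangular ∧ X * x = Z := by
  have hsub : ∀ {Y}, IsBelow u Y → (Y.submatrix id u.symm).IsUpperTriangular := by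
    intro Y hY i j hij
    exact hY i _ (by simpa using hij)
  have hB : IsBorel (x.submatrix id u.symm) := by
    refine isBorel_of_diag_ne_zero (hsub hx.2) fun k => ?_
    have := hx.1.1 (u.symm k)
    rw [Equiv.apply_symm_apply] at this
    rw [submatrix_apply, id, this]
    exact one_ne_zero
  have h2 : ∀ Y : Matrix (Fin n) (Fin n) ℂ, (Y.submatrix id u.symm).submatrix id u = Y := by
    intro Y
    ext i j
    simp
  refine ⟨Z.submatrix id u.symm * (x.submatrix id u.symm)⁻¹, (hsub hZ).mul hB.inv.1, ?_⟩
  have h1 : Z.submatrix id u.symm * (x.submatrix id u.symm)⁻¹ * x.submatrix id u.symm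
      = Z.submatrix id u.symm := by
    rw [mul_assoc, nonsing_inv_mul _ hB.2, mul_one]
  calc _ = (Z.submatrix id u.symm * (x.submatrix id u.symm)⁻¹ * x.submatrix id u.symm).submatrix
        id u := by
        rw [← submatrix_mul_equiv _ _ id (Equiv.refl (Fin n)) u, Equiv.coe_refl, submatrix_id_id,
          h2]
    _ = Z := by rw [h1, h2]

/-- The tangent directions to the Schubert cell are represented, modulo the vertical ones
`x * Y`, in `cellDir`. -/
theorem IsCell.exists_sub_mem_cellDir {u : Equiv.Perm (Fin n)} {x G : Matrix (Fin n) (Fin n) ℂ}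
    (hx : IsCell u x) (hG : IsBelow u G) :
    ∃ Y, Y.IsUpperTriangular ∧ G - x * Y ∈ cellDir u := by
  have key : ∀ q ≤ n, ∃ Y : Matrix (Fin n) (Fin n) ℂ, Y.IsUpperTriangular ∧
      (∀ k l, u l < u k → Y k l = 0) ∧
      ∀ k l : Fin n, (k : ℕ) < q → k ≤ l → (x * Y) (u k) l = G (u k) l := by
    intro q
    induction q with
    | zero => exact fun _ => ⟨0, blockTriangular_zero, fun _ _ _ => rfl,
        fun k _ hk => absurd hk (Nat.not_lt_zero _)⟩
    | succ q ih =>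
      intro hqn
      obtain ⟨Y, hY, hY0, hYq⟩ := ih (by omega)
      let Q : Fin n := ⟨q, hqn⟩
      let v : Fin n → ℂ := fun l => if Q ≤ l then G (u Q) l - (x * Y) (u Q) l else 0
      have happ : ∀ k l, (Y + vecMulVec (Pi.single Q 1) v) k l
          = Y k l + (Pi.single Q 1 : Fin n → ℂ) k * v l := fun _ _ => rfl
      have hmul : ∀ r l, (x * (Y + vecMulVec (Pi.single Q 1) v)) r l
          = (x * Y) r l + x r Q * v l := fun r l => by
        rw [mul_add, mul_vecMulVec, Matrix.add_apply, vecMulVec_apply, mulVec_single_one,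
          col_apply]
      refine ⟨Y + vecMulVec (Pi.single Q 1) v, fun k l h => ?_, fun k l h => ?_,
        fun k l hk hkl => ?_⟩
      · replace h : l < k := h
        rw [happ, hY h, zero_add]
        by_cases hk : k = Q
        · subst hk
          rw [show v l = 0 from if_neg (not_le.mpr h), mul_zero]
        · rw [Pi.single_eq_of_ne hk, zero_mul]
      · rw [happ, hY0 k l h, zero_add]
        by_cases hk : k = Q
        · subst hk
          have hv : v l = 0 := by
            simp only [v]
            split_ifs
            · rw [hG _ _ h, zero_sub, neg_eq_zero, mul_apply]
              refine Finset.sum_eq_zero fun m _ => ?_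
              rcases lt_or_ge (u l) (u m) with h' | h'
              · rw [hY0 m l h', mul_zero]
              · rw [hx.2 _ m (h'.trans_lt h), zero_mul]
            · rfl
          rw [hv, mul_zero]
        · rw [Pi.single_eq_of_ne hk, zero_mul]
      · rw [hmul]
        rcases (Nat.lt_succ_iff_lt_or_eq.mp hk) with hk | hk
        · rw [hYq k l hk hkl, hx.1.2 k Q (Fin.lt_def.mpr hk), zero_mul, add_zero]
        · obtain rfl : k = Q := Fin.ext hk
          rw [hx.1.1, one_mul, show v l = _ from if_pos hkl, add_sub_cancel]
  obtain ⟨Y, hY, hY0, hYn⟩ := key n le_rfl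
  refine ⟨Y, hY, fun k l h => ?_, fun i l h => ?_⟩
  · rw [Matrix.sub_apply, hYn k l k.2 h, sub_self]
  · rw [Matrix.sub_apply, hG i l h, zero_sub, neg_eq_zero, mul_apply]
    refine Finset.sum_eq_zero fun m _ => ?_
    rcases lt_or_ge (u l) (u m) with h' | h'
    · rw [hY0 m l h', mul_zero]
    · rw [hx.2 _ m (h'.trans_lt h), zero_mul]

theorem inf_eq_bot_of_le_sup {K V : Type*} [Field K] [AddCommGroup V] [Module K V]
    [FiniteDimensional K V] {S A N : Submodule K V} (hS : S ⊓ N = ⊥) (hle : S ≤ A ⊔ N)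
    (hrank : finrank K A ≤ finrank K S) : A ⊓ N = ⊥ := by
  have h1 := Submodule.finrank_sup_add_finrank_inf_eq S N
  have h2 := Submodule.finrank_sup_add_finrank_inf_eq A N
  have h3 := Submodule.finrank_mono (sup_le hle le_sup_right : S ⊔ N ≤ A ⊔ N)
  rw [hS, finrank_bot] at h1
  exact Submodule.finrank_eq_zero.mp (by omega)

/-- The determinant whose vanishing says that the `d`-dimensional subspace `E` of the flag of
`x` meets the osculating subspace `F_{n-d}(s)`; see `osc_eq_zero_of_inf_oscF_ne_bot`. -/
noncomputable def osc (d : ℕ) (x : Matrix (Fin n) (Fin n) ℂ) (s : ℂ) : ℂ :=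
  (of fun i k : Fin n => if (k : ℕ) < d then x i k
    else s ^ (i : ℕ) * ((i : ℕ) : ℂ) ^ ((k : ℕ) - d)).det

theorem osc_one_of_forall {d : ℕ} {x y : Matrix (Fin n) (Fin n) ℂ} {s : ℂ} {e : Fin n → ℕ}
    (h : ∀ i k : Fin n, (k : ℕ) < d → s ^ (i : ℕ) * y i k = s ^ e k * x i k) :
    (∏ i : Fin n, s ^ (i : ℕ)) * osc d y 1
      = (∏ k : Fin n, if (k : ℕ) < d then s ^ e k else 1) * osc d x s := by
  rw [osc, osc, ← det_mul_column, ← det_mul_row]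
  congr 1
  ext i k
  simp only [of_apply]
  split_ifs with hk
  · exact h i k hk
  · ring

theorem osc_eq_zero_iff {d : ℕ} {x y : Matrix (Fin n) (Fin n) ℂ} {s : ℂ} (hs : s ≠ 0)
    {e : Fin n → ℕ} (h : ∀ i k : Fin n, (k : ℕ) < d → s ^ (i : ℕ) * y i k = s ^ e k * x i k) :
    osc d x s = 0 ↔ osc d y 1 = 0 := by
  have h1 : (∏ i : Fin n, s ^ (i : ℕ)) ≠ 0 :=
    Finset.prod_ne_zero_iff.mpr fun _ _ => pow_ne_zero _ hs
  have h2 : (∏ k : Fin n, if (k : ℕ) < d then s ^ e k else 1) ≠ 0 :=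
    Finset.prod_ne_zero_iff.mpr fun k _ => by split_ifs <;> simp [hs]
  have := osc_one_of_forall h
  constructor <;> intro h0 <;> rw [h0, mul_zero] at this
  · exact (mul_eq_zero.mp this).resolve_left h1
  · exact (mul_eq_zero.mp this.symm).resolve_left h2

/-- The osculating subspaces at `s = 1` are transverse to the coordinate subspaces. -/
theorem osc_one_ne_zero {d : ℕ} {y : Matrix (Fin n) (Fin n) ℂ} (u : Equiv.Perm (Fin n))
    (hy : ∀ i k : Fin n, (k : ℕ) < d → y i k = if i = u k then 1 else 0) : osc d y 1 ≠ 0 := by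
  classical
  intro h0
  obtain ⟨c, hc0, hc⟩ := exists_mulVec_eq_zero_iff.mpr h0
  have hrow : ∀ i : Fin n, ∑ k : Fin n, (if (k : ℕ) < d then (if i = u k then 1 else 0)
      else ((i : ℕ) : ℂ) ^ ((k : ℕ) - d)) * c k = 0 := by
    intro i
    refine Eq.trans (Finset.sum_congr rfl fun k _ => ?_) (congrFun hc i)
    simp only [of_apply, one_pow, one_mul]
    split_ifs with h1 h2
    · rw [hy i k h1, if_pos h2]
    · rw [hy i k h1, if_neg h2]
    · rfl
  let S : Finset (Fin n) := Finset.univ.filter fun k => d ≤ (k : ℕ)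
  let p : Polynomial ℂ := ∑ k ∈ S, Polynomial.C (c k) * Polynomial.X ^ ((k : ℕ) - d)
  have hcard : S.card = n - d := by
    rcases le_or_gt n d with h | h
    · rw [Nat.sub_eq_zero_of_le h, Finset.card_eq_zero, Finset.filter_eq_empty_iff]
      intro k _
      have := k.2
      omega
    · have : S = Finset.Ici (⟨d, h⟩ : Fin n) := by
        ext k
        simp [S, Fin.le_def]
      rw [this, Fin.card_Ici]
  have hp : p = 0 := by
    refine Polynomial.eq_zero_of_degree_lt_of_eval_index_eq_zero (s := S)
      (v := fun k : Fin n => ((u k : ℕ) : ℂ)) ?_ ?_ ?_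
    · intro k _ l _ h
      exact u.injective (Fin.ext (Nat.cast_injective h))
    · refine (Polynomial.degree_sum_le _ _).trans_lt ?_
      rw [Finset.sup_lt_iff (WithBot.bot_lt_coe _)]
      intro k hk
      refine (Polynomial.degree_C_mul_X_pow_le _ _).trans_lt ?_
      rw [hcard]
      have h1 : d ≤ (k : ℕ) := (Finset.mem_filter.mp hk).2
      have := k.2
      exact_mod_cast (by omega : (k : ℕ) - d < n - d)
    · intro k hk
      have h1 : d ≤ (k : ℕ) := (Finset.mem_filter.mp hk).2
      rw [← hrow (u k), Polynomial.eval_finsetSum, Finset.sum_filter]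
      refine Finset.sum_congr rfl fun l _ => ?_
      by_cases hl : (l : ℕ) < d
      · rw [if_neg (not_le.mpr hl), if_pos hl, if_neg, zero_mul]
        intro h
        have := u.injective h
        subst this
        omega
      · rw [if_pos (not_lt.mp hl), if_neg hl]
        rw [Polynomial.eval_mul, Polynomial.eval_C, Polynomial.eval_pow, Polynomial.eval_X, mul_comm]
  have hhigh : ∀ k : Fin n, d ≤ (k : ℕ) → c k = 0 := by
    intro k hk
    have h1 : p.coeff ((k : ℕ) - d) = 0 := by rw [hp, Polynomial.coeff_zero]
    rw [Polynomial.finsetSum_coeff, Finset.sum_eq_single k] at h1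
    · simpa using h1
    · intro l hl hlk
      have h2 : d ≤ (l : ℕ) := (Finset.mem_filter.mp hl).2
      rw [Polynomial.coeff_C_mul_X_pow, if_neg]
      intro h
      exact hlk (Fin.ext (by omega))
    · intro h
      exact absurd (Finset.mem_filter.mpr ⟨Finset.mem_univ k, hk⟩) h
  apply hc0
  funext k
  by_cases hk : (k : ℕ) < d
  · have := hrow (u k)
    rw [Finset.sum_eq_single k] at this
    · simpa [hk] using this
    · intro l _ hl
      by_cases hld : (l : ℕ) < d
      · rw [if_pos hld, if_neg (fun h => hl (u.injective h).symm), zero_mul]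
      · rw [hhigh l (not_lt.mp hld), mul_zero]
    · exact fun h => absurd (Finset.mem_univ _) h
  · exact hhigh k (not_lt.mp hk)

/-- The character by which upper triangular matrices act on `osc d`. -/
noncomputable def oscChar (d : ℕ) (b : Matrix (Fin n) (Fin n) ℂ) : ℂ :=
  ∏ k : Fin n, if (k : ℕ) < d then b k k else 1

theorem IsBorel.oscChar_ne_zero {b : Matrix (Fin n) (Fin n) ℂ} (hb : IsBorel b) (d : ℕ) :
    oscChar d b ≠ 0 :=
  Finset.prod_ne_zero_iff.mpr fun k _ => by
    split_ifs
    · exact hb.diag_ne_zero k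
    · exact one_ne_zero

theorem osc_mul {b : Matrix (Fin n) (Fin n) ℂ} (hb : b.IsUpperTriangular) (d : ℕ)
    (g : Matrix (Fin n) (Fin n) ℂ) (s : ℂ) : osc d (g * b) s = oscChar d b * osc d g s := by
  let b' : Matrix (Fin n) (Fin n) ℂ :=
    of fun k l => if (l : ℕ) < d then b k l else (1 : Matrix (Fin n) (Fin n) ℂ) k l
  have hb' : b'.IsUpperTriangular := by
    intro k l h
    replace h : l < k := h
    simp only [b', of_apply]
    split_ifs
    · exact hb h
    · exact one_apply_ne h.ne'
  have hdet : b'.det = oscChar d b := by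
    rw [det_of_isUpperTriangular hb', oscChar]
    refine Finset.prod_congr rfl fun k _ => ?_
    simp only [b', of_apply, one_apply_eq]
  rw [← hdet, mul_comm, osc, osc, ← det_mul]
  congr 1
  ext i l
  rw [mul_apply]
  simp only [b', of_apply]
  by_cases hl : (l : ℕ) < d
  · simp only [if_pos hl]
    rw [mul_apply]
    refine Finset.sum_congr rfl fun k _ => ?_
    rcases le_or_gt k l with h | h
    · rw [if_pos (lt_of_le_of_lt (Fin.le_def.mp h) hl)]
    · rw [hb h, mul_zero, mul_zero]
  · simp only [if_neg hl]
    rw [Finset.sum_eq_single l]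
    · rw [one_apply_eq, mul_one, if_neg hl]
    · intro k _ hk
      rw [one_apply_ne hk, mul_zero]
    · exact fun h => absurd (Finset.mem_univ _) h

theorem osc_mul_eq_zero_iff {b : Matrix (Fin n) (Fin n) ℂ} (hb : IsBorel b) {d : ℕ}
    {g : Matrix (Fin n) (Fin n) ℂ} {s : ℂ} : osc d (g * b) s = 0 ↔ osc d g s = 0 := by
  rw [osc_mul hb.1, mul_eq_zero, or_iff_right (hb.oscChar_ne_zero d)]

theorem osc_conj (d : ℕ) (x : Matrix (Fin n) (Fin n) ℂ) (s : ℝ) :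
    osc d (x.map (starRingEnd ℂ)) s = starRingEnd ℂ (osc d x s) := by
  rw [osc, osc, RingHom.map_det]
  congr 1
  ext i k
  simp only [of_apply, RingHom.mapMatrix_apply, map_apply]
  split_ifs <;> simp

theorem osc_mul_transvection_of_not {d : ℕ} {a b : Fin n} (hab : a < b)
    (h : ¬((a : ℕ) < d ∧ d ≤ b)) (x : Matrix (Fin n) (Fin n) ℂ) (t s : ℂ) :
    osc d (x * transvection b a t) s = osc d x s := by
  by_cases ha : (a : ℕ) < d
  · have hb : (b : ℕ) < d := by
      by_contra hb
      exact h ⟨ha, not_lt.mp hb⟩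
    rw [← mul_one (osc d x s), ← det_transvection_of_ne b a hab.ne' t, osc, osc, ← det_mul]
    congr 1
    ext i k
    rw [mul_transvection_apply, of_apply, mul_transvection_apply, of_apply, of_apply,
      if_pos hb]
    split_ifs with h1 h2 h2
    · rfl
    · rfl
    · subst h2
      exact absurd ha h1
    · rw [add_zero]
  · rw [osc, osc]
    congr 1
    ext i k
    rw [of_apply, of_apply, mul_transvection_apply]
    split_ifs with h1 h2
    · subst h2
      exact absurd h1 ha
    · rw [add_zero]
    · rfl

/-! ### Rescaling a Schubert cell -/

/-- The limit `s → 0` of `(scaleCell u s x)` is the permutation matrix of `u`. -/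
def scaleCell (u : Equiv.Perm (Fin n)) (s : ℂ) (x : Matrix (Fin n) (Fin n) ℂ) :
    Matrix (Fin n) (Fin n) ℂ :=
  of fun i k => if i ≤ u k then s ^ ((u k : ℕ) - (i : ℕ)) * x i k else 0

theorem IsBelow.pow_mul_scaleCell {u : Equiv.Perm (Fin n)} {x : Matrix (Fin n) (Fin n) ℂ}
    (hx : IsBelow u x) (s : ℂ) (i k : Fin n) :
    s ^ (i : ℕ) * scaleCell u s x i k = s ^ (u k : ℕ) * x i k := by
  simp only [scaleCell, of_apply]
  split_ifs with h
  · rw [← mul_assoc, ← pow_add, Nat.add_sub_cancel' (Fin.le_def.mp h)]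
  · rw [hx i k (not_le.mp h), mul_zero, mul_zero]

theorem IsChart.scaleCell_zero {u : Equiv.Perm (Fin n)} {x : Matrix (Fin n) (Fin n) ℂ}
    (hx : IsChart u x) (i k : Fin n) : scaleCell u 0 x i k = if i = u k then 1 else 0 := by
  simp only [scaleCell, of_apply]
  rcases lt_trichotomy i (u k) with h | h | h
  · rw [if_pos h.le, if_neg h.ne, zero_pow, zero_mul]
    have := Fin.lt_def.mp h
    omega
  · rw [if_pos h.le, if_pos h, h, hx.1, Nat.sub_self, pow_zero, mul_one]
  · rw [if_neg (not_le.mpr h), if_neg h.ne']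

theorem IsBelow.osc_eq_zero_iff {u : Equiv.Perm (Fin n)} {x : Matrix (Fin n) (Fin n) ℂ}
    (hx : IsBelow u x) {s : ℂ} (hs : s ≠ 0) (d : ℕ) :
    osc d x s = 0 ↔ osc d (scaleCell u s x) 1 = 0 :=
  SchubertCell.osc_eq_zero_iff hs fun i k _ => hx.pow_mul_scaleCell s i k

theorem continuous_scaleCell (u : Equiv.Perm (Fin n)) :
    Continuous fun p : Matrix (Fin n) (Fin n) ℂ × ℂ => scaleCell u p.2 p.1 := by
  refine continuous_matrix fun i k => ?_
  simp only [scaleCell, of_apply]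
  split_ifs
  · exact (continuous_snd.pow _).mul (continuous_fst.matrix_elem i k)
  · exact continuous_const

theorem continuous_osc (d : ℕ) (s : ℂ) :
    Continuous fun x : Matrix (Fin n) (Fin n) ℂ => osc d x s := by
  refine Continuous.matrix_det (continuous_matrix fun i k => ?_)
  simp only [of_apply]
  split_ifs
  · exact continuous_id.matrix_elem i k
  · exact continuous_const

/-- Near `s = 0`, the osculating condition fails near a given point of the Schubert cell. -/
theorem IsCell.eventually_osc_ne_zero {u : Equiv.Perm (Fin n)} {x : Matrix (Fin n) (Fin n) ℂ}
    (hx : IsCell u x) (d : ℕ) :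
    ∀ᶠ p : Matrix (Fin n) (Fin n) ℂ × ℂ in 𝓝 (x, 0),
      IsBelow u p.1 → p.2 ≠ 0 → osc d p.1 p.2 ≠ 0 := by
  have hc : Continuous fun p : Matrix (Fin n) (Fin n) ℂ × ℂ => osc d (scaleCell u p.2 p.1) 1 :=
    (continuous_osc d 1).comp (continuous_scaleCell u)
  filter_upwards [hc.continuousAt.eventually_ne
    (osc_one_ne_zero u fun i k _ => hx.1.scaleCell_zero i k)] with p hp hb hs h0
  exact hp ((hb.osc_eq_zero_iff hs d).mp h0)

/-! ### The determinant and intersections with osculating subspaces -/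

theorem exists_polynomial_oscF {j : ℕ} {s : ℂ} (hs : s ≠ 0) {v : Fin n → ℂ}
    (hv : v ∈ oscF n j s) :
    ∃ p : Polynomial ℂ, p.degree < j ∧
      ∀ i : Fin n, v i = s ^ (i : ℕ) * p.eval ((i : ℕ) : ℂ) := by
  induction hv using Submodule.span_induction with
  | mem v hv =>
    obtain ⟨m, rfl⟩ := hv
    refine ⟨(s ^ (m : ℕ))⁻¹ • descPochhammer ℂ m, ?_, fun i => ?_⟩
    · refine (Polynomial.degree_smul_le _ _).trans_lt ?_
      refine Polynomial.degree_le_natDegree.trans_lt ?_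
      rw [descPochhammer_natDegree]
      exact_mod_cast m.2
    · simp only [oscVec]
      rw [iteratedDeriv_pow, Polynomial.eval_smul,
        descPochhammer_eval_eq_descFactorial, smul_eq_mul]
      rcases le_or_gt (m : ℕ) (i : ℕ) with h | h
      · rw [pow_sub₀ s hs h]
        ring
      · rw [Nat.descFactorial_of_lt h]
        simp
  | zero => exact ⟨0, by simp, by simp⟩
  | add v v' _ _ hv hv' =>
    obtain ⟨p, hp, h⟩ := hv
    obtain ⟨p', hp', h'⟩ := hv'
    refine ⟨p + p', (Polynomial.degree_add_le _ _).trans_lt (max_lt hp hp'), fun i => ?_⟩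
    rw [Pi.add_apply, h, h', Polynomial.eval_add]
    ring
  | smul a v _ hv =>
    obtain ⟨p, hp, h⟩ := hv
    refine ⟨a • p, (Polynomial.degree_smul_le _ _).trans_lt hp, fun i => ?_⟩
    rw [Pi.smul_apply, h, Polynomial.eval_smul, smul_eq_mul, smul_eq_mul]
    ring

/-- The span of the first `d` columns. -/
def colSpan (d : ℕ) (x : Matrix (Fin n) (Fin n) ℂ) : Submodule ℂ (Fin n → ℂ) :=
  (coeffSpace d n x).map x.mulVecLin

theorem mem_colSpan {d : ℕ} {x : Matrix (Fin n) (Fin n) ℂ} {v : Fin n → ℂ} :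
    v ∈ colSpan d x ↔ ∃ c : Fin n → ℂ, (∀ k : Fin n, d ≤ k → c k = 0) ∧ x *ᵥ c = v := by
  simp only [colSpan, Submodule.mem_map, mem_coeffSpace, mulVecLin_apply]
  constructor
  · rintro ⟨c, ⟨h1, -⟩, h⟩
    exact ⟨c, h1, h⟩
  · rintro ⟨c, h1, h⟩
    exact ⟨c, ⟨h1, fun i hi => absurd i.2 (not_lt.mpr hi)⟩, h⟩

theorem eval_eq_sum_range_shift {d : ℕ} {p : Polynomial ℂ} (hp : p.degree < (n - d : ℕ)) (z : ℂ) :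
    p.eval z = ∑ k ∈ Finset.range n, if k < d then 0 else p.coeff (k - d) * z ^ (k - d) := by
  rcases le_or_gt n d with hn | hn
  · have : p = 0 := by
      rw [Nat.sub_eq_zero_of_le hn] at hp
      exact Polynomial.degree_eq_bot.mp (Nat.WithBot.lt_zero_iff.mp hp)
    rw [Finset.sum_eq_zero, this, Polynomial.eval_zero]
    intro k hk
    rw [if_pos ((Finset.mem_range.mp hk).trans_le hn)]
  · obtain ⟨m, rfl⟩ := Nat.exists_eq_add_of_le hn.le
    rw [Nat.add_sub_cancel_left] at hp
    have hm : p.natDegree < m := by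
      by_cases h0 : p = 0
      · rw [h0, Polynomial.natDegree_zero]
        omega
      · exact (Polynomial.natDegree_lt_iff_degree_lt h0).mpr hp
    rw [Polynomial.eval_eq_sum_range' hm, Finset.sum_range_add,
      Finset.sum_eq_zero (s := Finset.range d) fun k hk => if_pos (Finset.mem_range.mp hk), zero_add]
    refine Finset.sum_congr rfl fun k _ => ?_
    rw [if_neg (by omega), Nat.add_sub_cancel_left]

theorem osc_eq_zero_of_inf_oscF_ne_bot {d : ℕ} {x : Matrix (Fin n) (Fin n) ℂ} {s : ℂ}
    (hs : s ≠ 0) (h : colSpan d x ⊓ oscF n (n - d) s ≠ ⊥) : osc d x s = 0 := by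
  obtain ⟨v, ⟨hv1, hv2⟩, hv0⟩ := (Submodule.ne_bot_iff _).mp h
  obtain ⟨c, hc, rfl⟩ := mem_colSpan.mp hv1
  obtain ⟨p, hp, hpv⟩ := exists_polynomial_oscF hs hv2
  refine exists_mulVec_eq_zero_iff.mp
    ⟨fun k => if (k : ℕ) < d then c k else -p.coeff ((k : ℕ) - d), fun h0 => hv0 ?_, ?_⟩
  · have : c = 0 := by
      funext k
      by_cases hk : (k : ℕ) < d
      · simpa [hk] using congrFun h0 k
      · exact hc k (not_lt.mp hk)
    rw [this, mulVec_zero]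
  · funext i
    have heval : p.eval ((i : ℕ) : ℂ)
        = ∑ k : Fin n, if (k : ℕ) < d then 0
          else p.coeff ((k : ℕ) - d) * ((i : ℕ) : ℂ) ^ ((k : ℕ) - d) := by
      rw [Fin.sum_univ_eq_sum_range (fun k => if k < d then 0
          else p.coeff (k - d) * ((i : ℕ) : ℂ) ^ (k - d)) n, eval_eq_sum_range_shift hp]
    have := hpv i
    rw [heval, mulVec, dotProduct] at this
    rw [Pi.zero_apply, mulVec, dotProduct, ← sub_eq_zero.mpr this, Finset.mul_sum,
      ← Finset.sum_sub_distrib]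
    refine Finset.sum_congr rfl fun k _ => ?_
    simp only [of_apply]
    split_ifs with hk
    · rw [mul_zero, sub_zero]
    · rw [hc k (not_lt.mp hk), mul_zero, zero_sub]
      ring

/-- Local existence of normal forms, close to a given normal form. -/
theorem IsChart.eventually_exists {u : Equiv.Perm (Fin n)} {x : Matrix (Fin n) (Fin n) ℂ}
    (hx : IsChart u x) {O : Set (Matrix (Fin n) (Fin n) ℂ)} (hO : O ∈ 𝓝 x) :
    ∀ᶠ y in 𝓝 x, ∃ b, IsBorel b ∧ y * b ∈ O ∧ IsChart u (y * b) := by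
  have key : ∀ q ≤ n, ∀ O ∈ 𝓝 x, ∀ᶠ y in 𝓝 x, ∃ b, IsBorel b ∧ y * b ∈ O ∧
      ∀ k : Fin n, (k : ℕ) < q → (y * b) (u k) k = 1 ∧ ∀ l, k < l → (y * b) (u k) l = 0 := by
    intro q
    induction q with
    | zero =>
      intro _ O hO
      filter_upwards [hO] with y hy
      exact ⟨1, IsBorel.one, by rwa [mul_one], fun k hk => absurd hk (Nat.not_lt_zero _)⟩
    | succ q ih =>
      intro hqn O hO
      let Q : Fin n := ⟨q, hqn⟩
      let v : Matrix (Fin n) (Fin n) ℂ → Fin n → ℂ := fun h l =>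
        if l < Q then 0 else if l = Q then (h (u Q) Q)⁻¹ - 1 else -h (u Q) l * (h (u Q) Q)⁻¹
      have hvlt : ∀ h, ∀ l < Q, v h l = 0 := fun h l hl => if_pos hl
      have hvQ : ∀ h, v h Q = (h (u Q) Q)⁻¹ - 1 := fun h => by simp [v]
      have hvgt : ∀ h l, Q < l → v h l = -h (u Q) l * (h (u Q) Q)⁻¹ := fun h l hl => by
        simp [v, hl.ne', not_lt.mpr hl.le]
      let f : Matrix (Fin n) (Fin n) ℂ → Matrix (Fin n) (Fin n) ℂ := fun h =>
        h * (1 + vecMulVec (Pi.single Q 1) (v h))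
      have hf : ∀ h r l, f h r l = h r l + h r Q * v h l := fun h =>
        mul_one_add_vecMulVec_apply h Q (v h)
      have hv0 : v x = 0 := by
        funext l
        rcases lt_trichotomy l Q with hl | rfl | hl
        · exact hvlt x l hl
        · rw [hvQ, hx.1, inv_one, sub_self, Pi.zero_apply]
        · rw [hvgt x l hl, hx.2 Q l hl, neg_zero, zero_mul, Pi.zero_apply]
      have hfx : f x = x := by
        ext r l
        rw [hf, hv0, Pi.zero_apply, mul_zero, add_zero]
      have hentry : ∀ r l, ContinuousAt (fun h : Matrix (Fin n) (Fin n) ℂ => h r l) x :=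
        fun r l => (continuous_id.matrix_elem r l).continuousAt
      have hpiv : x (u Q) Q ≠ 0 := by
        rw [hx.1]
        exact one_ne_zero
      have hcont : ContinuousAt f x := by
        refine continuousAt_pi.mpr fun r => continuousAt_pi.mpr fun l => ?_
        simp only [hf]
        refine (hentry r l).add ((hentry r Q).mul ?_)
        simp only [v]
        split_ifs
        · exact continuousAt_const
        · exact ((hentry _ _).inv₀ hpiv).sub continuousAt_const
        · exact (hentry _ _).neg.mul ((hentry _ _).inv₀ hpiv)
      have hfO : ∀ᶠ h in 𝓝 x, f h ∈ O := hcont.preimage_mem_nhds (by rwa [hfx])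
      have hO' : {h | f h ∈ O ∧ h (u Q) Q ≠ 0} ∈ 𝓝 x :=
        hfO.and ((hentry _ _).eventually_ne hpiv)
      filter_upwards [ih (by omega) _ hO'] with y ⟨b, hb, ⟨hbO, hb0⟩, hyb⟩
      refine ⟨b * (1 + vecMulVec (Pi.single Q 1) (v (y * b))),
        hb.mul (isBorel_one_add_vecMulVec (hvlt _) ?_), ?_, fun k hk => ?_⟩
      · rw [hvQ, add_sub_cancel]
        exact inv_ne_zero hb0
      · rwa [← mul_assoc]
      rw [← mul_assoc]
      change f (y * b) (u k) k = 1 ∧ ∀ l, k < l → f (y * b) (u k) l = 0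
      rcases (Nat.lt_succ_iff_lt_or_eq.mp hk) with hk | hk
      · have hkQ : k < Q := Fin.lt_def.mpr hk
        obtain ⟨h1, h2⟩ := hyb k hk
        refine ⟨?_, fun l hl => ?_⟩
        · rw [hf, hvlt _ k hkQ, mul_zero, add_zero, h1]
        · rw [hf, h2 l hl, h2 Q hkQ, zero_mul, add_zero]
      · obtain rfl : k = Q := Fin.ext hk
        refine ⟨?_, fun l hl => ?_⟩
        · rw [hf, hvQ]
          field_simp
          ring
        · rw [hf, hvgt _ l hl]
          field_simp
          ring
  filter_upwards [key n le_rfl O hO] with y ⟨b, hb, hbO, h⟩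
  exact ⟨b, hb, hbO, fun k => (h k k.2).1, fun k l hkl => (h k k.2).2 l hkl⟩

theorem IsChart.eventually_exists_mul {u : Equiv.Perm (Fin n)}
    {x c : Matrix (Fin n) (Fin n) ℂ} (hx : IsChart u x) (hc : IsBorel c)
    {O : Set (Matrix (Fin n) (Fin n) ℂ)} (hO : O ∈ 𝓝 x) :
    ∀ᶠ y in 𝓝 (x * c), ∃ b, IsBorel b ∧ y * b ∈ O ∧ IsChart u (y * b) := by
  have hcont : Tendsto (fun y => y * c⁻¹) (𝓝 (x * c)) (𝓝 x) := by
    have : Continuous fun y : Matrix (Fin n) (Fin n) ℂ => y * c⁻¹ :=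
      continuous_id.matrix_mul continuous_const
    have h := this.tendsto (x * c)
    rwa [mul_assoc, mul_nonsing_inv _ hc.2, mul_one] at h
  filter_upwards [hcont.eventually (hx.eventually_exists hO)] with y ⟨b, hb, hbO, h⟩
  exact ⟨c⁻¹ * b, hc.inv.mul hb, by rwa [← mul_assoc], by rwa [← mul_assoc]⟩

/-- An immersion is locally injective, and an immersion nearby. -/
theorem exists_injOn_of_injective_fderiv {E F : Type*} [NormedAddCommGroup E] [NormedSpace ℂ E]
    [FiniteDimensional ℂ E] [NormedAddCommGroup F] [NormedSpace ℂ F] [FiniteDimensional ℂ F]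
    {f : E → F} (hf : ContDiff ℂ 1 f) {p : E} (hp : Function.Injective (fderiv ℂ f p)) :
    ∃ O ∈ 𝓝 p, Set.InjOn f O ∧ ∀ q ∈ O, Function.Injective (fderiv ℂ f q) := by
  have : CompleteSpace E := FiniteDimensional.complete ℂ E
  obtain ⟨L, hL⟩ := (fderiv ℂ f p : E →ₗ[ℂ] F).exists_leftInverse_of_injective
    (LinearMap.ker_eq_bot.mpr hp)
  let L' : F →L[ℂ] E := LinearMap.toContinuousLinearMap L
  have hid : L' ∘L fderiv ℂ f p = ContinuousLinearMap.id ℂ E := by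
    ext v
    exact congrArg (fun T : E →ₗ[ℂ] E => T v) hL
  have hstrict : HasStrictFDerivAt (fun y => L' (f y))
      ((ContinuousLinearEquiv.refl ℂ E : E ≃L[ℂ] E) : E →L[ℂ] E) p := by
    have h1 := hf.contDiffAt.hasStrictFDerivAt (x := p) one_ne_zero
    have h2 := L'.hasStrictFDerivAt.comp p h1
    rwa [hid] at h2
  have hopen : ∀ᶠ q in 𝓝 p, Function.Injective (fderiv ℂ f q) :=
    (hf.continuous_fderiv one_ne_zero).continuousAt.preimage_mem_nhds
      (ContinuousLinearMap.isOpen_injective.mem_nhds hp)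
  let e := hstrict.toOpenPartialHomeomorph
  refine ⟨e.source ∩ {q | Function.Injective (fderiv ℂ f q)},
    inter_mem (e.open_source.mem_nhds hstrict.mem_toOpenPartialHomeomorph_source) hopen, ?_,
    fun q hq => hq.2⟩
  intro q hq q' hq' h
  exact e.injOn hq.1 hq'.1 (congrArg L' h)

section Analysis

attribute [local instance] Matrix.normedAddCommGroup Matrix.normedSpace

theorem contDiff_det : ContDiff ℂ 1 fun x : Matrix (Fin n) (Fin n) ℂ => x.det := by
  simp only [det_apply']
  refine ContDiff.sum fun σ _ => contDiff_const.mul (contDiff_prod fun i _ => ?_)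
  exact (contDiff_apply_apply ℂ ℂ (σ i) i)

theorem contDiff_matrix {E : Type*} [NormedAddCommGroup E] [NormedSpace ℂ E]
    {f : E → Matrix (Fin n) (Fin n) ℂ} (h : ∀ i k, ContDiff ℂ 1 fun e => f e i k) :
    ContDiff ℂ 1 f :=
  contDiff_pi.mpr fun i => contDiff_pi.mpr fun k => h i k

theorem contDiff_entry (i k : Fin n) :
    ContDiff ℂ 1 fun x : Matrix (Fin n) (Fin n) ℂ => x i k :=
  contDiff_apply_apply ℂ ℂ i k

theorem contDiff_osc (d : ℕ) (s : ℂ) :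
    ContDiff ℂ 1 fun x : Matrix (Fin n) (Fin n) ℂ => osc d x s := by
  refine contDiff_det.comp (contDiff_matrix fun i k => ?_)
  simp only [of_apply]
  split_ifs
  · exact contDiff_entry i k
  · exact contDiff_const

theorem hasFDerivAt_osc (d : ℕ) (s : ℂ) (x : Matrix (Fin n) (Fin n) ℂ) :
    HasFDerivAt (fun y => osc d y s) (fderiv ℂ (fun y => osc d y s) x) x :=
  ((contDiff_osc d s).differentiable one_ne_zero x).hasFDerivAt

theorem hasDerivAt_line {E F : Type*} [NormedAddCommGroup E] [NormedSpace ℂ E]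
    [NormedAddCommGroup F] [NormedSpace ℂ F] {f : E → F} {x : E} {f' : E →L[ℂ] F}
    (hf : HasFDerivAt f f' x) (v : E) : HasDerivAt (fun t : ℂ => f (x + t • v)) (f' v) 0 :=
  (hf.hasLineDerivAt v)

/-- All osculating conditions of a list hold. -/
def Solves (cs : List (ℕ × ℝ)) (x : Matrix (Fin n) (Fin n) ℂ) : Prop :=
  ∀ c ∈ cs, osc c.1 x (c.2 : ℂ) = 0

theorem solves_cons {d : ℕ} {s : ℝ} {cs : List (ℕ × ℝ)} {x : Matrix (Fin n) (Fin n) ℂ} :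
    Solves ((d, s) :: cs) x ↔ osc d x s = 0 ∧ Solves cs x :=
  List.forall_mem_cons

theorem solves_mul {cs : List (ℕ × ℝ)} {x b : Matrix (Fin n) (Fin n) ℂ} (hb : IsBorel b) :
    Solves cs (x * b) ↔ Solves cs x :=
  forall₂_congr fun _ _ => osc_mul_eq_zero_iff hb

theorem solves_conj {cs : List (ℕ × ℝ)} {x : Matrix (Fin n) (Fin n) ℂ} (h : Solves cs x) :
    Solves cs (x.map (starRingEnd ℂ)) := fun c hc => by
  rw [osc_conj, h c hc, map_zero]

/-- The common kernel of the differentials of the osculating conditions. -/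
noncomputable def oscKer (cs : List (ℕ × ℝ)) (x : Matrix (Fin n) (Fin n) ℂ) :
    Submodule ℂ (Matrix (Fin n) (Fin n) ℂ) where
  carrier := {v | ∀ c ∈ cs, fderiv ℂ (fun y => osc c.1 y (c.2 : ℂ)) x v = 0}
  zero_mem' := fun c _ => map_zero _
  add_mem' := fun h h' c hc => by rw [map_add, h c hc, h' c hc, add_zero]
  smul_mem' := fun a _ h c hc => by rw [map_smul, h c hc, smul_zero]

theorem mul_mem_oscKer_of_solves {cs : List (ℕ × ℝ)} {x Y : Matrix (Fin n) (Fin n) ℂ}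
    (hx : Solves cs x) (hY : Y.IsUpperTriangular) : x * Y ∈ oscKer cs x := by
  intro c hc
  refine (hasDerivAt_line (hasFDerivAt_osc c.1 c.2 x) (x * Y)).unique ?_
  have h : (fun t : ℂ => osc c.1 (x + t • (x * Y)) (c.2 : ℂ)) = fun _ => 0 := by
    funext t
    have hup : (1 + t • Y).IsUpperTriangular := fun i j hij => by
      replace hij : j < i := hij
      rw [Matrix.add_apply, Matrix.smul_apply, hY hij, one_apply_ne hij.ne', smul_zero, add_zero]
    rw [← mul_smul_comm, ← mul_one_add, osc_mul hup, hx c hc, mul_zero]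
  rw [h]
  exact hasDerivAt_const 0 0

theorem mul_mem_oscKer_mul {cs : List (ℕ × ℝ)} {x v b : Matrix (Fin n) (Fin n) ℂ}
    (hb : b.IsUpperTriangular) (hv : v ∈ oscKer cs x) : v * b ∈ oscKer cs (x * b) := by
  intro c hc
  refine (hasDerivAt_line (hasFDerivAt_osc c.1 c.2 (x * b)) (v * b)).unique ?_
  have h : (fun t : ℂ => osc c.1 (x * b + t • (v * b)) (c.2 : ℂ))
      = fun t => oscChar c.1 b * osc c.1 (x + t • v) (c.2 : ℂ) := by
    funext t
    rw [← smul_mul_assoc, ← add_mul, osc_mul hb]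
  rw [h]
  exact ((hasDerivAt_line (hasFDerivAt_osc c.1 c.2 x) v).const_mul (oscChar c.1 b)).congr_deriv
    ((congrArg (oscChar c.1 b * ·) (hv c hc)).trans (mul_zero _))

theorem mem_oscKer_of_mul_mem {cs : List (ℕ × ℝ)} {x v b : Matrix (Fin n) (Fin n) ℂ}
    (hb : IsBorel b) (hv : v * b ∈ oscKer cs (x * b)) : v ∈ oscKer cs x := by
  have h := mul_mem_oscKer_mul hb.inv.1 hv
  rwa [mul_assoc, mul_assoc, mul_nonsing_inv _ hb.2, mul_one, mul_one] at h

theorem transvection_eq (a b : Fin n) (t : ℂ) :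
    transvection b a t = 1 + t • single b a (1 : ℂ) := by
  rw [transvection, smul_single, smul_eq_mul, mul_one]

/-- Nondegeneracy at a point of the big cell, from the corresponding statement along the
parametrization `(x, t) ↦ x * transvection b a t`. -/
theorem cellDir_inf_oscKer_eq_bot {u w : Equiv.Perm (Fin n)} {a b : Fin n} (hab : a ≠ b)
    {x c : Matrix (Fin n) (Fin n) ℂ} {t : ℂ} (hx : IsCell u x) (ht : t ≠ 0) (hc : IsBorel c)
    (hw : IsCell w (x * transvection b a t * c)) (hlen : invCount n w = invCount n u + 1)
    {cs : List (ℕ × ℝ)} (hcs : Solves cs (x * transvection b a t))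
    (hinj : ∀ Z ∈ cellDir u, ∀ τ : ℂ,
      Z * transvection b a t + τ • (x * single b a 1) ∈ oscKer cs (x * transvection b a t) →
        Z = 0 ∧ τ = 0) :
    cellDir w ⊓ oscKer cs (x * transvection b a t * c) = ⊥ := by
  set y := x * transvection b a t with hy
  let Λ : cellDir u × ℂ →ₗ[ℂ] Matrix (Fin n) (Fin n) ℂ :=
    { toFun := fun p => (p.1.1 * transvection b a t + p.2 • (x * single b a 1)) * c
      map_add' := fun p q => by
        simp only [Prod.fst_add, Prod.snd_add, Submodule.coe_add, add_mul, add_smul]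
        abel
      map_smul' := fun r p => by
        simp only [Prod.smul_fst, Prod.smul_snd, SetLike.val_smul, add_mul, smul_mul_assoc,
          smul_assoc, smul_add, RingHom.id_apply] }
  have hΛ : ∀ p, Λ p ∈ oscKer cs (y * c) → p = 0 := by
    intro p hp
    obtain ⟨h1, h2⟩ := hinj p.1.1 p.1.2 p.2 (mem_oscKer_of_mul_mem hc hp)
    exact Prod.ext (Subtype.ext h1) h2
  have hker : LinearMap.ker Λ = ⊥ := by
    rw [LinearMap.ker_eq_bot']
    intro p hp
    exact hΛ p (by rw [hp]; exact Submodule.zero_mem _)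
  have hleft : ∀ X : Matrix (Fin n) (Fin n) ℂ, X.IsUpperTriangular →
      X * (y * c) ∈ cellDir w ⊔ oscKer cs (y * c) := by
    intro X hX
    obtain ⟨Y, hY, h⟩ := hw.exists_sub_mem_cellDir (IsBelow.mul_left hX hw.2)
    rw [← sub_add_cancel (X * (y * c)) (y * c * Y)]
    exact Submodule.add_mem_sup h (mul_mem_oscKer_of_solves ((solves_mul hc).mpr hcs) hY)
  refine inf_eq_bot_of_le_sup (S := LinearMap.range Λ) ?_ ?_ ?_
  · rw [eq_bot_iff]
    rintro _ ⟨⟨p, rfl⟩, hp⟩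
    rw [hΛ p hp, map_zero]
    exact Submodule.zero_mem _
  · rintro _ ⟨⟨Z, τ⟩, rfl⟩
    have h1 : Z.1 * transvection b a t * c ∈ cellDir w ⊔ oscKer cs (y * c) := by
      obtain ⟨X, hX, h⟩ := hx.exists_mul_eq Z.2.2
      have h' : Z.1 * transvection b a t * c = X * (y * c) := by
        rw [← h, mul_assoc X, ← hy, mul_assoc]
      rw [h']
      exact hleft X hX
    have h2 : x * single b a 1 * c ∈ cellDir w ⊔ oscKer cs (y * c) := by
      obtain ⟨X, hX, h⟩ := hx.exists_mul_eq (Z := x * single a a 1) (by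
        intro i k hi
        rw [mul_apply, Finset.sum_eq_zero]
        intro m _
        by_cases hm : m = k
        · subst hm
          rw [hx.2 i m hi, zero_mul]
        · rw [single_apply_of_ne, mul_zero]
          rintro ⟨rfl, rfl⟩
          exact hm rfl)
      have hXy : X * y = x * single a a 1 := by
        rw [hy, ← mul_assoc, h, transvection_eq, mul_add, mul_one, mul_smul_comm, mul_assoc,
          single_mul_single_of_ne _ _ _ _ hab, mul_zero, smul_zero, add_zero]
      have hya : y * single a a 1 = x * single a a 1 + t • (x * single b a 1) := by
        rw [hy, transvection_eq, mul_add, mul_one, add_mul, mul_smul_comm, smul_mul_assoc,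
          mul_assoc x, single_mul_single_same, mul_one]
      have hup : (c⁻¹ * single a a (1 : ℂ) * c).IsUpperTriangular := by
        refine (hc.inv.1.mul fun i j hij => ?_).mul hc.1
        replace hij : j < i := hij
        rw [single_apply_of_ne]
        rintro ⟨rfl, rfl⟩
        exact lt_irrefl _ hij
      have h3 : t • (x * single b a 1 * c)
          = y * c * (c⁻¹ * single a a (1 : ℂ) * c) - X * (y * c) := by
        rw [← mul_assoc X, hXy, ← mul_assoc (y * c), ← mul_assoc (y * c), mul_assoc y,
          mul_nonsing_inv _ hc.2, mul_one, hya, add_mul, smul_mul_assoc, add_sub_cancel_left]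
      rw [← Submodule.smul_mem_iff _ ht, h3]
      exact Submodule.sub_mem _ (Submodule.mem_sup_right
        (mul_mem_oscKer_of_solves ((solves_mul hc).mpr hcs) hup)) (hleft X hX)
    have h3 : Λ (Z, τ) = Z.1 * transvection b a t * c + τ • (x * single b a 1 * c) := by
      change (Z.1 * transvection b a t + τ • (x * single b a 1)) * c = _
      rw [add_mul, smul_mul_assoc]
    rw [h3]
    exact Submodule.add_mem _ h1 (Submodule.smul_mem _ _ h2)
  · rw [finrank_cellDir, hlen, LinearMap.finrank_range_of_inj (LinearMap.ker_eq_bot.mp hker),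
      finrank_prod, finrank_cellDir, finrank_self]

/-! ### Complex conjugation -/

theorem IsBorel.conj {b : Matrix (Fin n) (Fin n) ℂ} (hb : IsBorel b) :
    IsBorel (b.map (starRingEnd ℂ)) := by
  refine isBorel_of_diag_ne_zero (fun i j h => ?_) fun k => ?_
  · rw [map_apply, hb.1 h, map_zero]
  · rw [map_apply]
    exact (map_ne_zero _).mpr (hb.diag_ne_zero k)

theorem IsCell.conj {u : Equiv.Perm (Fin n)} {x : Matrix (Fin n) (Fin n) ℂ} (hx : IsCell u x) :
    IsCell u (x.map (starRingEnd ℂ)) := by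
  refine ⟨⟨fun k => ?_, fun k l h => ?_⟩, fun i k h => ?_⟩
  · rw [map_apply, hx.1.1, map_one]
  · rw [map_apply, hx.1.2 k l h, map_zero]
  · rw [map_apply, hx.2 i k h, map_zero]

theorem mul_transvection_conj (x : Matrix (Fin n) (Fin n) ℂ) (a b : Fin n) (t : ℂ) :
    (x * transvection b a t).map (starRingEnd ℂ)
      = x.map (starRingEnd ℂ) * transvection b a (starRingEnd ℂ t) := by
  ext i k
  simp only [map_apply, mul_transvection_apply, map_add]
  split_ifs <;> simp

/-! ### The neighbourhood of a codimension one cell -/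

theorem osc_congr {d : ℕ} {x y : Matrix (Fin n) (Fin n) ℂ} {s : ℂ}
    (h : ∀ i k : Fin n, (k : ℕ) < d → x i k = y i k) : osc d x s = osc d y s := by
  rw [osc, osc]
  congr 1
  ext i k
  simp only [of_apply]
  split_ifs with hk
  · exact h i k hk
  · rfl

/-- The rescaling of `x * transvection b a t` adapted to the cell of `u * swap a b`. -/
def scaleNbr (u : Equiv.Perm (Fin n)) (a b : Fin n) (s t : ℂ) (x : Matrix (Fin n) (Fin n) ℂ) :
    Matrix (Fin n) (Fin n) ℂ :=
  of fun i k => if k = a then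
      s ^ ((u b : ℕ) - (u a : ℕ)) * scaleCell u s x i a + t * scaleCell u s x i b
    else scaleCell u s x i k

theorem IsBelow.pow_mul_scaleNbr {u : Equiv.Perm (Fin n)} {a b : Fin n} (hu : u a < u b)
    {x : Matrix (Fin n) (Fin n) ℂ} (hx : IsBelow u x) (s t : ℂ) (i k : Fin n) :
    s ^ (i : ℕ) * scaleNbr u a b s t x i k
      = s ^ (if k = a then (u b : ℕ) else (u k : ℕ)) * (x * transvection b a t) i k := by
  rw [mul_transvection_apply, scaleNbr, of_apply]
  split_ifs with h
  · subst h
    have h1 := hx.pow_mul_scaleCell s i k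
    have h2 := hx.pow_mul_scaleCell s i b
    have h3 : s ^ (u b : ℕ) = s ^ ((u b : ℕ) - (u k : ℕ)) * s ^ (u k : ℕ) := by
      rw [← pow_add, Nat.sub_add_cancel (Fin.lt_def.mp hu).le]
    linear_combination s ^ ((u b : ℕ) - (u k : ℕ)) * h1 + t * h2 - x i k * h3
  · rw [add_zero]
    exact hx.pow_mul_scaleCell s i k

theorem exists_osc_scaleNbr_eq {u : Equiv.Perm (Fin n)} {a b : Fin n} (hu : u a < u b)
    {s : ℂ} (hs : s ≠ 0) (d : ℕ) :
    ∃ κ : ℂ, ∀ x t, IsBelow u x →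
      osc d (scaleNbr u a b s t x) 1 = κ * osc d (x * transvection b a t) s := by
  have h1 : (∏ i : Fin n, s ^ (i : ℕ)) ≠ 0 :=
    Finset.prod_ne_zero_iff.mpr fun _ _ => pow_ne_zero _ hs
  refine ⟨(∏ i : Fin n, s ^ (i : ℕ))⁻¹ * ∏ k : Fin n, if (k : ℕ) < d then
    s ^ (if k = a then (u b : ℕ) else (u k : ℕ)) else 1, fun x t hx => ?_⟩
  rw [mul_assoc, ← osc_one_of_forall fun i k _ => hx.pow_mul_scaleNbr hu s t i k,
    inv_mul_cancel_left₀ h1]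

theorem exists_osc_scaleNbr_zero {u : Equiv.Perm (Fin n)} {a b : Fin n} (hu : u a < u b)
    {d : ℕ} (had : (a : ℕ) < d) (hdb : d ≤ b) :
    ∃ H : ℂ, H ≠ 0 ∧ ∀ x t, IsChart u x → osc d (scaleNbr u a b 0 t x) 1 = H * t := by
  let P : Matrix (Fin n) (Fin n) ℂ := of fun i k => if i = (u * Equiv.swap a b) k then 1 else 0
  refine ⟨osc d P 1, osc_one_ne_zero (u * Equiv.swap a b) fun i k _ => rfl, fun x t hx => ?_⟩
  have hD : (diagonal fun k => if k = a then t else 1 : Matrix (Fin n) (Fin n) ℂ).IsUpperTriangular :=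
    blockTriangular_diagonal _
  have hchar : oscChar d (diagonal fun k => if k = a then t else 1) = t := by
    rw [oscChar, Finset.prod_eq_single a]
    · rw [if_pos had, diagonal_apply_eq, if_pos rfl]
    · intro k _ hk
      rw [diagonal_apply_eq, if_neg hk, ite_self]
    · exact fun h => absurd (Finset.mem_univ _) h
  rw [mul_comm]
  nth_rewrite 2 [← hchar]
  rw [← osc_mul hD]
  refine osc_congr fun i k hk => ?_
  have hkb : k ≠ b := by
    rintro rfl
    omega
  rw [mul_diagonal, scaleNbr, of_apply]
  have hP : ∀ l, (u * Equiv.swap a b) k = l → P i k = if i = l then 1 else 0 := by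
    rintro _ rfl
    rfl
  simp only [hx.scaleCell_zero]
  by_cases hka : k = a
  · subst hka
    rw [hP (u b) (congrArg u (Equiv.swap_apply_left k b)), if_pos rfl, if_pos rfl,
      zero_pow (Nat.sub_pos_of_lt (Fin.lt_def.mp hu)).ne', zero_mul, zero_add, mul_comm]
  · rw [hP (u k) (congrArg u (Equiv.swap_apply_of_ne_of_ne hka hkb)), if_neg hka, if_neg hka,
      mul_one]

theorem contDiff_scaleNbr (u : Equiv.Perm (Fin n)) (a b : Fin n) :
    ContDiff ℂ 1 fun p : Matrix (Fin n) (Fin n) ℂ × ℂ × ℂ => scaleNbr u a b p.2.2 p.2.1 p.1 := by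
  have h1 : ∀ i k, ContDiff ℂ 1 fun p : Matrix (Fin n) (Fin n) ℂ × ℂ × ℂ =>
      scaleCell u p.2.2 p.1 i k := fun i k => by
    simp only [scaleCell, of_apply]
    split_ifs
    · exact (contDiff_snd.comp contDiff_snd).pow _ |>.mul ((contDiff_entry i k).comp contDiff_fst)
    · exact contDiff_const
  refine contDiff_matrix fun i k => ?_
  simp only [scaleNbr, of_apply]
  split_ifs
  · exact (((contDiff_snd.comp contDiff_snd).pow _).mul (h1 i a)).add
      ((contDiff_fst.comp contDiff_snd).mul (h1 i b))
  · exact h1 i k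

theorem contDiff_mul_transvection (a b : Fin n) :
    ContDiff ℂ 1 fun p : Matrix (Fin n) (Fin n) ℂ × ℂ => p.1 * transvection b a p.2 := by
  refine contDiff_matrix fun i k => ?_
  simp only [mul_transvection_apply]
  refine ((contDiff_entry i k).comp contDiff_fst).add ?_
  split_ifs
  · exact contDiff_snd.mul ((contDiff_entry i b).comp contDiff_fst)
  · exact contDiff_const

theorem hasDerivAt_mul_transvection (a b : Fin n) (x Z : Matrix (Fin n) (Fin n) ℂ) (t τ : ℂ) :
    HasDerivAt (fun ε : ℂ => (x + ε • Z) * transvection b a (t + ε • τ))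
      (Z * transvection b a t + τ • (x * single b a 1)) 0 := by
  have hpoly : ∀ ε : ℂ, (x + ε • Z) * transvection b a (t + ε • τ) = x * transvection b a t +
      ε • (Z * transvection b a t + τ • (x * single b a 1)) +
      ε ^ 2 • (τ • (Z * single b a 1)) := by
    intro ε
    simp only [transvection_eq, mul_add, add_mul, mul_one, smul_mul_assoc, mul_smul_comm, smul_add,
      smul_smul, add_smul, smul_eq_mul]
    module
  have h1 := (hasDerivAt_id (0 : ℂ)).smul_const (Z * transvection b a t + τ • (x * single b a 1))
  have h2 := ((hasDerivAt_id (0 : ℂ)).pow 2).smul_const (τ • (Z * single b a (1 : ℂ)))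
  have h3 := ((hasDerivAt_const (0 : ℂ) (x * transvection b a t)).add h1).add h2
  refine (h3.congr_of_eventuallyEq (Eventually.of_forall hpoly)).congr_deriv ?_
  simp

theorem hasDerivAt_osc_mul_transvection (d : ℕ) (s : ℂ) (a b : Fin n)
    (x Z : Matrix (Fin n) (Fin n) ℂ) (t τ : ℂ) :
    HasDerivAt (fun ε : ℂ => osc d ((x + ε • Z) * transvection b a (t + ε • τ)) s)
      (fderiv ℂ (fun y => osc d y s) (x * transvection b a t)
        (Z * transvection b a t + τ • (x * single b a 1))) 0 := by
  refine (hasFDerivAt_osc d s _).comp_hasDerivAt_of_eq 0 (hasDerivAt_mul_transvection a b x Z t τ) ?_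
  simp

/-- The equations of the old conditions together with the rescaled new condition, in the
coordinates `x₀ + Z`, `t` and `s`. -/
noncomputable def nbrMap (u : Equiv.Perm (Fin n)) (a b : Fin n) (d : ℕ) (cs : List (ℕ × ℝ))
    (x₀ : Matrix (Fin n) (Fin n) ℂ) (p : cellDir u × ℂ × ℂ) :
    (Fin cs.length → ℂ) × ℂ × ℂ :=
  (fun k => osc (cs.get k).1 ((x₀ + p.1.1) * transvection b a p.2.1) ((cs.get k).2 : ℂ),
    osc d (scaleNbr u a b p.2.2 p.2.1 (x₀ + p.1.1)) 1, p.2.2)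

theorem contDiff_nbrMap (u : Equiv.Perm (Fin n)) (a b : Fin n) (d : ℕ) (cs : List (ℕ × ℝ))
    (x₀ : Matrix (Fin n) (Fin n) ℂ) : ContDiff ℂ 1 (nbrMap u a b d cs x₀) := by
  have h1 : ContDiff ℂ 1 fun p : cellDir u × ℂ × ℂ => x₀ + (p.1 : Matrix (Fin n) (Fin n) ℂ) :=
    contDiff_const.add ((cellDir u).subtypeL.contDiff.comp contDiff_fst)
  have h2 : ContDiff ℂ 1 fun p : cellDir u × ℂ × ℂ => p.2.1 := contDiff_fst.comp contDiff_snd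
  refine ContDiff.prodMk (contDiff_pi.mpr fun k => ?_) (ContDiff.prodMk ?_ ?_)
  · exact (contDiff_osc _ _).comp ((contDiff_mul_transvection a b).comp (h1.prodMk h2))
  · exact (contDiff_osc _ _).comp ((contDiff_scaleNbr u a b).comp (h1.prodMk contDiff_snd))
  · exact contDiff_snd.comp contDiff_snd

theorem hasDerivAt_nbrMap (u : Equiv.Perm (Fin n)) (a b : Fin n) (d : ℕ) (cs : List (ℕ × ℝ))
    (x₀ : Matrix (Fin n) (Fin n) ℂ) (p v : cellDir u × ℂ × ℂ) :
    HasDerivAt (fun ε : ℂ => nbrMap u a b d cs x₀ (p + ε • v))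
      (fderiv ℂ (nbrMap u a b d cs x₀) p v) 0 :=
  hasDerivAt_line
    ((contDiff_nbrMap u a b d cs x₀).differentiable one_ne_zero p).hasFDerivAt v

theorem injective_fderiv_nbrMap {u : Equiv.Perm (Fin n)} {a b : Fin n} (hu : u a < u b)
    {d : ℕ} (had : (a : ℕ) < d) (hdb : d ≤ b) {cs : List (ℕ × ℝ)}
    {x₀ : Matrix (Fin n) (Fin n) ℂ} (hx₀ : IsCell u x₀) (hker : cellDir u ⊓ oscKer cs x₀ = ⊥) :
    Function.Injective (fderiv ℂ (nbrMap u a b d cs x₀) 0) := by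
  rw [injective_iff_map_eq_zero]
  rintro ⟨Z, τ, σ⟩ hv
  have hder := hasDerivAt_nbrMap u a b d cs x₀ 0 (Z, τ, σ)
  rw [hv] at hder
  have hσ : σ = 0 := by
    have h1 := hder.snd.snd
    refine HasDerivAt.unique ?_ h1
    simpa [nbrMap] using (hasDerivAt_id (0 : ℂ)).mul_const σ
  subst hσ
  have hτ : τ = 0 := by
    obtain ⟨H, hH, h⟩ := exists_osc_scaleNbr_zero hu had hdb
    have h1 := hder.snd.fst
    have h2 : HasDerivAt (fun ε : ℂ => H * (ε * τ)) (H * (1 * τ)) 0 :=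
      ((hasDerivAt_id (0 : ℂ)).mul_const τ).const_mul H
    have h3 : (fun ε : ℂ => (nbrMap u a b d cs x₀ (0 + ε • (Z, τ, (0 : ℂ)))).2.1)
        = fun ε => H * (ε * τ) := by
      funext ε
      have := h (x₀ + (ε • Z : cellDir u)) (ε * τ) (hx₀.add (ε • Z).2).1
      simpa [nbrMap] using this
    rw [h3] at h1
    have := h2.unique h1
    simpa [hH] using this
  subst hτ
  have hZ : (Z : Matrix (Fin n) (Fin n) ℂ) ∈ cellDir u ⊓ oscKer cs x₀ := by
    refine ⟨Z.2, fun c hc => ?_⟩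
    obtain ⟨k, rfl⟩ := List.get_of_mem hc
    have h1 := hasDerivAt_pi.mp hder.fst k
    have h2 := hasDerivAt_osc_mul_transvection (cs.get k).1 ((cs.get k).2 : ℂ) a b x₀ Z 0 0
    have h3 := h2.unique (by simpa [nbrMap] using h1)
    simpa using h3
  rw [hker, Submodule.mem_bot] at hZ
  rw [show Z = 0 from Subtype.ext hZ]
  rfl

theorem fderiv_nbrMap_eq_zero {u : Equiv.Perm (Fin n)} {a b : Fin n} (hu : u a < u b)
    {d : ℕ} {cs : List (ℕ × ℝ)} {x₀ : Matrix (Fin n) (Fin n) ℂ} (hx₀ : IsCell u x₀)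
    {s : ℝ} (hs : s ≠ 0) {Y Z : cellDir u} {t τ : ℂ}
    (h : (Z : Matrix (Fin n) (Fin n) ℂ) * transvection b a t + τ • ((x₀ + Y.1) * single b a 1)
      ∈ oscKer ((d, s) :: cs) ((x₀ + Y.1) * transvection b a t)) :
    fderiv ℂ (nbrMap u a b d cs x₀) (Y, t, (s : ℂ)) (Z, τ, 0) = 0 := by
  refine (hasDerivAt_nbrMap u a b d cs x₀ (Y, t, (s : ℂ)) (Z, τ, 0)).unique ?_
  obtain ⟨κ, hκ⟩ := exists_osc_scaleNbr_eq hu (Complex.ofReal_ne_zero.mpr hs) d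
  have hosc : ∀ c ∈ (d, s) :: cs, HasDerivAt (fun ε : ℂ =>
      osc c.1 ((x₀ + Y.1 + ε • (Z : Matrix (Fin n) (Fin n) ℂ)) * transvection b a (t + ε • τ))
        (c.2 : ℂ)) 0 0 := fun c hc =>
    (hasDerivAt_osc_mul_transvection c.1 (c.2 : ℂ) a b (x₀ + Y.1) Z t τ).congr_deriv (h c hc)
  refine HasDerivAt.prodMk (hasDerivAt_pi.mpr fun k => ?_) (HasDerivAt.prodMk ?_ ?_)
  · have := hosc (cs.get k) (List.mem_cons_of_mem _ (List.get_mem cs k))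
    simpa [add_assoc] using this
  · have h1 := (hosc (d, s) List.mem_cons_self).const_mul κ
    rw [mul_zero] at h1
    refine h1.congr_of_eventuallyEq (Eventually.of_forall fun ε => ?_)
    have := hκ (x₀ + (Y + ε • Z : cellDir u)) (t + ε • τ) (hx₀.add (Y + ε • Z).2).2
    simpa [add_assoc] using this
  · simpa using hasDerivAt_const (0 : ℂ) (s : ℂ)

/-! ### Solutions near a point of a bigger cell -/

/-- For small `s > 0` the solutions in the cell of `w` of the conditions `(d, s) :: cs` whose flags
meet `N` are finite in number, real and transverse. -/
def LocallyGood (w : Equiv.Perm (Fin n)) (cs : List (ℕ × ℝ)) (d : ℕ)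
    (N : Set (Matrix (Fin n) (Fin n) ℂ)) : Prop :=
  ∀ᶠ s : ℝ in 𝓝[>] 0,
    {x | IsCell w x ∧ Solves ((d, s) :: cs) x ∧ ∃ c, IsBorel c ∧ x * c ∈ N}.Finite ∧
    ∀ x, IsCell w x → Solves ((d, s) :: cs) x → ∀ c, IsBorel c → x * c ∈ N →
      x.map (starRingEnd ℂ) = x ∧ cellDir w ⊓ oscKer ((d, s) :: cs) x = ⊥

theorem locallyGood_of_forall_not {w : Equiv.Perm (Fin n)} {cs : List (ℕ × ℝ)} {d : ℕ}
    {N : Set (Matrix (Fin n) (Fin n) ℂ)}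
    (h : ∀ᶠ s : ℝ in 𝓝[>] 0, ∀ x, IsCell w x → Solves ((d, s) :: cs) x → ∀ c, IsBorel c →
      x * c ∉ N) : LocallyGood w cs d N := by
  filter_upwards [h] with s hs
  refine ⟨?_, fun x hx hsol c hc hN => absurd hN (hs x hx hsol c hc)⟩
  convert Set.finite_empty
  refine Set.eq_empty_of_forall_notMem ?_
  rintro x ⟨hx, hsol, c, hc, hN⟩
  exact hs x hx hsol c hc hN

theorem eq_mul_inv_of_mul_eq {x y b : Matrix (Fin n) (Fin n) ℂ} (hb : IsBorel b)
    (h : x * b = y) : x = y * b⁻¹ := by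
  rw [← h, mul_assoc, mul_nonsing_inv _ hb.2, mul_one]

theorem exists_nbr_coords {u : Equiv.Perm (Fin n)} {a b : Fin n} (hab : a < b) (hu : u a < u b)
    (hcov : ∀ c, a < c → c < b → u a < u c → ¬u c < u b) {x₀ y : Matrix (Fin n) (Fin n) ℂ}
    (hx₀ : IsCell u x₀) (hy : IsChart u y) (hw : SchubCond (u * Equiv.swap a b) y) :
    ∃ Z : cellDir u, Z.1 = y * transvection b a (-y (u b) a) - x₀ ∧ IsCell u (x₀ + Z.1) ∧
      y = (x₀ + Z.1) * transvection b a (y (u b) a) := by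
  have h := hy.isCell_mul_transvection hab hu hcov hw
  refine ⟨⟨_, h.sub_mem hx₀⟩, rfl, ?_, ?_⟩
  · simpa using h
  · have h1 : transvection b a (-y (u b) a) * transvection b a (y (u b) a) = 1 := by
      rw [transvection_mul_transvection_same _ _ hab.ne', neg_add_cancel, transvection_zero]
    simp only [add_sub_cancel]
    rw [mul_assoc, h1, mul_one]

theorem nbrMap_eq_of_solves {u : Equiv.Perm (Fin n)} {a b : Fin n} (hu : u a < u b)
    {d : ℕ} {cs : List (ℕ × ℝ)} {x₀ : Matrix (Fin n) (Fin n) ℂ} {s : ℝ} (hs : s ≠ 0)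
    {Z : cellDir u} {t : ℂ} (hx : IsCell u (x₀ + Z.1))
    (h : Solves ((d, s) :: cs) ((x₀ + Z.1) * transvection b a t)) :
    nbrMap u a b d cs x₀ (Z, t, (s : ℂ)) = (0, 0, (s : ℂ)) := by
  obtain ⟨κ, hκ⟩ := exists_osc_scaleNbr_eq hu (Complex.ofReal_ne_zero.mpr hs) d
  obtain ⟨h1, h2⟩ := solves_cons.mp h
  refine Prod.ext ?_ (Prod.ext ?_ rfl)
  · funext k
    exact h2 _ (List.get_mem cs k)
  · change osc d (scaleNbr u a b s t (x₀ + Z.1)) 1 = 0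
    rw [hκ _ _ hx.2, h1, mul_zero]

theorem map_conj_eq_of_mul {w : Equiv.Perm (Fin n)} {y b : Matrix (Fin n) (Fin n) ℂ}
    (hb : IsBorel b) (hy : y.map (starRingEnd ℂ) = y) (hx : IsCell w (y * b)) :
    (y * b).map (starRingEnd ℂ) = y * b := by
  have h := hx.conj.1
  rw [Matrix.map_mul, hy] at h ⊢
  rw [IsChart.mul_unique hb.conj hb h hx.1]

theorem norm_mem_cellDir_lt_of_ball {u : Equiv.Perm (Fin n)}
    {O : Set (cellDir u × ℂ × ℂ)} (hO : O ∈ 𝓝 0) :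
    ∃ ε > 0, ∀ (Z : cellDir u) (t s : ℂ), ‖Z.1‖ < ε → ‖t‖ < ε → ‖s‖ < ε → (Z, t, s) ∈ O := by
  obtain ⟨ε, hε, h⟩ := Metric.mem_nhds_iff.mp hO
  refine ⟨ε, hε, fun Z t s hZ ht hs => h ?_⟩
  rw [mem_ball_zero_iff]
  simp only [Prod.norm_def, max_lt_iff]
  exact ⟨hZ, ht, hs⟩

theorem nbr_mem_nhds {u : Equiv.Perm (Fin n)} {a b : Fin n} (hu : u a < u b)
    {x₀ : Matrix (Fin n) (Fin n) ℂ} (hx₀ : IsCell u x₀) {ε : ℝ} (hε : 0 < ε) :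
    {y : Matrix (Fin n) (Fin n) ℂ | ‖y (u b) a‖ < ε ∧
      ‖y * transvection b a (-y (u b) a) - x₀‖ < ε} ∈ 𝓝 x₀ := by
  have h0 : x₀ (u b) a = 0 := hx₀.2 _ _ hu
  have h1 : Continuous fun y : Matrix (Fin n) (Fin n) ℂ => y (u b) a := continuous_id.matrix_elem _ _
  have h2 : Continuous fun y : Matrix (Fin n) (Fin n) ℂ =>
      y * transvection b a (-y (u b) a) - x₀ :=
    ((contDiff_mul_transvection a b).continuous.comp
      (continuous_id.prodMk h1.neg)).sub continuous_const
  refine IsOpen.mem_nhds ((isOpen_lt h1.norm continuous_const).inter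
    (isOpen_lt h2.norm continuous_const)) ⟨?_, ?_⟩
  · simpa [h0] using hε
  · simpa [h0] using hε

theorem conj_mem_cellDir {u : Equiv.Perm (Fin n)} {Z : Matrix (Fin n) (Fin n) ℂ}
    (hZ : Z ∈ cellDir u) : Z.map (starRingEnd ℂ) ∈ cellDir u := by
  refine ⟨fun k l h => ?_, fun i k h => ?_⟩
  · rw [map_apply, hZ.1 k l h, map_zero]
  · rw [map_apply, hZ.2 i k h, map_zero]

theorem exists_locallyGood_of_cover {u : Equiv.Perm (Fin n)} {a b : Fin n} (hab : a < b)
    (hu : u a < u b) (hcov : ∀ c, a < c → c < b → u a < u c → ¬u c < u b)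
    (hlen : invCount n (u * Equiv.swap a b) = invCount n u + 1) {d : ℕ} (had : (a : ℕ) < d)
    (hdb : d ≤ b) {cs : List (ℕ × ℝ)} {x₀ c₀ : Matrix (Fin n) (Fin n) ℂ} (hx₀ : IsCell u x₀)
    (hreal : x₀.map (starRingEnd ℂ) = x₀) (hker : cellDir u ⊓ oscKer cs x₀ = ⊥)
    (hc₀ : IsBorel c₀) :
    ∃ N ∈ 𝓝 (x₀ * c₀), LocallyGood (u * Equiv.swap a b) cs d N := by
  set w := u * Equiv.swap a b with hw
  obtain ⟨O, hO, hinj, hder⟩ := exists_injOn_of_injective_fderiv (contDiff_nbrMap u a b d cs x₀)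
    (injective_fderiv_nbrMap hu had hdb hx₀ hker)
  obtain ⟨ε, hε, hball⟩ := norm_mem_cellDir_lt_of_ball hO
  refine ⟨_, hx₀.1.eventually_exists_mul hc₀ (nbr_mem_nhds hu hx₀ hε), ?_⟩
  filter_upwards [Ioo_mem_nhdsGT hε] with s hs
  have hs0 : s ≠ 0 := hs.1.ne'
  have hsε : ‖(s : ℂ)‖ < ε := by
    rw [Complex.norm_real, Real.norm_of_nonneg hs.1.le]
    exact hs.2
  have key : ∀ x, IsCell w x → Solves ((d, s) :: cs) x → ∀ c, IsBorel c →
      x * c ∈ {y | ∃ β, IsBorel β ∧ y * β ∈ {y : Matrix (Fin n) (Fin n) ℂ | ‖y (u b) a‖ < ε ∧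
        ‖y * transvection b a (-y (u b) a) - x₀‖ < ε} ∧ IsChart u (y * β)} →
      ∃ β, IsBorel β ∧ ∃ (Z : cellDir u) (t : ℂ), ‖Z.1‖ < ε ∧ ‖t‖ < ε ∧ IsCell u (x₀ + Z.1) ∧
        x = (x₀ + Z.1) * transvection b a t * β ∧
        Solves ((d, s) :: cs) ((x₀ + Z.1) * transvection b a t) := by
    rintro x hx hsol c hc ⟨β, hβ, ⟨h1, h2⟩, hchart⟩
    rw [mul_assoc x c β] at h1 h2 hchart
    have hcβ := hc.mul hβ
    obtain ⟨Z, hZ, hcell, hy⟩ := exists_nbr_coords hab hu hcov hx₀ hchart (hx.schubCond.mul hcβ)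
    refine ⟨(c * β)⁻¹, hcβ.inv, Z, _, ?_, h1, hcell, ?_, ?_⟩
    · rw [hZ]
      exact h2
    · rw [← hy]
      exact eq_mul_inv_of_mul_eq hcβ rfl
    · rw [← hy]
      exact (solves_mul hcβ).mpr hsol
  have huniq : ∀ (Z Z' : cellDir u) (t t' : ℂ), ‖Z.1‖ < ε → ‖Z'.1‖ < ε → ‖t‖ < ε → ‖t'‖ < ε →
      IsCell u (x₀ + Z.1) → IsCell u (x₀ + Z'.1) →
      Solves ((d, s) :: cs) ((x₀ + Z.1) * transvection b a t) →
      Solves ((d, s) :: cs) ((x₀ + Z'.1) * transvection b a t') → Z = Z' ∧ t = t' := by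
    intro Z Z' t t' hZ hZ' ht ht' hc hc' hsol hsol'
    have := hinj (hball Z t s hZ ht hsε) (hball Z' t' s hZ' ht' hsε)
      ((nbrMap_eq_of_solves hu hs0 hc hsol).trans (nbrMap_eq_of_solves hu hs0 hc' hsol').symm)
    simp only [Prod.mk.injEq] at this
    exact ⟨this.1, this.2.1⟩
  refine ⟨Set.Subsingleton.finite ?_, ?_⟩
  · rintro x ⟨hx, hsol, c, hc, hN⟩ x' ⟨hx', hsol', c', hc', hN'⟩
    obtain ⟨β, hβ, Z, t, hZ, ht, hcell, rfl, hs1⟩ := key x hx hsol c hc hN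
    obtain ⟨β', hβ', Z', t', hZ', ht', hcell', rfl, hs1'⟩ := key x' hx' hsol' c' hc' hN'
    obtain ⟨rfl, rfl⟩ := huniq Z Z' t t' hZ hZ' ht ht' hcell hcell' hs1 hs1'
    rw [IsChart.mul_unique hβ hβ' hx.1 hx'.1]
  · intro x hx hsol c hc hN
    obtain ⟨β, hβ, Z, t, hZ, ht, hcell, rfl, hs1⟩ := key x hx hsol c hc hN
    constructor
    · refine map_conj_eq_of_mul hβ ?_ hx
      have h1 : x₀ + Z.1.map (starRingEnd ℂ) = (x₀ + Z.1).map (starRingEnd ℂ) := by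
        rw [Matrix.map_add _ (map_add _), hreal]
      have h2 : (x₀ + Z.1.map (starRingEnd ℂ)) * transvection b a (starRingEnd ℂ t)
          = ((x₀ + Z.1) * transvection b a t).map (starRingEnd ℂ) := by
        rw [h1, mul_transvection_conj]
      have h3 := huniq ⟨_, conj_mem_cellDir Z.2⟩ Z (starRingEnd ℂ t) t
        (by rwa [Matrix.norm_map_eq _ _ fun z => RCLike.norm_conj z]) hZ
        (by rwa [RCLike.norm_conj]) ht (by rw [h1]; exact hcell.conj) hcell
        (by rw [h2]; exact solves_conj hs1) hs1
      rw [← h2, h3.2, show Z.1.map (starRingEnd ℂ) = Z.1 from congrArg Subtype.val h3.1]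
    · have ht0 : t ≠ 0 := by
        rintro rfl
        have h1 : IsCell w ((x₀ + Z.1) * β) := by simpa using hx
        have h2 : u = u * Equiv.swap a b := hcell.perm_eq hβ h1
        exact hab.ne (Equiv.swap_eq_one_iff.mp (left_eq_mul.mp h2))
      refine cellDir_inf_oscKer_eq_bot hab.ne hcell ht0 hβ hx hlen hs1 fun V hV τ h => ?_
      have h1 := hder _ (hball Z t s hZ ht hsε)
      have h2 := fderiv_nbrMap_eq_zero hu hx₀ hs0 (Y := Z) (Z := ⟨V, hV⟩) h
      have h3 := (injective_iff_map_eq_zero _).mp h1 _ h2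
      simp only [Prod.mk_eq_zero] at h3
      exact ⟨congrArg Subtype.val h3.1, h3.2.1⟩

/-! ### Adding one condition -/

theorem LocallyGood.mono {w : Equiv.Perm (Fin n)} {cs : List (ℕ × ℝ)} {d : ℕ}
    {N N' : Set (Matrix (Fin n) (Fin n) ℂ)} (h : LocallyGood w cs d N') (hN : N ⊆ N') :
    LocallyGood w cs d N := by
  filter_upwards [h] with s hs
  refine ⟨hs.1.subset ?_, fun x hx hsol c hc hxc => hs.2 x hx hsol c hc (hN hxc)⟩
  rintro x ⟨hx, hsol, c, hc, hxc⟩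
  exact ⟨hx, hsol, c, hc, hN hxc⟩

theorem LocallyGood.union {w : Equiv.Perm (Fin n)} {cs : List (ℕ × ℝ)} {d : ℕ}
    {N N' : Set (Matrix (Fin n) (Fin n) ℂ)} (h : LocallyGood w cs d N)
    (h' : LocallyGood w cs d N') : LocallyGood w cs d (N ∪ N') := by
  filter_upwards [h, h'] with s hs hs'
  refine ⟨(hs.1.union hs'.1).subset ?_, ?_⟩
  · rintro x ⟨hx, hsol, c, hc, hxc | hxc⟩
    · exact Or.inl ⟨hx, hsol, c, hc, hxc⟩
    · exact Or.inr ⟨hx, hsol, c, hc, hxc⟩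
  · rintro x hx hsol c hc (hxc | hxc)
    · exact hs.2 x hx hsol c hc hxc
    · exact hs'.2 x hx hsol c hc hxc

/-- A list of osculating conditions cuts every cell of dimension its length in finitely many
real, transverse points, and misses all smaller cells. -/
def Good (n : ℕ) (cs : List (ℕ × ℝ)) : Prop :=
  ∀ u : Equiv.Perm (Fin n),
    (invCount n u < cs.length → ∀ x, IsCell u x → ¬Solves cs x) ∧
    (invCount n u = cs.length → {x | IsCell u x ∧ Solves cs x}.Finite ∧
      ∀ x, IsCell u x → Solves cs x →
        x.map (starRingEnd ℂ) = x ∧ cellDir u ⊓ oscKer cs x = ⊥)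

theorem good_nil (n : ℕ) : Good n [] := by
  intro u
  refine ⟨fun h => absurd h (Nat.not_lt_zero _), fun h => ?_⟩
  have hbot : cellDir u = ⊥ := Submodule.finrank_eq_zero.mp ((finrank_cellDir u).trans h)
  have huniq : ∀ x y, IsCell u x → IsCell u y → x = y := fun x y hx hy => by
    have := hx.sub_mem hy
    rwa [hbot, Submodule.mem_bot, sub_eq_zero] at this
  refine ⟨Set.Subsingleton.finite fun x hx y hy => huniq x y hx.1 hy.1, fun x hx _ => ?_⟩
  exact ⟨huniq _ _ hx.conj hx, by rw [hbot, bot_inf_eq]⟩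

theorem IsCell.eventually_osc_ne_zero_ofReal {u : Equiv.Perm (Fin n)}
    {x : Matrix (Fin n) (Fin n) ℂ} (hx : IsCell u x) (d : ℕ) :
    ∃ O ∈ 𝓝 x, ∀ᶠ s : ℝ in 𝓝[>] 0, ∀ y ∈ O, IsBelow u y → osc d y s ≠ 0 := by
  obtain ⟨p, hp, q, hq, h⟩ := eventually_prod_iff.mp
    (nhds_prod_eq (x := x) (y := (0 : ℂ)) ▸ hx.eventually_osc_ne_zero d)
  refine ⟨_, hp, ?_⟩
  have hlim : Tendsto (fun s : ℝ => (s : ℂ)) (𝓝[>] 0) (𝓝 0) :=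
    (Complex.continuous_ofReal.tendsto' 0 0 Complex.ofReal_zero).mono_left nhdsWithin_le_nhds
  filter_upwards [hlim.eventually hq, self_mem_nhdsWithin] with s hs hs0 y hy hbelow
  exact h hy hs hbelow (Complex.ofReal_ne_zero.mpr (ne_of_gt hs0))

theorem exists_locallyGood_of_retract {u w : Equiv.Perm (Fin n)} {cs : List (ℕ × ℝ)} {d : ℕ}
    {x₀ c₀ : Matrix (Fin n) (Fin n) ℂ} (hx₀ : IsCell u x₀) (hc₀ : IsBorel c₀)
    {φ : Matrix (Fin n) (Fin n) ℂ → Matrix (Fin n) (Fin n) ℂ} (hφ : Tendsto φ (𝓝 x₀) (𝓝 x₀))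
    (hcell : ∀ y, IsChart u y → SchubCond w y →
      IsCell u (φ y) ∧ ∀ s, osc d (φ y) s = osc d y s) :
    ∃ N ∈ 𝓝 (x₀ * c₀), LocallyGood w cs d N := by
  obtain ⟨O, hO, h⟩ := hx₀.eventually_osc_ne_zero_ofReal d
  refine ⟨_, hx₀.1.eventually_exists_mul hc₀ (hφ hO), locallyGood_of_forall_not ?_⟩
  filter_upwards [h] with s hs
  rintro x hx hsol c hc ⟨β, hβ, hmem, hchart⟩
  rw [mul_assoc x c β] at hmem hchart
  obtain ⟨h1, h2⟩ := hcell _ hchart (hx.schubCond.mul (hc.mul hβ))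
  refine hs _ hmem h1.2 ?_
  rw [h2, osc_mul_eq_zero_iff (hc.mul hβ)]
  exact (solves_cons.mp hsol).1

theorem exists_locallyGood {cs : List (ℕ × ℝ)} (hgood : Good n cs) (d : ℕ)
    {w : Equiv.Perm (Fin n)} (hw : invCount n w = cs.length + 1)
    {g : Matrix (Fin n) (Fin n) ℂ} (hg : IsUnit g.det) :
    ∃ N ∈ 𝓝 g, LocallyGood w cs d N := by
  obtain ⟨u, b, hb, hx⟩ := exists_isCell hg
  have hgx : g = g * b * b⁻¹ := eq_mul_inv_of_mul_eq hb rfl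
  set x := g * b with hxdef
  have hbi := hb.inv
  by_cases hle : ∀ q j, schubNum n w q j ≤ schubNum n u q j
  · by_cases hsol : Solves cs x
    · have hu1 : cs.length ≤ invCount n u := by
        by_contra! hlt
        exact (hgood u).1 hlt x hx hsol
      rw [hgx]
      by_cases huw : u = w
      · subst huw
        exact exists_locallyGood_of_retract hx hbi tendsto_id
          fun y hy hy' => ⟨hy.isCell hy', fun _ => rfl⟩
      · have hlt := invCount_lt_of_schubNum_le hle huw
        have hlen : invCount n w = invCount n u + 1 := by omega
        obtain ⟨hreal, hker⟩ := ((hgood u).2 (by omega)).2 x hx hsol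
        obtain ⟨p, q, hpq, hupq, rfl, hcov⟩ := exists_cover_of_schubNum_le hle hlen
        by_cases hd : (p : ℕ) < d ∧ d ≤ q
        · exact exists_locallyGood_of_cover hpq hupq hcov hlen hd.1 hd.2 hx hreal hker hbi
        · refine exists_locallyGood_of_retract hx hbi
            (φ := fun y => y * transvection q p (-y (u q) p)) ?_ fun y hy hy' =>
              ⟨hy.isCell_mul_transvection hpq hupq hcov hy', fun s =>
                osc_mul_transvection_of_not hpq hd _ _ _⟩
          have h1 : Continuous fun y : Matrix (Fin n) (Fin n) ℂ => y (u q) p :=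
            continuous_id.matrix_elem _ _
          refine ((contDiff_mul_transvection p q).continuous.comp
            (continuous_id.prodMk h1.neg)).tendsto' _ _ ?_
          simp [hx.2 _ _ hupq]
    · rw [Solves] at hsol
      push Not at hsol
      obtain ⟨c, hc, hne⟩ := hsol
      rw [hxdef, Ne, osc_mul_eq_zero_iff hb] at hne
      refine ⟨_, (continuous_osc c.1 (c.2 : ℂ)).continuousAt.eventually_ne hne,
        locallyGood_of_forall_not (Eventually.of_forall fun s y hy hsol e he hN => hN ?_)⟩
      exact (osc_mul_eq_zero_iff he).mpr ((solves_cons.mp hsol).2 c hc)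
  · rw [hgx]
    refine ⟨_, hx.1.eventually_exists_mul hbi univ_mem,
      locallyGood_of_forall_not (Eventually.of_forall fun s y hy _ e he hN => hle fun q j => ?_)⟩
    obtain ⟨β, hβ, -, hchart⟩ := hN
    rw [mul_assoc y e β] at hchart
    exact (hy.schubCond.mul (he.mul hβ) q j).trans (hchart.finrank_coeffSpace_le q j)

/-- Representatives of all flags by matrices with bounded entries. -/
def boundedCharts (n : ℕ) : Set (Matrix (Fin n) (Fin n) ℂ) :=
  ⋃ v : Equiv.Perm (Fin n), {x | IsChart v x ∧ ∀ i k, ‖x i k‖ ≤ 1}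

theorem isCompact_boundedCharts (n : ℕ) : IsCompact (boundedCharts n) := by
  refine isCompact_iUnion fun v => ?_
  have : ProperSpace (Matrix (Fin n) (Fin n) ℂ) := FiniteDimensional.proper ℂ _
  have hcont : ∀ i k, Continuous fun x : Matrix (Fin n) (Fin n) ℂ => x i k :=
    fun i k => continuous_id.matrix_elem _ _
  have hclosed : IsClosed {x : Matrix (Fin n) (Fin n) ℂ | IsChart v x} := by
    refine IsClosed.inter (s₁ := {x : Matrix (Fin n) (Fin n) ℂ | ∀ k, x (v k) k = 1})
      (s₂ := {x : Matrix (Fin n) (Fin n) ℂ | ∀ k l, k < l → x (v k) l = 0}) ?_ ?_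
    · simp only [Set.ofPred_forall]
      exact isClosed_iInter fun k => isClosed_eq (hcont _ _) continuous_const
    · simp only [Set.ofPred_forall]
      exact isClosed_iInter fun k => isClosed_iInter fun l => isClosed_iInter fun _ =>
        isClosed_eq (hcont _ _) continuous_const
  have hbounded : IsClosed {x : Matrix (Fin n) (Fin n) ℂ | ∀ i k, ‖x i k‖ ≤ 1} := by
    simp only [Set.ofPred_forall]
    exact isClosed_iInter fun i => isClosed_iInter fun k =>
      isClosed_le (hcont i k).norm continuous_const
  refine (isCompact_closedBall (0 : Matrix (Fin n) (Fin n) ℂ) 1).of_isClosed_subset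
    (hclosed.inter hbounded) ?_
  rintro x ⟨-, hx⟩
  rw [mem_closedBall_zero_iff, Matrix.norm_le_iff zero_le_one]
  exact hx

theorem locallyGood_boundedCharts {cs : List (ℕ × ℝ)} (hgood : Good n cs) (d : ℕ)
    {w : Equiv.Perm (Fin n)} (hw : invCount n w = cs.length + 1) :
    LocallyGood w cs d (boundedCharts n) := by
  refine (isCompact_boundedCharts n).induction_on ?_ (fun _ _ h h' => h'.mono h)
    (fun _ _ h h' => h.union h') fun x hx => ?_
  · exact locallyGood_of_forall_not (Eventually.of_forall fun _ _ _ _ _ _ => Set.notMem_empty _)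
  · obtain ⟨v, hv, -⟩ := Set.mem_iUnion.mp hx
    obtain ⟨N, hN, h⟩ := exists_locallyGood hgood d hw hv.isUnit_det
    exact ⟨N, mem_nhdsWithin_of_mem_nhds hN, h⟩

theorem Good.exists_cons {cs : List (ℕ × ℝ)} (hgood : Good n cs) (d : ℕ) :
    ∃ s : ℝ, s ≠ 0 ∧ Good n ((d, s) :: cs) := by
  have h1 : ∀ᶠ s : ℝ in 𝓝[>] 0, ∀ u : Equiv.Perm (Fin n), invCount n u = cs.length →
      ∀ x, IsCell u x → Solves cs x → osc d x s ≠ 0 := by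
    refine eventually_all.mpr fun u => ?_
    by_cases hu : invCount n u = cs.length
    · have h2 := (eventually_all_finite ((hgood u).2 hu).1).mpr fun x hx =>
        (hx.1.eventually_osc_ne_zero_ofReal d).elim fun O hO =>
          hO.2.mono fun s hs => hs x (mem_of_mem_nhds hO.1) hx.1.2
      filter_upwards [h2] with s hs _ x hx hsol using hs x ⟨hx, hsol⟩
    · exact Eventually.of_forall fun s h => absurd h hu
  have h2 : ∀ᶠ s : ℝ in 𝓝[>] 0, ∀ w : Equiv.Perm (Fin n), invCount n w = cs.length + 1 →
      {x | IsCell w x ∧ Solves ((d, s) :: cs) x}.Finite ∧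
      ∀ x, IsCell w x → Solves ((d, s) :: cs) x →
        x.map (starRingEnd ℂ) = x ∧ cellDir w ⊓ oscKer ((d, s) :: cs) x = ⊥ := by
    refine eventually_all.mpr fun w => ?_
    by_cases hw : invCount n w = cs.length + 1
    · have hb : ∀ x, IsCell w x → ∃ c, IsBorel c ∧ x * c ∈ boundedCharts n := fun x hx => by
        obtain ⟨v, c, hc, h3, h4⟩ := exists_isChart_norm_le_one hx.1.isUnit_det
        exact ⟨c, hc, Set.mem_iUnion.mpr ⟨v, h3, h4⟩⟩
      filter_upwards [locallyGood_boundedCharts hgood d hw] with s hs _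
      refine ⟨hs.1.subset fun x hx => ⟨hx.1, hx.2, hb x hx.1⟩, fun x hx hsol => ?_⟩
      obtain ⟨c, hc, hm⟩ := hb x hx
      exact hs.2 x hx hsol c hc hm
    · exact Eventually.of_forall fun s h => absurd h hw
  obtain ⟨s, hs1, hs2, hs0⟩ := (h1.and (h2.and self_mem_nhdsWithin)).exists
  refine ⟨s, ne_of_gt hs0, fun u => ⟨fun hu x hx hsol => ?_, hs2 u⟩⟩
  rw [List.length_cons, Nat.lt_succ_iff, le_iff_lt_or_eq] at hu
  rw [solves_cons] at hsol
  rcases hu with hu | hu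
  · exact (hgood u).1 hu x hx hsol.2
  · exact hs1 u hu x hx hsol.2 hsol.1

theorem exists_good (n : ℕ) (ds : List ℕ) :
    ∃ cs : List (ℕ × ℝ), cs.map Prod.fst = ds ∧ (∀ c ∈ cs, c.2 ≠ 0) ∧ Good n cs := by
  induction ds with
  | nil => exact ⟨[], rfl, by simp, good_nil n⟩
  | cons d ds ih =>
    obtain ⟨cs, rfl, h0, hgood⟩ := ih
    obtain ⟨s, hs, h⟩ := hgood.exists_cons d
    exact ⟨(d, s) :: cs, rfl, List.forall_mem_cons.mpr ⟨hs, h0⟩, h⟩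

end Analysis

/-! ### Partial flags -/

theorem col_mem_colSpan {d : ℕ} {k : Fin n} (hk : (k : ℕ) < d) (x : Matrix (Fin n) (Fin n) ℂ) :
    x.col k ∈ colSpan d x := by
  refine mem_colSpan.mpr ⟨Pi.single k 1, fun l hl => ?_, ?_⟩
  · exact Pi.single_eq_of_ne (fun h => by subst h; omega) _
  · rw [mulVec_single_one]

theorem colSpan_le {d : ℕ} {x : Matrix (Fin n) (Fin n) ℂ} {E : Submodule ℂ (Fin n → ℂ)}
    (h : ∀ k : Fin n, (k : ℕ) < d → x.col k ∈ E) : colSpan d x ≤ E := by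
  intro v hv
  obtain ⟨c, hc, rfl⟩ := mem_colSpan.mp hv
  rw [mulVec_eq_sum]
  refine Submodule.sum_mem _ fun k _ => ?_
  rw [op_smul_eq_smul]
  by_cases hk : (k : ℕ) < d
  · exact Submodule.smul_mem _ (c k) (h k hk)
  · rw [hc k (not_lt.mp hk)]
    simp

theorem colSpan_mul_le {b : Matrix (Fin n) (Fin n) ℂ} (hb : b.IsUpperTriangular) (d : ℕ)
    (g : Matrix (Fin n) (Fin n) ℂ) : colSpan d (g * b) ≤ colSpan d g := by
  intro v hv
  obtain ⟨c, hc, rfl⟩ := mem_colSpan.mp hv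
  refine mem_colSpan.mpr ⟨b *ᵥ c, fun k hk => ?_, ?_⟩
  · rw [mulVec, dotProduct]
    refine Finset.sum_eq_zero fun l _ => ?_
    rcases lt_or_ge l k with h | h
    · rw [hb h, zero_mul]
    · rw [hc l (hk.trans (Fin.le_def.mp h)), mul_zero]
  · rw [mulVec_mulVec]

theorem colSpan_mul {b : Matrix (Fin n) (Fin n) ℂ} (hb : IsBorel b) (d : ℕ)
    (g : Matrix (Fin n) (Fin n) ℂ) : colSpan d (g * b) = colSpan d g := by
  refine le_antisymm (colSpan_mul_le hb.1 d g) ?_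
  have h := colSpan_mul_le hb.inv.1 d (g * b)
  rwa [mul_assoc, mul_nonsing_inv _ hb.2, mul_one] at h

theorem conjStable_colSpan {x : Matrix (Fin n) (Fin n) ℂ} (hx : x.map (starRingEnd ℂ) = x)
    (d : ℕ) : conjStable n (colSpan d x) := by
  intro v hv
  obtain ⟨c, hc, rfl⟩ := mem_colSpan.mp hv
  refine mem_colSpan.mpr ⟨fun k => starRingEnd ℂ (c k), fun k hk => ?_, ?_⟩
  · simp only [hc k hk, map_zero]
  · funext i
    simp only [mulVec, dotProduct, map_sum, map_mul]
    refine Finset.sum_congr rfl fun k _ => ?_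
    have h : starRingEnd ℂ (x i k) = x i k := congrFun (congrFun hx i) k
    rw [h]

theorem apply_eq_zero_of_mem_oscF_zero {j : ℕ} {v : Fin n → ℂ} (hv : v ∈ oscF n j 0) {i : Fin n}
    (hi : j ≤ i) : v i = 0 := by
  induction hv using Submodule.span_induction with
  | mem v hv =>
    obtain ⟨k, rfl⟩ := hv
    have hk : (k : ℕ) ≠ i := by omega
    change iteratedDeriv (k : ℕ) (fun t : ℂ => t ^ (i : ℕ)) 0 = 0
    rw [iteratedDeriv_fun_pow_zero, if_neg hk, Nat.cast_zero]
  | zero => rfl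
  | add v v' _ _ h h' => rw [Pi.add_apply, h, h', add_zero]
  | smul c v _ h => rw [Pi.smul_apply, h, smul_zero]

theorem finrank_colSpan_inf_oscF_le (d j : ℕ) (x : Matrix (Fin n) (Fin n) ℂ) :
    finrank ℂ ↥(colSpan d x ⊓ oscF n j 0) ≤ finrank ℂ (coeffSpace d j x) := by
  refine le_trans (Submodule.finrank_mono ?_) (Submodule.finrank_map_le x.mulVecLin _)
  rintro v ⟨h1, h2⟩
  obtain ⟨c, hc, rfl⟩ := mem_colSpan.mp h1
  exact ⟨c, ⟨hc, fun i hi => apply_eq_zero_of_mem_oscF_zero h2 hi⟩, rfl⟩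

theorem schubNum_succ (u : Equiv.Perm (Fin n)) {p : ℕ} (hp : p < n) (j : ℕ) :
    schubNum n u (p + 1) j = schubNum n u p j + if (u ⟨p, hp⟩ : ℕ) < j then 1 else 0 := by
  rw [schubNum_eq_sum, schubNum_eq_sum,
    ← Finset.add_sum_erase _ _ (Finset.mem_univ (⟨p, hp⟩ : Fin n)),
    ← Finset.add_sum_erase (a := (⟨p, hp⟩ : Fin n)) _ (fun k : Fin n => if (k : ℕ) < p ∧ _ then 1 else 0)
      (Finset.mem_univ _)]
  simp only [lt_add_one, true_and, lt_irrefl, false_and, if_false, zero_add]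
  rw [add_comm]
  congr 1
  refine Finset.sum_congr rfl fun k hk => ?_
  have : (k : ℕ) ≠ p := fun h => (Finset.mem_erase.mp hk).1 (Fin.ext h)
  have h2 : (k : ℕ) < p + 1 ↔ (k : ℕ) < p := by omega
  simp only [h2]

theorem schubNum_min (u : Equiv.Perm (Fin n)) (q j : ℕ) :
    schubNum n u (min q n) (min j n) = schubNum n u q j := by
  rw [schubNum, schubNum]
  congr 1
  ext k
  have := k.2
  have := (u k).2
  simp only [Finset.mem_filter, Finset.mem_univ, true_and]
  omega

theorem schubNum_top (u w : Equiv.Perm (Fin n)) (j : ℕ) :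
    schubNum n u n j = schubNum n w n j := by
  rw [schubNum_eq_sum, schubNum_eq_sum]
  simp only [Fin.is_lt, true_and]
  rw [Equiv.sum_comp u fun k => if (k : ℕ) < j then 1 else 0,
    Equiv.sum_comp w fun k => if (k : ℕ) < j then 1 else 0]

theorem schubNum_le_of_forall_lt {u w : Equiv.Perm (Fin n)} {D : ℕ → Prop}
    (hD : ∀ q, D q → ∀ j, schubNum n w q j ≤ schubNum n u q j)
    (hu : ∀ p (hp : p + 1 < n), ¬D (p + 1) → u ⟨p, by omega⟩ < u ⟨p + 1, hp⟩) (q j : ℕ) :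
    schubNum n w q j ≤ schubNum n u q j := by
  classical
  rw [← schubNum_min w, ← schubNum_min u]
  generalize hq : min q n = q'
  generalize min j n = j
  have hq' : q' ≤ n := hq ▸ min_le_right _ _
  clear hq
  by_contra! hfail
  have hex : ∃ q, q ≤ n ∧ schubNum n u q j < schubNum n w q j := ⟨q', hq', hfail⟩
  obtain ⟨hle, hlt⟩ := Nat.find_spec hex
  have hmin := fun p => Nat.find_min hex (m := p)
  generalize Nat.find hex = q₀ at hle hlt hmin
  obtain _ | p := q₀
  · simp [schubNum] at hlt
  have hp := hmin p (Nat.lt_succ_self p)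
  have h1 : ∀ k, ∀ h : p + k < n, schubNum n u (p + k + 1) j < schubNum n w (p + k + 1) j ∧
      j ≤ u ⟨p + k, h⟩ := by
    intro k
    induction k with
    | zero =>
      intro h
      replace h : p < n := h
      refine ⟨hlt, show j ≤ u ⟨p, h⟩ from ?_⟩
      rw [schubNum_succ u h, schubNum_succ w h] at hlt
      by_contra! h2
      rw [if_pos h2] at hlt
      split_ifs at hlt <;> omega
    | succ k ih =>
      intro h
      replace h : p + k + 1 < n := h
      obtain ⟨h2, h3⟩ := ih (by omega)
      have h4 := hu (p + k) h fun h => (hD _ h j).not_gt h2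
      have h5 : j ≤ u ⟨p + k + 1, h⟩ := h3.trans (Fin.le_def.mp h4.le)
      refine ⟨?_, h5⟩
      change schubNum n u (p + k + 1 + 1) j < schubNum n w (p + k + 1 + 1) j
      rw [schubNum_succ u h, schubNum_succ w h, if_neg (not_lt.mpr h5)]
      omega
  obtain ⟨k, hk⟩ := Nat.exists_eq_add_of_le hle
  have h2 := (h1 k (by omega)).1
  rw [show p + k + 1 = n by omega, schubNum_top u w] at h2
  exact lt_irrefl _ h2

theorem exists_linearIndependent_adapted {m : ℕ} {d : Fin m → ℕ}
    {E : Fin m → Submodule ℂ (Fin n → ℂ)} (hE : Monotone E)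
    (hfin : ∀ i, finrank ℂ (E i) = d i) (q : ℕ) (hq : q ≤ n) :
    ∃ v : Fin q → Fin n → ℂ, LinearIndependent ℂ v ∧
      ∀ (k : Fin q) (i : Fin m), (k : ℕ) < d i → v k ∈ E i := by
  induction q with
  | zero => exact ⟨Fin.elim0, linearIndependent_empty_type, fun k => k.elim0⟩
  | succ q ih =>
    obtain ⟨v, hv, hmem⟩ := ih (by omega)
    have hspan := finrank_span_eq_card hv
    rw [Fintype.card_fin] at hspan
    have hout : ∀ F : Submodule ℂ (Fin n → ℂ), q < finrank ℂ F →
        ∃ y ∈ F, y ∉ Submodule.span ℂ (Set.range v) := by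
      intro F hF
      by_contra! h
      have := Submodule.finrank_mono (show F ≤ Submodule.span ℂ (Set.range v) from h)
      omega
    obtain ⟨y, hy, hyE⟩ : ∃ y, y ∉ Submodule.span ℂ (Set.range v) ∧ ∀ i, q < d i → y ∈ E i := by
      by_cases hne : {i | q < d i}.Nonempty
      · obtain ⟨i, hi, hmin⟩ := wellFounded_lt.has_min _ hne
        obtain ⟨y, hy, hy'⟩ := hout (E i) (by rw [hfin]; exact hi)
        exact ⟨y, hy', fun i' hi' => hE (not_lt.mp (hmin i' hi')) hy⟩
      · obtain ⟨y, -, hy⟩ := hout ⊤ (by rw [finrank_top, finrank_fin_fun]; omega)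
        exact ⟨y, hy, fun i hi => absurd ⟨i, hi⟩ hne⟩
    refine ⟨Fin.snoc v y, linearIndependent_finSnoc.mpr ⟨hv, hy⟩, fun k => ?_⟩
    refine Fin.lastCases ?_ (fun k => ?_) k
    · intro i hi
      rw [Fin.snoc_last]
      exact hyE i hi
    · intro i hi
      rw [Fin.snoc_castSucc]
      exact hmem k i hi

theorem exists_colSpan_eq {m : ℕ} {d : Fin m → ℕ}
    {E : Fin m → Submodule ℂ (Fin n → ℂ)} (hE : Monotone E)
    (hfin : ∀ i, finrank ℂ (E i) = d i) :
    ∃ g : Matrix (Fin n) (Fin n) ℂ, IsUnit g.det ∧ ∀ i, E i = colSpan (d i) g := by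
  obtain ⟨v, hv, hmem⟩ := exists_linearIndependent_adapted hE hfin n le_rfl
  have hd : ∀ i, d i ≤ n := fun i => by
    rw [← hfin]
    exact (Submodule.finrank_le (E i)).trans_eq (finrank_fin_fun ℂ)
  refine ⟨(of v)ᵀ, ?_, fun i => ?_⟩
  · rw [det_transpose, ← isUnit_iff_isUnit_det, ← linearIndependent_rows_iff_isUnit]
    exact hv
  · refine le_antisymm ?_ (colSpan_le fun k hk => hmem k i hk)
    have h1 : LinearIndependent ℂ (v ∘ Fin.castLE (hd i)) :=
      hv.comp _ (Fin.castLE_injective (hd i))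
    have h2 : Submodule.span ℂ (Set.range (v ∘ Fin.castLE (hd i))) = E i := by
      refine Submodule.eq_of_le_of_finrank_eq (Submodule.span_le.mpr ?_) ?_
      · rintro _ ⟨k, rfl⟩
        exact hmem _ i k.2
      · rw [finrank_span_eq_card h1, Fintype.card_fin, hfin]
    rw [← h2, Submodule.span_le]
    rintro _ ⟨k, rfl⟩
    exact col_mem_colSpan (d := d i) (k := Fin.castLE (hd i) k) k.2 (of v)ᵀ

/-- Exchanging two adjacent columns of a cell matrix at a descent and clearing the new pivot row
gives a matrix in a smaller cell. -/
theorem IsCell.exists_mul_swap {u : Equiv.Perm (Fin n)} {x : Matrix (Fin n) (Fin n) ℂ}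
    (hx : IsCell u x) {a b : Fin n} (hab : (b : ℕ) = a + 1) (hu : u b < u a) :
    ∃ y, IsCell (u * Equiv.swap a b) y ∧ ∀ d : ℕ, d ≠ a + 1 → colSpan d y = colSpan d x := by
  have hne : b ≠ a := fun h => by rw [h] at hab; omega
  have hlt : a < b := Fin.lt_def.mpr (by omega)
  set y : Matrix (Fin n) (Fin n) ℂ := of fun i k =>
    if k = a then x i b else if k = b then x i a - x (u b) a * x i b else x i k with hy
  have ya : ∀ i, y i a = x i b := fun i => by simp [hy]
  have yb : ∀ i, y i b = x i a - x (u b) a * x i b := fun i => by simp [hy, hne]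
  have yk : ∀ i k, k ≠ a → k ≠ b → y i k = x i k := fun i k h1 h2 => by simp [hy, h1, h2]
  have ua : (u * Equiv.swap a b) a = u b := by simp
  have ub : (u * Equiv.swap a b) b = u a := by simp
  have uk : ∀ k, k ≠ a → k ≠ b → (u * Equiv.swap a b) k = u k := fun k h1 h2 => by
    simp [Equiv.swap_apply_of_ne_of_ne h1 h2]
  refine ⟨y, ⟨⟨fun k => ?_, fun k l hkl => ?_⟩, fun i k hik => ?_⟩, fun d hd => ?_⟩
  · by_cases h1 : k = a
    · rw [h1, ua, ya, hx.1.1]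
    by_cases h2 : k = b
    · rw [h2, ub, yb, hx.1.1, hx.1.2 a b hlt, mul_zero, sub_zero]
    rw [uk k h1 h2, yk _ k h1 h2, hx.1.1]
  · by_cases h1 : k = a
    · rw [h1] at hkl ⊢
      rw [ua]
      by_cases h2 : l = b
      · rw [h2, yb, hx.1.1, mul_one, sub_self]
      · have hbl : b < l := by
          have := Fin.val_ne_of_ne h2
          rw [Fin.lt_def] at hkl ⊢
          omega
        rw [yk _ l hkl.ne' h2, hx.1.2 b l hbl]
    by_cases h2 : k = b
    · rw [h2] at hkl ⊢
      rw [ub, yk _ l (hlt.trans hkl).ne' hkl.ne', hx.1.2 a l (hlt.trans hkl)]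
    rw [uk k h1 h2]
    by_cases h3 : l = a
    · rw [h3] at hkl ⊢
      rw [ya, hx.1.2 k b (hkl.trans hlt)]
    by_cases h4 : l = b
    · rw [h4] at hkl ⊢
      have hka : k < a := by
        have := Fin.val_ne_of_ne h1
        rw [Fin.lt_def] at hkl ⊢
        omega
      rw [yb, hx.1.2 k a hka, hx.1.2 k b hkl, mul_zero, sub_zero]
    rw [yk _ l h3 h4, hx.1.2 k l hkl]
  · by_cases h1 : k = a
    · rw [h1, ua] at hik
      rw [h1, ya, hx.2 i b hik]
    by_cases h2 : k = b
    · rw [h2, ub] at hik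
      rw [h2, yb, hx.2 i a hik, hx.2 i b (hu.trans hik), mul_zero, sub_zero]
    rw [uk k h1 h2] at hik
    rw [yk _ k h1 h2, hx.2 i k hik]
  · have ca : y.col a = x.col b := funext ya
    have cb : y.col b = x.col a - x (u b) a • x.col b := funext yb
    have ck : ∀ k, k ≠ a → k ≠ b → y.col k = x.col k :=
      fun k h1 h2 => funext fun i => yk i k h1 h2
    refine le_antisymm (colSpan_le fun k hk => ?_) (colSpan_le fun k hk => ?_)
    · by_cases h1 : k = a
      · rw [h1] at hk ⊢
        rw [ca]
        exact col_mem_colSpan (by omega) x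
      by_cases h2 : k = b
      · rw [h2] at hk ⊢
        rw [cb]
        exact Submodule.sub_mem _ (col_mem_colSpan (by omega) x)
          (Submodule.smul_mem _ _ (col_mem_colSpan hk x))
      rw [ck k h1 h2]
      exact col_mem_colSpan hk x
    · by_cases h1 : k = a
      · rw [h1] at hk ⊢
        have h : x.col a = y.col b + x (u b) a • y.col a := by rw [ca, cb, sub_add_cancel]
        rw [h]
        exact Submodule.add_mem _ (col_mem_colSpan (by omega) y)
          (Submodule.smul_mem _ _ (col_mem_colSpan hk y))
      by_cases h2 : k = b
      · rw [h2] at hk ⊢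
        rw [← ca]
        exact col_mem_colSpan (by omega) y
      rw [← ck k h1 h2]
      exact col_mem_colSpan hk y

/-- Every partial flag is spanned by the columns of a cell matrix whose permutation has descents
only at the dimensions of the flag. -/
theorem exists_isCell_of_flag {m : ℕ} {d : Fin m → ℕ} {E : Fin m → Submodule ℂ (Fin n → ℂ)}
    (hE : Monotone E) (hfin : ∀ i, finrank ℂ (E i) = d i) :
    ∃ u x, IsCell u x ∧ (∀ i, E i = colSpan (d i) x) ∧
      ∀ p (hp : p + 1 < n), (∀ i, d i ≠ p + 1) →
        u ⟨p, Nat.lt_of_succ_lt hp⟩ < u ⟨p + 1, hp⟩ := by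
  have hex : ∃ N u x, invCount n u = N ∧ IsCell u x ∧ ∀ i, E i = colSpan (d i) x := by
    obtain ⟨g, hg, hgE⟩ := exists_colSpan_eq hE hfin
    obtain ⟨u, b, hb, hx⟩ := exists_isCell hg
    exact ⟨_, u, g * b, rfl, hx, fun i => by rw [colSpan_mul hb, hgE]⟩
  classical
  obtain ⟨u, x, hN, hx, hxE⟩ := Nat.find_spec hex
  refine ⟨u, x, hx, hxE, fun p hp hd => ?_⟩
  by_contra hlt
  have hne : (⟨p, Nat.lt_of_succ_lt hp⟩ : Fin n) ≠ ⟨p + 1, hp⟩ := by simp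
  have hu := lt_of_le_of_ne (not_lt.mp hlt) (u.injective.ne hne.symm)
  obtain ⟨y, hy, hyE⟩ := hx.exists_mul_swap (a := ⟨p, Nat.lt_of_succ_lt hp⟩) rfl hu
  refine Nat.find_min hex ?_ ⟨_, y, rfl, hy, fun i => by rw [hyE _ (hd i), hxE i]⟩
  rw [← hN]
  have h := invCount_lt_mul_swap (u * Equiv.swap ⟨p, Nat.lt_of_succ_lt hp⟩ ⟨p + 1, hp⟩)
    (a := ⟨p, Nat.lt_of_succ_lt hp⟩) (b := ⟨p + 1, hp⟩) (by simp) (by simpa using hu)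
  rwa [mul_assoc, Equiv.swap_mul_self, mul_one] at h

theorem schubNum_le_of_flag {m : ℕ} {d : Fin m → ℕ} {E : Fin m → Submodule ℂ (Fin n → ℂ)}
    {w u : Equiv.Perm (Fin n)} {x : Matrix (Fin n) (Fin n) ℂ} (hx : IsCell u x)
    (hxE : ∀ i, E i = colSpan (d i) x)
    (hdesc : ∀ p (hp : p + 1 < n), (∀ i, d i ≠ p + 1) →
      u ⟨p, Nat.lt_of_succ_lt hp⟩ < u ⟨p + 1, hp⟩)
    (hw : ∀ i j, j ≤ n → schubNum n w (d i) j ≤ finrank ℂ ↥(E i ⊓ oscF n j 0)) (q j : ℕ) :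
    schubNum n w q j ≤ schubNum n u q j := by
  refine schubNum_le_of_forall_lt (D := fun q => q = n ∨ ∃ i, d i = q) ?_ ?_ q j
  · rintro q (rfl | ⟨i, rfl⟩) j
    · exact (schubNum_top w u j).le
    · rw [← schubNum_min w, ← schubNum_min u]
      have hmin : ∀ v : Equiv.Perm (Fin n), schubNum n v (min (d i) n) (min j n)
          = schubNum n v (d i) (min j n) := fun v => by
        rw [← schubNum_min v (d i) (min j n), min_assoc, min_self]
      rw [hmin, hmin, ← hx.finrank_coeffSpace]
      refine (hw i _ (min_le_right j n)).trans ?_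
      rw [hxE i]
      exact finrank_colSpan_inf_oscF_le _ _ x
  · intro p hp hD
    push Not at hD
    exact hdesc p hp hD.2

end SchubertCell

open SchubertCell

/-- Corollary 2.2 (transversality weakened to finiteness): for dimensions
`0 = d₀ < d₁ < ⋯ < d_m < n`, a permutation `w ∈ S_n` with descent set contained in
`{d₁,…,d_m}`, `r = ℓ(w)`, and any list `i₁,…,i_r` of indices in `{1,…,m}`, there are real
numbers `s₁,…,s_r` such that the set of partial flags of type `d` lying in `X_w F_•(0)`
and with `E_{d_{i_k}} ∩ F_{n−d_{i_k}}(s_k) ≠ 0` for all `k` is finite and consists only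
of real flags. -/
theorem stmt_3 (n m : ℕ) (d : Fin (m + 1) → ℕ) (hd0 : d 0 = 0)
    (hmono : StrictMono d) (hdn : d (Fin.last m) < n)
    (w : Equiv.Perm (Fin n))
    (hdesc : ∀ (q : ℕ) (hq : q + 1 < n),
      ((w ⟨q + 1, hq⟩ : Fin n) : ℕ) < ((w ⟨q, Nat.lt_of_succ_lt hq⟩ : Fin n) : ℕ) →
        ∃ i : Fin m, d i.succ = q + 1)
    (idx : Fin (invCount n w) → Fin m) :
    ∃ s : Fin (invCount n w) → ℝ,
      {E : Fin m → Submodule ℂ (Fin n → ℂ) |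
          Monotone E ∧ (∀ i, Module.finrank ℂ (E i) = d i.succ) ∧
          (∀ (i : Fin m) (j : ℕ), j ≤ n →
            schubNum n w (d i.succ) j ≤ Module.finrank ℂ ↥(E i ⊓ oscF n j 0)) ∧
          ∀ k, E (idx k) ⊓ oscF n (n - d (idx k).succ) ((s k : ℝ) : ℂ) ≠ ⊥}.Finite ∧
      ∀ E ∈ {E : Fin m → Submodule ℂ (Fin n → ℂ) |
          Monotone E ∧ (∀ i, Module.finrank ℂ (E i) = d i.succ) ∧
          (∀ (i : Fin m) (j : ℕ), j ≤ n →
            schubNum n w (d i.succ) j ≤ Module.finrank ℂ ↥(E i ⊓ oscF n j 0)) ∧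
          ∀ k, E (idx k) ⊓ oscF n (n - d (idx k).succ) ((s k : ℝ) : ℂ) ≠ ⊥},
        ∀ i : Fin m, conjStable n (E i) := by
  obtain ⟨cs, hds, hne, hgood⟩ := exists_good n (List.ofFn fun k => d (idx k).succ)
  have hlen : cs.length = invCount n w := by
    rw [← List.length_map (f := Prod.fst), hds, List.length_ofFn]
  have hfst : ∀ k : Fin cs.length, cs[k].1 = d (idx (Fin.cast hlen k)).succ := fun k => by
    have h : (cs.map Prod.fst)[(k : ℕ)]? = some cs[k].1 := by simp
    rw [hds] at h
    have hk : (k : ℕ) < invCount n w := hlen ▸ k.2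
    simp only [List.getElem?_ofFn, hk, dif_pos] at h
    exact (Option.some.inj h).symm
  suffices key : ∀ E : Fin m → Submodule ℂ (Fin n → ℂ), Monotone E →
      (∀ i, Module.finrank ℂ (E i) = d i.succ) →
      (∀ (i : Fin m) (j : ℕ), j ≤ n →
        schubNum n w (d i.succ) j ≤ Module.finrank ℂ ↥(E i ⊓ oscF n j 0)) →
      (∀ k, E (idx k) ⊓ oscF n (n - d (idx k).succ)
        ((cs[Fin.cast hlen.symm k].2 : ℝ) : ℂ) ≠ ⊥) →
      ∃ x, IsCell w x ∧ Solves cs x ∧ E = fun i => colSpan (d i.succ) x by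
    refine ⟨fun k => cs[Fin.cast hlen.symm k].2, ?_, ?_⟩
    · refine (((hgood w).2 hlen.symm).1.image fun x i => colSpan (d (Fin.succ i)) x).subset ?_
      rintro E ⟨h1, h2, h3, h4⟩
      obtain ⟨x, hx, hs, rfl⟩ := key E h1 h2 h3 h4
      exact ⟨x, ⟨hx, hs⟩, rfl⟩
    · rintro E ⟨h1, h2, h3, h4⟩ i
      obtain ⟨x, hx, hs, rfl⟩ := key E h1 h2 h3 h4
      exact conjStable_colSpan (((hgood w).2 hlen.symm).2 x hx hs).1 _
  intro E hE hfin hw hosc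
  obtain ⟨u, x, hx, hxE, hu⟩ := exists_isCell_of_flag (d := fun i => d i.succ) hE hfin
  have hsolves : Solves cs x := by
    intro c hc
    obtain ⟨k, hk, rfl⟩ := List.mem_iff_getElem.mp hc
    have h := hosc (Fin.cast hlen ⟨k, hk⟩)
    have hk' := hfst ⟨k, hk⟩
    rw [hxE, ← hk'] at h
    exact osc_eq_zero_of_inf_oscF_ne_bot (by exact_mod_cast hne _ hc) h
  have huw : u = w := by
    by_contra hne'
    have hlt := invCount_lt_of_schubNum_le (schubNum_le_of_flag hx hxE hu hw) hne'
    exact (hgood u).1 (hlen.symm ▸ hlt) x hx hsolves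
  exact ⟨x, huw ▸ hx, hsolves, funext hxE⟩
end
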